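/- (Weak Harnack inequality.) Let u be a weak supersolution of ∂ₜu + 𝓛u = Δu in Ω × (0,T) with u ≥ 0 on B_R(x₀) × (t₀ − r², t₀ + r²), where B_R(x₀) × (t₀ − r², t₀ + r²) ⊂ Ω × (0,T), 0 < r ≤ 1 and r < R/2. Set 𝒯 = (r/R)² · Tail_∞(u₋; x₀, R, t₀ − r², t₀ + r²), and set κ = 2N/(N − 2) if N > 2 and κ = 4 if N = 2. Then for every q with 0 < q < 2 − 2/κ there exists a constant C > 0 depending only on N, s, Λ and q such that ( ⨍_{V⁻(r/2)} (u + 𝒯)^q dx dt )^{1/q} ≤ C · ( essinf_{V⁺(r/2)} u + 𝒯 ), where V⁻(r/2) = B_{r/2}(x₀) × (t₀ − r², t₀ − 3r²/4) and V⁺(r/2) = B_{r/2}(x₀) × (t₀ + 3r²/4, t₀ + r²). -/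

import Mathlib

open MeasureTheory Metric Set
open scoped RealInnerProductSpace ENNReal

noncomputable section

/-- Euclidean space `ℝ^N`. -/
abbrev E (N : ℕ) : Type := EuclideanSpace ℝ (Fin N)

/-- The kernel `K` is measurable, symmetric in its first two arguments, and comparable to
the fractional kernel `|x-y|^{-(N+2s)}` with constant `Λ`, uniformly for `t ∈ (0,T)`. -/
def KernelOK (N : ℕ) (s Λ T : ℝ) (K : E N → E N → ℝ → ℝ) : Prop :=
  Measurable (fun p : E N × E N × ℝ => K p.1 p.2.1 p.2.2) ∧
  (∀ x y t, K x y t = K y x t) ∧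
  ∀ x y : E N, x ≠ y → ∀ t ∈ Set.Ioo 0 T,
    Λ⁻¹ * ‖x - y‖ ^ (-((N : ℝ) + 2 * s)) ≤ K x y t ∧
      K x y t ≤ Λ * ‖x - y‖ ^ (-((N : ℝ) + 2 * s))

/-- `u` is a (bounded, measurable, smooth in `Ω × (0,T)`) weak supersolution of
`∂ₜ u + 𝓛 u = Δ u` in `Ω × (0,T)`. -/
def IsWeakSupersolution (N : ℕ) (T : ℝ) (K : E N → E N → ℝ → ℝ)
    (Ω : Set (E N)) (u : E N → ℝ → ℝ) : Prop :=
  Measurable (fun p : E N × ℝ => u p.1 p.2) ∧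
  (∃ M : ℝ, ∀ x t, t ∈ Set.Ioo 0 T → |u x t| ≤ M) ∧
  ContDiffOn ℝ (⊤ : ℕ∞) (fun p : E N × ℝ => u p.1 p.2) (Ω ×ˢ Set.Ioo 0 T) ∧
  ∀ φ : E N → ℝ → ℝ,
    ContDiff ℝ (⊤ : ℕ∞) (fun p : E N × ℝ => φ p.1 p.2) →
    HasCompactSupport (fun p : E N × ℝ => φ p.1 p.2) →
    tsupport (fun p : E N × ℝ => φ p.1 p.2) ⊆ Ω ×ˢ Set.Ioo 0 T →
    (∀ x t, 0 ≤ φ x t) →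
    0 ≤ -(∫ t in Set.Ioo 0 T, ∫ x in Ω, u x t * deriv (fun τ => φ x τ) t) +
        (∫ t in Set.Ioo 0 T, ∫ x in Ω,
          ⟪gradient (fun y => u y t) x, gradient (fun y => φ y t) x⟫) +
        ∫ t in Set.Ioo 0 T, ∫ x : E N, ∫ y : E N,
          (u x t - u y t) * (φ x t - φ y t) * K x y t

/-- The negative part `u₋ = max(-u, 0)`. -/
def uminus (N : ℕ) (u : E N → ℝ → ℝ) : E N → ℝ → ℝ := fun x t => max (-(u x t)) 0

/-- The parabolic tail `Tail_∞(w; x₀, ρ, t₁, t₂)`. -/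
def tailInfty (N : ℕ) (s : ℝ) (w : E N → ℝ → ℝ) (x₀ : E N) (ρ t₁ t₂ : ℝ) : ℝ :=
  ρ ^ 2 * essSup
      (fun t => ∫ y in (Metric.ball x₀ ρ)ᶜ, |w y t| * ‖y - x₀‖ ^ (-((N : ℝ) + 2 * s)))
      (volume.restrict (Set.Ioo t₁ t₂))

/-- The Sobolev exponent: `κ = 2N/(N-2)` for `N > 2` and `κ = 4` for `N = 2`. -/
def kappa (N : ℕ) : ℝ := if 2 < N then 2 * N / ((N : ℝ) - 2) else 4

lemma holder_ab {α : Type*} [MeasurableSpace α] {μ : Measure α} {f g : α → ℝ} {a b : ℝ}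
    (ha : 0 ≤ a) (hb : 0 ≤ b) (hab : a + b = 1) (hf : Integrable f μ) (hg : Integrable g μ)
    (hf0 : ∀ x, 0 ≤ f x) (hg0 : ∀ x, 0 ≤ g x) :
    ∫ x, f x ^ a * g x ^ b ∂μ ≤ (∫ x, f x ∂μ) ^ a * (∫ x, g x ∂μ) ^ b := by
  have h := ENNReal.lintegral_mul_norm_pow_le (μ := μ) (f := fun x => ENNReal.ofReal (f x))
    (g := fun x => ENNReal.ofReal (g x)) hf.1.aemeasurable.ennreal_ofReal
    hg.1.aemeasurable.ennreal_ofReal ha hb hab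
  rw [← ofReal_integral_eq_lintegral_ofReal hf (ae_of_all _ hf0),
    ← ofReal_integral_eq_lintegral_ofReal hg (ae_of_all _ hg0),
    ENNReal.ofReal_rpow_of_nonneg (integral_nonneg hf0) ha,
    ENNReal.ofReal_rpow_of_nonneg (integral_nonneg hg0) hb,
    ← ENNReal.ofReal_mul (Real.rpow_nonneg (integral_nonneg hf0) _)] at h
  rw [integral_eq_lintegral_of_nonneg_ae]
  · apply ENNReal.toReal_le_of_le_ofReal
    · exact mul_nonneg (Real.rpow_nonneg (integral_nonneg hf0) _)
        (Real.rpow_nonneg (integral_nonneg hg0) _)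
    · refine le_trans (le_of_eq ?_) h
      congr 1; ext x
      rw [ENNReal.ofReal_mul (Real.rpow_nonneg (hf0 x) _), ENNReal.ofReal_rpow_of_nonneg (hf0 x) ha,
        ENNReal.ofReal_rpow_of_nonneg (hg0 x) hb]
  · exact ae_of_all _ fun x => mul_nonneg (Real.rpow_nonneg (hf0 x) _) (Real.rpow_nonneg (hg0 x) _)
  · exact ((hf.1.aemeasurable.pow_const a).mul (hg.1.aemeasurable.pow_const b)).aestronglyMeasurable

/-- continuous integrand vanishing outside a compact is integrable -/
lemma cs_int {N : ℕ} {f : E N → ℝ} (hf : Continuous f) (hc : HasCompactSupport f) :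
    Integrable f := hf.integrable_of_hasCompactSupport hc

/-- the parabolic exponent -/
def chi (N : ℕ) : ℝ := 1 + 2 / N

lemma chi_gt {N : ℕ} (hN : 2 ≤ N) : 1 < chi N := by
  unfold chi; have : (0:ℝ) < N := by positivity
  linarith [div_pos two_pos this]

lemma gn_ge3 {N : ℕ} (hN : 3 ≤ N) : ∃ C : ℝ, 0 < C ∧ ∀ f : E N → ℝ, ContDiff ℝ 1 f →
    HasCompactSupport f → ∫ x, |f x| ^ (2 * chi N) ≤
      C * (∫ x, f x ^ 2) ^ (chi N - 1) * ∫ x, ‖fderiv ℝ f x‖ ^ 2 := by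
  have hN0 : (3:ℝ) ≤ N := by exact_mod_cast hN
  set ps : ℝ := 2 * N / (N - 2) with hps
  have hps0 : 0 < ps := by rw [hps]; apply div_pos <;> linarith
  set K : ℝ := (SNormLESNormFDerivOfEqConst ℝ (volume : Measure (E N)) 2 : ℝ) with hK
  have hK0 : 0 ≤ K := NNReal.coe_nonneg _
  refine ⟨K ^ 2 + 1, by positivity, fun f hf hc => ?_⟩
  have hcf : Continuous f := hf.continuous
  have hcd : Continuous (fderiv ℝ f) := hf.continuous_fderiv (by norm_num)
  have i2 : Integrable (fun x => f x ^ 2) :=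
    cs_int (hcf.pow 2) (by simpa [Function.comp_def] using hc.comp_left (g := fun y : ℝ => y ^ 2) (by simp))
  have ips : Integrable (fun x => |f x| ^ ps) :=
    cs_int (hcf.abs.rpow_const (fun x => Or.inr hps0.le))
      (by simpa [Function.comp_def] using hc.comp_left (g := fun y : ℝ => |y| ^ ps) (by simp [hps0.ne']))
  have id2 : Integrable (fun x => ‖fderiv ℝ f x‖ ^ 2) :=
    cs_int (hcd.norm.pow 2) (by simpa [Function.comp_def] using
      (hc.fderiv (𝕜 := ℝ)).comp_left (g := fun y : E N →L[ℝ] ℝ => ‖y‖ ^ 2) (by simp))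
  have h1 := eLpNorm_le_eLpNorm_fderiv_of_eq (volume : Measure (E N)) hf hc (p := 2) (p' := ps.toNNReal)
    (by norm_num) (by simp; omega) (by
      rw [Real.coe_toNNReal _ hps0.le]; simp [hps]
      field_simp)
  have h2 : (∫ x, |f x| ^ ps) ^ (1 / ps) ≤ K * (∫ x, ‖fderiv ℝ f x‖ ^ 2) ^ (1/2 : ℝ) := by
    have e1 : eLpNorm f ps.toNNReal volume = ENNReal.ofReal ((∫ x, |f x| ^ ps) ^ (1 / ps)) := by
      rw [eLpNorm_eq_lintegral_rpow_enorm_toReal (by simpa using hps0) (by simp)]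
      simp only [ENNReal.coe_toReal, Real.coe_toNNReal _ hps0.le]
      rw [← ENNReal.ofReal_rpow_of_nonneg (integral_nonneg fun x => by positivity) (by positivity),
        ofReal_integral_eq_lintegral_ofReal ips (ae_of_all _ fun x => by positivity)]
      congr 2; ext x
      rw [← ENNReal.ofReal_rpow_of_nonneg (abs_nonneg _) hps0.le, Real.enorm_eq_ofReal_abs]
    have e2 : eLpNorm (fderiv ℝ f) ((2:NNReal):ℝ≥0∞) volume =
        ENNReal.ofReal ((∫ x, ‖fderiv ℝ f x‖ ^ 2) ^ (1/2 : ℝ)) := by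
      rw [eLpNorm_eq_lintegral_rpow_enorm_toReal (by simp) (by simp)]
      rw [← ENNReal.ofReal_rpow_of_nonneg (integral_nonneg fun x => by positivity) (by positivity),
        ofReal_integral_eq_lintegral_ofReal id2 (ae_of_all _ fun x => by positivity)]
      simp only [ENNReal.coe_toReal, NNReal.coe_ofNat]
      congr 2; ext x
      rw [← ofReal_norm_eq_enorm, ENNReal.ofReal_rpow_of_nonneg (norm_nonneg _) (by norm_num)]
      norm_num
    rw [e1, e2, ← ENNReal.ofReal_coe_nnreal, ← ENNReal.ofReal_mul (NNReal.coe_nonneg _)] at h1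
    exact (ENNReal.ofReal_le_ofReal_iff (by positivity)).1 h1
  have hI := holder_ab (a := 2 / N) (b := (N - 2) / N) (by positivity)
    (div_nonneg (by linarith) (by linarith)) (by field_simp; ring) i2 ips (fun x => by positivity)
    (fun x => by positivity)
  have e3 : ∀ x, (f x ^ 2) ^ (2 / N : ℝ) * (|f x| ^ ps) ^ ((N - 2) / N : ℝ) = |f x| ^ (2 * chi N) := by
    intro x
    rw [← sq_abs, ← Real.rpow_natCast, ← Real.rpow_mul (abs_nonneg _), ← Real.rpow_mul (abs_nonneg _),
      ← Real.rpow_add_of_nonneg (abs_nonneg _) (by positivity)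
        (mul_nonneg hps0.le (div_nonneg (by linarith) (by linarith)))]
    congr 1
    have : (N:ℝ) - 2 ≠ 0 := by linarith
    rw [hps, chi]; push_cast; field_simp; ring
  simp_rw [e3] at hI
  have hI0 : 0 ≤ ∫ x, |f x| ^ ps := integral_nonneg fun x => by positivity
  have hD0 : 0 ≤ ∫ x, ‖fderiv ℝ f x‖ ^ 2 := integral_nonneg fun x => by positivity
  have h3 : (∫ x, |f x| ^ ps) ^ ((N - 2) / N : ℝ) ≤ K ^ 2 * ∫ x, ‖fderiv ℝ f x‖ ^ 2 := by
    have e : ((∫ x, |f x| ^ ps) ^ (1 / ps)) ^ 2 = (∫ x, |f x| ^ ps) ^ ((N - 2) / N : ℝ) := by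
      rw [← Real.rpow_natCast, ← Real.rpow_mul hI0]
      congr 1
      have : (N:ℝ) - 2 ≠ 0 := by linarith
      rw [hps]; push_cast; field_simp
    rw [← e]
    calc _ ≤ (K * (∫ x, ‖fderiv ℝ f x‖ ^ 2) ^ (1/2 : ℝ)) ^ 2 := by
          apply pow_le_pow_left₀ _ h2; exact Real.rpow_nonneg hI0 _
      _ = _ := by
          rw [mul_pow, ← Real.rpow_natCast, ← Real.rpow_natCast (_ ^ (1/2:ℝ)), ← Real.rpow_mul hD0]; norm_num
  have e4 : chi N - 1 = 2 / N := by unfold chi; ring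
  rw [e4]
  calc _ ≤ _ := hI
    _ ≤ (∫ x, f x ^ 2) ^ (2 / N : ℝ) * (K ^ 2 * ∫ x, ‖fderiv ℝ f x‖ ^ 2) := by
        apply mul_le_mul_of_nonneg_left h3; apply Real.rpow_nonneg; exact integral_nonneg fun x => by positivity
    _ ≤ (∫ x, f x ^ 2) ^ (2 / N : ℝ) * ((K ^ 2 + 1) * ∫ x, ‖fderiv ℝ f x‖ ^ 2) := by
        apply mul_le_mul_of_nonneg_left _ (Real.rpow_nonneg (integral_nonneg fun x => by positivity) _)
        apply mul_le_mul_of_nonneg_right _ hD0; linarith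
    _ = _ := by ring

lemma cauchy_sq {N : ℕ} {f g : E N → ℝ} (hf : Integrable fun x => f x ^ 2)
    (hg : Integrable fun x => g x ^ 2) :
    (∫ x, |f x| * |g x|) ^ 2 ≤ (∫ x, f x ^ 2) * ∫ x, g x ^ 2 := by
  have h := holder_ab (a := 1/2) (b := 1/2) (by norm_num) (by norm_num) (by norm_num) hf hg
    (fun x => by positivity) (fun x => by positivity)
  have e : ∀ y : ℝ, (y ^ 2) ^ (1/2 : ℝ) = |y| := fun y => by
    rw [← Real.sqrt_eq_rpow, Real.sqrt_sq_eq_abs]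
  simp_rw [e] at h
  have hf0 : 0 ≤ ∫ x, f x ^ 2 := integral_nonneg fun x => by positivity
  have hg0 : 0 ≤ ∫ x, g x ^ 2 := integral_nonneg fun x => by positivity
  calc _ ≤ ((∫ x, f x ^ 2) ^ (1/2:ℝ) * (∫ x, g x ^ 2) ^ (1/2:ℝ)) ^ 2 :=
        pow_le_pow_left₀ (integral_nonneg fun x => by positivity) h 2
    _ = _ := by
        rw [← Real.sqrt_eq_rpow, ← Real.sqrt_eq_rpow, mul_pow, Real.sq_sqrt hf0, Real.sq_sqrt hg0]

lemma gn_2 : ∃ C : ℝ, 0 < C ∧ ∀ f : E 2 → ℝ, ContDiff ℝ 1 f →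
    HasCompactSupport f → ∫ x, |f x| ^ (2 * chi 2) ≤
      C * (∫ x, f x ^ 2) ^ (chi 2 - 1) * ∫ x, ‖fderiv ℝ f x‖ ^ 2 := by
  set K : ℝ := (lintegralPowLePowLIntegralFDerivConst (volume : Measure (E 2)) 2 : ℝ) with hK
  have hK0 : 0 ≤ K := NNReal.coe_nonneg _
  refine ⟨4 * K + 1, by positivity, fun f hf hc => ?_⟩
  have hcf : Continuous f := hf.continuous
  have hcd : Continuous (fderiv ℝ f) := hf.continuous_fderiv (by norm_num)
  have i2 : Integrable (fun x => f x ^ 2) :=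
    cs_int (hcf.pow 2) (by simpa [Function.comp_def] using hc.comp_left (g := fun y : ℝ => y ^ 2) (by simp))
  have i4 : Integrable (fun x => f x ^ 4) :=
    cs_int (hcf.pow 4) (by simpa [Function.comp_def] using hc.comp_left (g := fun y : ℝ => y ^ 4) (by simp))
  have id2 : Integrable (fun x => ‖fderiv ℝ f x‖ ^ 2) :=
    cs_int (hcd.norm.pow 2) (by simpa [Function.comp_def] using
      (hc.fderiv (𝕜 := ℝ)).comp_left (g := fun y : E 2 →L[ℝ] ℝ => ‖y‖ ^ 2) (by simp))
  have ic : Integrable (fun x => 2 * (|f x| * |‖fderiv ℝ f x‖|)) :=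
    cs_int (continuous_const.mul (hcf.abs.mul hcd.norm.abs)) (by
      apply HasCompactSupport.mul_left
      apply HasCompactSupport.mul_right
      simpa [Function.comp_def] using hc.comp_left (g := fun y : ℝ => |y|) (by simp))
  have h1 := lintegral_pow_le_pow_lintegral_fderiv (volume : Measure (E 2)) (u := fun x => f x ^ 2)
    (hf.pow 2) (by simpa [Function.comp_def] using hc.comp_left (g := fun y : ℝ => y ^ 2) (by simp))
    (p := 2) (by simpa using Real.HolderConjugate.two_two)
  have hd : ∀ x, ‖fderiv ℝ (fun x => f x ^ 2) x‖ = 2 * (|f x| * |‖fderiv ℝ f x‖|) := by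
    intro x
    rw [fderiv_fun_pow 2 (hf.differentiable (by norm_num) x), norm_smul]
    simp; ring
  have e1 : ∫⁻ x, ‖f x ^ 2‖ₑ ^ (2:ℝ) = ENNReal.ofReal (∫ x, f x ^ 4) := by
    rw [ofReal_integral_eq_lintegral_ofReal i4 (ae_of_all _ fun x => by positivity)]
    congr 1; ext x
    rw [← ofReal_norm_eq_enorm, ENNReal.ofReal_rpow_of_nonneg (norm_nonneg _) (by norm_num)]
    congr 1; simp; rw [← sq_abs]; rw [sq_abs, ← pow_mul]
  have e2 : ∫⁻ x, ‖fderiv ℝ (fun x => f x ^ 2) x‖ₑ =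
      ENNReal.ofReal (2 * ∫ x, |f x| * |‖fderiv ℝ f x‖|) := by
    rw [← integral_const_mul, ofReal_integral_eq_lintegral_ofReal ic (ae_of_all _ fun x => by positivity)]
    congr 1; ext x
    rw [← ofReal_norm_eq_enorm, hd]
  have h0 : 0 ≤ 2 * ∫ x, |f x| * |‖fderiv ℝ f x‖| :=
    mul_nonneg zero_le_two (integral_nonneg fun x => by positivity)
  rw [e1, e2, ENNReal.ofReal_rpow_of_nonneg h0 (by norm_num), ← ENNReal.ofReal_coe_nnreal,
    ← ENNReal.ofReal_mul (NNReal.coe_nonneg _),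
    ENNReal.ofReal_le_ofReal_iff (mul_nonneg (NNReal.coe_nonneg _) (Real.rpow_nonneg h0 _))] at h1
  have h2 := cauchy_sq i2 id2
  have ec : chi 2 = 2 := by unfold chi; norm_num
  have e4 : ∀ x, |f x| ^ (2 * chi 2) = f x ^ 4 := by
    intro x
    rw [ec, show (2 * 2 : ℝ) = ((4:ℕ) : ℝ) by norm_num, Real.rpow_natCast]
    exact Even.pow_abs (by decide) _
  simp_rw [e4]; rw [ec, show (2:ℝ) - 1 = 1 by norm_num, Real.rpow_one]
  rw [← hK, show (2:ℝ) = ((2:ℕ):ℝ) by norm_num, Real.rpow_natCast, mul_pow] at h1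
  push_cast at h1
  have hp : 0 ≤ (∫ x, f x ^ 2) * ∫ x, ‖fderiv ℝ f x‖ ^ 2 :=
    mul_nonneg (integral_nonneg fun x => by positivity) (integral_nonneg fun x => by positivity)
  nlinarith [mul_le_mul_of_nonneg_left h2 hK0]

lemma gn {N : ℕ} (hN : 2 ≤ N) : ∃ C : ℝ, 0 < C ∧ ∀ f : E N → ℝ, ContDiff ℝ 1 f →
    HasCompactSupport f → ∫ x, |f x| ^ (2 * chi N) ≤
      C * (∫ x, f x ^ 2) ^ (chi N - 1) * ∫ x, ‖fderiv ℝ f x‖ ^ 2 := by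
  rcases Nat.lt_or_ge 2 N with h | h
  · exact gn_ge3 h
  · obtain rfl : N = 2 := le_antisymm h hN
    exact gn_2

/-- the cutoff -/
def zeta {N : ℕ} (ρ : ℝ) (x : E N) : ℝ := max (ρ ^ 2 - ‖x‖ ^ 2) 0

lemma zeta_nonneg {N : ℕ} (ρ : ℝ) (x : E N) : 0 ≤ zeta ρ x := le_max_right _ _

lemma zeta_cont {N : ℕ} (ρ : ℝ) : Continuous (zeta ρ : E N → ℝ) := by
  unfold zeta; fun_prop

lemma zeta_le {N : ℕ} (ρ : ℝ) (x : E N) : zeta ρ x ≤ ρ ^ 2 := by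
  unfold zeta; apply max_le <;> nlinarith [sq_nonneg ‖x‖, sq_nonneg ρ]

lemma zeta_le_one {N : ℕ} {ρ : ℝ} (h0 : 0 < ρ) (h1 : ρ ≤ 1) (x : E N) : zeta ρ x ≤ 1 :=
  (zeta_le ρ x).trans (by nlinarith)

lemma zeta_zero {N : ℕ} {ρ : ℝ} (h0 : 0 < ρ) {x : E N} (h : ρ ≤ ‖x‖) : zeta ρ x = 0 := by
  unfold zeta; apply max_eq_right; nlinarith

lemma zeta_zero' {N : ℕ} {ρ : ℝ} (h0 : 0 < ρ) {x : E N} (h : x ∉ closedBall (0 : E N) ρ) :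
    zeta ρ x = 0 := by
  apply zeta_zero h0; simp at h; exact h.le

lemma zeta_cs {N : ℕ} {ρ : ℝ} (h0 : 0 < ρ) : HasCompactSupport (zeta ρ : E N → ℝ) :=
  HasCompactSupport.intro (isCompact_closedBall (0 : E N) ρ) fun _ hx => zeta_zero' h0 hx

lemma zetapow_cs {N : ℕ} {ρ : ℝ} (h0 : 0 < ρ) {k : ℕ} (hk : k ≠ 0) (f : E N → ℝ) :
    HasCompactSupport (fun x => f x * zeta ρ x ^ k) :=
  HasCompactSupport.intro (isCompact_closedBall (0 : E N) ρ) fun _ hx => by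
    simp [zeta_zero' h0 hx, hk]

lemma zetapow_int {N : ℕ} {ρ : ℝ} (h0 : 0 < ρ) {k : ℕ} (hk : k ≠ 0) {f : E N → ℝ}
    (hf : Continuous f) : Integrable (fun x => f x * zeta ρ x ^ k) :=
  cs_int (hf.mul ((zeta_cont ρ).pow k)) (zetapow_cs h0 hk f)

lemma posPow_hasDeriv (k : ℕ) (s : ℝ) :
    HasDerivAt (fun s : ℝ => max s 0 ^ (k + 2)) ((k + 2) * max s 0 ^ (k + 1)) s := by
  rcases lt_trichotomy s 0 with h | h | h
  · have : (fun s : ℝ => max s 0 ^ (k + 2)) =ᶠ[nhds s] fun _ => 0 := by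
      filter_upwards [gt_mem_nhds h] with y hy
      rw [max_eq_right hy.le]; simp
    rw [max_eq_right h.le]; simp only [ne_eq, Nat.add_eq_zero_iff, one_ne_zero, and_false, not_false_eq_true, zero_pow, mul_zero]
    exact (hasDerivAt_const s (0:ℝ)).congr_of_eventuallyEq this
  · subst h
    simp only [max_self, ne_eq, Nat.add_eq_zero_iff, one_ne_zero, and_false, not_false_eq_true, zero_pow, mul_zero]
    rw [hasDerivAt_iff_isLittleO]
    simp only [max_self, ne_eq, Nat.add_eq_zero_iff, OfNat.ofNat_ne_zero, and_false, not_false_eq_true, zero_pow, sub_zero, smul_zero]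
    have h1 : (fun x : ℝ => max x 0 ^ (k + 2)) =O[nhds 0] fun x => x ^ (k+2) := by
      apply Asymptotics.IsBigO.of_bound 1
      filter_upwards with x
      rw [norm_pow, norm_pow, one_mul]
      gcongr
      rw [Real.norm_of_nonneg (le_max_right _ _)]
      exact max_le (le_abs_self x) (abs_nonneg x)
    refine h1.trans_isLittleO ?_
    simpa using (Asymptotics.isLittleO_pow_pow (𝕜 := ℝ) (show 1 < k + 2 by omega))
  · have : (fun s : ℝ => max s 0 ^ (k + 2)) =ᶠ[nhds s] fun s => s ^ (k+2) := by
      filter_upwards [lt_mem_nhds h] with y hy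
      rw [max_eq_left (le_of_lt hy)]
    rw [max_eq_left h.le]
    refine HasDerivAt.congr_of_eventuallyEq ?_ this
    simpa using hasDerivAt_pow (k+2) s

lemma posPow_contDiff (k : ℕ) : ContDiff ℝ 1 (fun s : ℝ => max s 0 ^ (k + 2)) := by
  rw [contDiff_one_iff_deriv]
  refine ⟨fun s => (posPow_hasDeriv k s).differentiableAt, ?_⟩
  rw [show deriv (fun s : ℝ => max s 0 ^ (k + 2)) = fun s : ℝ => ((k:ℝ) + 2) * max s 0 ^ (k + 1) from
    funext fun s => (posPow_hasDeriv k s).deriv]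
  fun_prop

lemma zetapow_contDiff {N : ℕ} (ρ : ℝ) (k : ℕ) : ContDiff ℝ 1 (fun x : E N => zeta ρ x ^ (k+2)) := by
  have : ContDiff ℝ 1 (fun x : E N => ρ ^ 2 - ‖x‖ ^ 2) := contDiff_const.sub (contDiff_norm_sq ℝ)
  exact (posPow_contDiff k).comp this

lemma zetapow_hasFDeriv {N : ℕ} (ρ : ℝ) (k : ℕ) (x : E N) :
    HasFDerivAt (fun x : E N => zeta ρ x ^ (k+2))
      (((k + 2) * zeta ρ x ^ (k + 1)) • (-((2:ℝ) • innerSL ℝ x))) x := by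
  have h1 : HasFDerivAt (fun x : E N => ρ ^ 2 - ‖x‖ ^ 2) (-((2:ℝ) • innerSL ℝ x)) x := by
    have := (hasStrictFDerivAt_norm_sq x).hasFDerivAt.const_sub (ρ ^ 2)
    simpa [two_smul] using this
  exact (posPow_hasDeriv k (ρ ^ 2 - ‖x‖ ^ 2)).comp_hasFDerivAt x h1

lemma div_id {N : ℕ} {h : E N → ℝ} (hh : ContDiff ℝ 1 h) (hc : HasCompactSupport h) :
    ∫ x, fderiv ℝ h x x = - N * ∫ x, h x := by
  have hcd : Continuous (fderiv ℝ h) := hh.continuous_fderiv (by norm_num)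
  have key : ∀ i : Fin N, ∫ x : E N, x i * fderiv ℝ h x (EuclideanSpace.single i 1) = - ∫ x, h x := by
    intro i
    have hd : ∀ x : E N, HasFDerivAt (fun x : E N => x i) (EuclideanSpace.proj i : E N →L[ℝ] ℝ) x :=
      fun x => (EuclideanSpace.proj (𝕜 := ℝ) i : E N →L[ℝ] ℝ).hasFDerivAt
    have hfd : ∀ x : E N, fderiv ℝ (fun x : E N => x i) x = EuclideanSpace.proj i := fun x => (hd x).fderiv
    have hci : Continuous fun x : E N => x i := (EuclideanSpace.proj (𝕜 := ℝ) i : E N →L[ℝ] ℝ).continuous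
    have := integral_mul_fderiv_eq_neg_fderiv_mul_of_integrable (𝕜 := ℝ) (μ := (volume : Measure (E N)))
      (f := fun x : E N => x i) (g := h) (v := EuclideanSpace.single i 1) ?_ ?_ ?_
      (fun x _ => (hd x).differentiableAt) (fun x _ => hh.differentiable (by norm_num) x)
    · rw [this]; simp [hfd]
    · simp only [hfd]; simpa using cs_int hh.continuous hc
    · refine cs_int (hci.mul (hcd.clm_apply continuous_const)) ?_
      exact ((hc.fderiv (𝕜 := ℝ)).mono (f := fderiv ℝ h) (by
        intro x hx; simp at hx ⊢; intro h0; simp [h0] at hx))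
    · exact cs_int (hci.mul hh.continuous) hc.mul_left
  have e : ∀ x : E N, fderiv ℝ h x x = ∑ i, x i * fderiv ℝ h x (EuclideanSpace.single i 1) := by
    intro x
    have h2 := congrArg (fderiv ℝ h x) ((EuclideanSpace.basisFun (Fin N) ℝ).sum_repr x)
    rw [← h2]
    simp only [map_sum, map_smul, smul_eq_mul, EuclideanSpace.basisFun_repr, EuclideanSpace.basisFun_apply]
  simp_rw [e]
  rw [integral_finsetSum]
  · simp_rw [key]; simp
  · intro i _
    have hci : Continuous fun x : E N => x i := (EuclideanSpace.proj (𝕜 := ℝ) i : E N →L[ℝ] ℝ).continuous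
    refine cs_int (hci.mul (hcd.clm_apply continuous_const)) ?_
    exact ((hc.fderiv (𝕜 := ℝ)).mono (f := fderiv ℝ h) (by
        intro x hx; simp at hx ⊢; intro h0; simp [h0] at hx))

lemma int_lin3 {α : Type*} [MeasurableSpace α] {μ : Measure α} {a b c : α → ℝ} (ha : Integrable a μ)
    (hb : Integrable b μ) (hc : Integrable c μ) (p q r : ℝ) :
    ∫ x, (p * a x + q * b x + r * c x) ∂μ = p * (∫ x, a x ∂μ) + q * (∫ x, b x ∂μ) + r * ∫ x, c x ∂μ := by
  have h := integral_add (μ := μ) (f := fun x => p * a x + q * b x) (g := fun x => r * c x)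
    ((ha.const_mul p).add (hb.const_mul q)) (hc.const_mul r)
  have h2 := integral_add (μ := μ) (f := fun x => p * a x) (g := fun x => q * b x)
    (ha.const_mul p) (hb.const_mul q)
  rw [h, h2, integral_const_mul, integral_const_mul, integral_const_mul]

lemma hardy {N : ℕ} {v : E N → ℝ} (hv : ContDiff ℝ 1 v) :
    ∫ x, v x ^ 2 * zeta 1 x ^ 2 ≤ (∫ x, ‖fderiv ℝ v x‖ ^ 2 * zeta 1 x ^ 4) +
      (1 + (N:ℝ)) ^ 2 * ∫ x, v x ^ 2 * zeta 1 x ^ 4 := by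
  have hcd : Continuous (fderiv ℝ v) := hv.continuous_fderiv (by norm_num)
  have hc := hv.continuous
  have hh : ContDiff ℝ 1 (fun x => v x ^ 2 * zeta 1 x ^ 3) := (hv.pow 2).mul (zetapow_contDiff 1 1)
  have hd := div_id hh (zetapow_cs one_pos (by norm_num) _)
  have hfd : ∀ x, fderiv ℝ (fun x => v x ^ 2 * zeta 1 x ^ 3) x x =
      2 * v x * zeta 1 x ^ 3 * fderiv ℝ v x x - 6 * v x ^ 2 * ‖x‖ ^ 2 * zeta 1 x ^ 2 := by
    intro x
    have h1 := (hv.differentiable (by norm_num) x).hasFDerivAt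
    have h2 : HasFDerivAt (fun x => v x ^ 2 * zeta 1 x ^ 3) _ x := (h1.pow 2).mul (zetapow_hasFDeriv 1 1 x)
    rw [h2.fderiv]
    simp [real_inner_self_eq_norm_sq]
    ring
  simp_rw [hfd] at hd
  have i1 : Integrable (fun x => 2 * v x * zeta 1 x ^ 3 * fderiv ℝ v x x - 6 * v x ^ 2 * ‖x‖ ^ 2 * zeta 1 x ^ 2) := by
    have := (zetapow_int (N := N) one_pos (k := 3) (by norm_num) (f := fun x => 2 * v x * fderiv ℝ v x x)
      (by fun_prop)).sub (zetapow_int (N := N) one_pos (k := 2) (by norm_num)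
        (f := fun x => 6 * v x ^ 2 * ‖x‖ ^ 2) (by fun_prop))
    refine this.congr (ae_of_all _ fun x => ?_)
    simp; ring
  have i3 : Integrable fun x => v x ^ 2 * zeta 1 x ^ 3 := zetapow_int (N := N) one_pos (k := 3) (by norm_num) (hc.pow 2)
  have i2 : Integrable fun x => v x ^ 2 * zeta 1 x ^ 2 := zetapow_int (N := N) one_pos (k := 2) (by norm_num) (hc.pow 2)
  have i4 : Integrable fun x => v x ^ 2 * zeta 1 x ^ 4 := zetapow_int (N := N) one_pos (k := 4) (by norm_num) (hc.pow 2)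
  have iD : Integrable fun x => ‖fderiv ℝ v x‖ ^ 2 * zeta 1 x ^ 4 := zetapow_int (N := N) one_pos (k := 4) (by norm_num) (hcd.norm.pow 2)
  have hz : ∀ x : E N, zeta 1 x ^ 2 = ‖x‖ ^ 2 * zeta 1 x ^ 2 + zeta 1 x ^ 3 := by
    intro x
    rcases le_total 1 ‖x‖ with h | h
    · simp [zeta_zero one_pos h]
    · have : zeta 1 x = 1 - ‖x‖ ^ 2 := by
        unfold zeta; rw [max_eq_left] <;> nlinarith [norm_nonneg x]
      rw [this]; ring
  have key : ∫ x, (v x ^ 2 * zeta 1 x ^ 2 + (1/5) * ((2 * v x * zeta 1 x ^ 3 * fderiv ℝ v x x -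
      6 * v x ^ 2 * ‖x‖ ^ 2 * zeta 1 x ^ 2) + N * (v x ^ 2 * zeta 1 x ^ 3))) ≤
      ∫ x, ((1/5) * (‖fderiv ℝ v x‖ ^ 2 * zeta 1 x ^ 4) + (1/2) * (v x ^ 2 * zeta 1 x ^ 2) +
        (1 + (N:ℝ)/5)^2/2 * (v x ^ 2 * zeta 1 x ^ 4)) := by
    apply integral_mono
    · exact i2.add ((i1.add (i3.const_mul _)).const_mul _)
    · exact ((iD.const_mul _).add (i2.const_mul _)).add (i4.const_mul _)
    · intro x
      simp only
      have e := hz x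
      set z := zeta 1 x
      have hz0 : 0 ≤ z := zeta_nonneg 1 x
      have hb : v x * fderiv ℝ v x x ≤ |v x| * (‖fderiv ℝ v x‖ * ‖x‖) := by
        refine (le_abs_self _).trans ?_
        rw [abs_mul]; gcongr
        exact (fderiv ℝ v x).le_opNorm x
      have hb2 : v x * fderiv ℝ v x x * z ^ 3 ≤ |v x| * (‖fderiv ℝ v x‖ * ‖x‖) * z ^ 3 := by gcongr
      have h3 : v x ^ 2 * z ^ 2 = v x ^ 2 * ‖x‖ ^ 2 * z ^ 2 + v x ^ 2 * z ^ 3 := by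
        linear_combination (v x ^ 2) * e
      have h4 : 0 ≤ (|v x| * ‖x‖ * z - ‖fderiv ℝ v x‖ * z ^ 2) ^ 2 := sq_nonneg _
      have h5 : 0 ≤ v x ^ 2 * z ^ 2 * (1 - (1 + (N:ℝ)/5) * z) ^ 2 := by positivity
      have h6 : |v x| ^ 2 = v x ^ 2 := sq_abs _
      have h7 : (|v x| * ‖x‖ * z - ‖fderiv ℝ v x‖ * z ^ 2) ^ 2 = v x ^ 2 * ‖x‖ ^ 2 * z ^ 2 -
        2 * (|v x| * (‖fderiv ℝ v x‖ * ‖x‖) * z ^ 3) + ‖fderiv ℝ v x‖ ^ 2 * z ^ 4 := by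
        rw [← h6]; ring
      have h8 : v x ^ 2 * z ^ 2 * (1 - (1 + (N:ℝ)/5) * z) ^ 2 = v x ^ 2 * z ^ 2 -
        2 * (1 + (N:ℝ)/5) * (v x ^ 2 * z ^ 3) + (1 + (N:ℝ)/5) ^ 2 * (v x ^ 2 * z ^ 4) := by ring
      linarith
  rw [int_lin3 iD i2 i4] at key
  have z2 := int_lin3 i2 i1 i3 1 (1/5) (N/5)
  rw [show (∫ x, (v x ^ 2 * zeta 1 x ^ 2 + (1/5) * ((2 * v x * zeta 1 x ^ 3 * fderiv ℝ v x x -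
      6 * v x ^ 2 * ‖x‖ ^ 2 * zeta 1 x ^ 2) + N * (v x ^ 2 * zeta 1 x ^ 3)))) = _ from
      (integral_congr_ae (ae_of_all _ fun x => by ring)).trans z2, hd] at key
  have p1 : 0 ≤ ∫ x, ‖fderiv ℝ v x‖ ^ 2 * zeta 1 x ^ 4 :=
    integral_nonneg fun x => by have := zeta_nonneg 1 x; positivity
  have p2 : 0 ≤ ∫ x, v x ^ 2 * zeta 1 x ^ 4 :=
    integral_nonneg fun x => by have := zeta_nonneg 1 x; positivity
  have hN : (0:ℝ) ≤ N := Nat.cast_nonneg N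
  have p3 : (1 + (N:ℝ)/5)^2 * (∫ x, v x ^ 2 * zeta 1 x ^ 4) ≤ (1 + (N:ℝ))^2 * ∫ x, v x ^ 2 * zeta 1 x ^ 4 := by
    gcongr; linarith
  linarith

lemma lint_homothety {N : ℕ} {H : E N → ℝ≥0∞} (hH : Measurable H) {c : ℝ} (hc : 1/2 ≤ c) (b : E N) :
    ∫⁻ x, H (c • x + b) ≤ ENNReal.ofReal (2 ^ N) * ∫⁻ x, H x := by
  have hc0 : c ≠ 0 := by linarith
  have h1 : ∫⁻ x, H (c • x + b) = ∫⁻ x, H (x + b) ∂(Measure.map (c • ·) volume) := by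
    rw [lintegral_map (f := fun x => H (x + b)) (hH.comp (measurable_add_const b)) (measurable_const_smul c)]
  rw [h1, Measure.map_addHaar_smul _ hc0, lintegral_smul_measure, lintegral_add_right_eq_self]
  rw [smul_eq_mul]
  gcongr
  rw [finrank_euclideanSpace, Fintype.card_fin, abs_of_pos (by positivity)]
  rw [← inv_pow]
  gcongr
  rw [inv_le_comm₀ (by linarith) (by norm_num)]; linarith

lemma jensen_sq {f : ℝ → ℝ} (hf : Continuous f) :
    (∫ t in (0:ℝ)..1, f t) ^ 2 ≤ ∫ t in (0:ℝ)..1, f t ^ 2 := by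
  set m := ∫ t in (0:ℝ)..1, f t with hm
  have h : 0 ≤ ∫ t in (0:ℝ)..1, (f t - m) ^ 2 :=
    intervalIntegral.integral_nonneg (by norm_num) fun t _ => sq_nonneg _
  have e : ∫ t in (0:ℝ)..1, (f t - m) ^ 2 = (∫ t in (0:ℝ)..1, f t ^ 2) - 2 * m * m + m ^ 2 := by
    rw [show (fun t => (f t - m) ^ 2) = fun t => (f t ^ 2 - (2 * m) * f t) + m ^ 2 by ext t; ring]
    rw [intervalIntegral.integral_add, intervalIntegral.integral_sub, intervalIntegral.integral_const_mul]
    · simp [← hm]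
    all_goals exact (by fun_prop : Continuous _).intervalIntegrable _ _
  nlinarith

lemma seg_sq {N : ℕ} {v : E N → ℝ} (hv : ContDiff ℝ 1 v) {x y : E N} (hx : ‖x‖ ≤ 1) (hy : ‖y‖ ≤ 1) :
    (v x - v y) ^ 2 ≤ 4 * ∫ θ in (0:ℝ)..1, ‖fderiv ℝ v ((1 - θ) • x + θ • y)‖ ^ 2 := by
  have hcd : Continuous (fderiv ℝ v) := hv.continuous_fderiv (by norm_num)
  have hd : ∀ θ : ℝ, HasDerivAt (fun θ : ℝ => v ((1 - θ) • x + θ • y))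
      (fderiv ℝ v ((1 - θ) • x + θ • y) (y - x)) θ := by
    intro θ
    have h1 : HasDerivAt (fun θ : ℝ => (1 - θ) • x + θ • y) (y - x) θ := by
      have h : HasDerivAt (fun θ : ℝ => (1 - θ) • x + θ • y) ((-1:ℝ) • x + (1:ℝ) • y) θ :=
        (((hasDerivAt_id θ).const_sub 1).smul_const x).add ((hasDerivAt_id θ).smul_const y)
      rwa [neg_one_smul, one_smul, neg_add_eq_sub] at h
    exact (hv.differentiable (by norm_num) _).hasFDerivAt.comp_hasDerivAt θ h1
  have hft := intervalIntegral.integral_eq_sub_of_hasDerivAt (a := 0) (b := 1) (fun θ _ => hd θ)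
    (Continuous.intervalIntegrable (by fun_prop) _ _)
  simp at hft
  have hn : ‖y - x‖ ≤ 2 := (norm_sub_le _ _).trans (by linarith)
  have h2 : |v y - v x| ≤ 2 * ∫ θ in (0:ℝ)..1, ‖fderiv ℝ v ((1 - θ) • x + θ • y)‖ := by
    rw [← hft, ← intervalIntegral.integral_const_mul]
    refine (intervalIntegral.abs_integral_le_integral_abs (by norm_num)).trans ?_
    apply intervalIntegral.integral_mono_on (by norm_num)
    · exact (Continuous.intervalIntegrable (by fun_prop) _ _)
    · exact (Continuous.intervalIntegrable (by fun_prop) _ _)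
    · intro θ _
      have := (fderiv ℝ v ((1 - θ) • x + θ • y)).le_opNorm (y - x)
      rw [← map_sub]
      rw [Real.norm_eq_abs] at this
      nlinarith [norm_nonneg (fderiv ℝ v ((1 - θ) • x + θ • y))]
  have h3 := jensen_sq (f := fun θ => ‖fderiv ℝ v ((1 - θ) • x + θ • y)‖) (by fun_prop)
  have h4 : (v x - v y) ^ 2 = |v y - v x| ^ 2 := by rw [sq_abs]; ring
  rw [h4]
  have := pow_le_pow_left₀ (abs_nonneg _) h2 2
  nlinarith

lemma zeta_seg {N : ℕ} {x y : E N} (hx : ‖x‖ ≤ 1) (hy : ‖y‖ ≤ 1/2) {θ : ℝ} (h0 : 0 ≤ θ) (h1 : θ ≤ 1) :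
    (3/4) * zeta 1 x ≤ zeta 1 ((1 - θ) • x + θ • y) := by
  have hzx : zeta 1 x = 1 - ‖x‖ ^ 2 := by
    unfold zeta; rw [max_eq_left] <;> nlinarith [norm_nonneg x]
  have h2 : ‖(1 - θ) • x + θ • y‖ ≤ (1 - θ) * ‖x‖ + θ * ‖y‖ := by
    refine (norm_add_le _ _).trans ?_
    rw [norm_smul, norm_smul, Real.norm_of_nonneg h0, Real.norm_of_nonneg (by linarith)]
  refine le_trans ?_ (le_max_left _ _)
  rw [hzx]
  have h3 := pow_le_pow_left₀ (norm_nonneg _) h2 2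
  have h4 : ((1 - θ) * ‖x‖ + θ * ‖y‖) ^ 2 ≤ (1 - θ) * ‖x‖ ^ 2 + θ * ‖y‖ ^ 2 := by
    nlinarith [mul_nonneg (mul_nonneg h0 (sub_nonneg.2 h1)) (sq_nonneg (‖x‖ - ‖y‖))]
  have h5 : ‖y‖ ^ 2 ≤ 1/4 := by nlinarith [norm_nonneg y]
  have h6 : ‖x‖ ^ 2 ≤ 1 := by nlinarith [norm_nonneg x]
  nlinarith [mul_nonneg h0 (sub_nonneg.2 h5), mul_nonneg (sub_nonneg.2 h1) (sub_nonneg.2 h6), mul_nonneg h0 (sq_nonneg ‖x‖)]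

lemma poincare (N : ℕ) : ∃ C : ℝ, 0 < C ∧ ∀ v : E N → ℝ, ContDiff ℝ 1 v →
    ∃ y : E N, ∫ x, (v x - v y) ^ 2 * zeta 1 x ^ 4 ≤ C * ∫ x, ‖fderiv ℝ v x‖ ^ 2 * zeta 1 x ^ 4 := by
  set B : Set (E N) := ball 0 1
  set B' : Set (E N) := ball 0 (1/2)
  have hB'0 : volume B' ≠ 0 := (measure_ball_pos volume _ (by norm_num)).ne'
  have hB't : volume B' ≠ ∞ := measure_ball_lt_top.ne
  have hBt : volume B ≠ ∞ := measure_ball_lt_top.ne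
  have hBB : volume B' ≤ volume B := measure_mono (ball_subset_ball (by norm_num))
  set C0 : ℝ≥0∞ := ENNReal.ofReal (16 * 2 ^ N) * volume B / volume B' with hC0
  have hC0t : C0 ≠ ∞ := ENNReal.div_ne_top (ENNReal.mul_ne_top ENNReal.ofReal_ne_top hBt) hB'0
  refine ⟨C0.toReal + 1, by positivity, fun v hv => ?_⟩
  have hcd : Continuous (fderiv ℝ v) := hv.continuous_fderiv (by norm_num)
  have hc := hv.continuous
  have hzc : Continuous (zeta 1 : E N → ℝ) := zeta_cont 1
  set H : E N → ℝ≥0∞ := fun z => ENNReal.ofReal (‖fderiv ℝ v z‖ ^ 2 * zeta 1 z ^ 4) with hHdef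
  have hHc : Continuous H := ENNReal.continuous_ofReal.comp (by fun_prop)
  have hHm : Measurable H := hHc.measurable
  set F : E N → ℝ≥0∞ := fun y => ∫⁻ x, ENNReal.ofReal ((v x - v y) ^ 2 * zeta 1 x ^ 4) with hF
  have hFm : Measurable F := by
    apply Measurable.lintegral_prod_right'
      (f := fun p : E N × E N => ENNReal.ofReal ((v p.2 - v p.1) ^ 2 * zeta 1 p.2 ^ 4))
    exact (ENNReal.continuous_ofReal.comp (by fun_prop)).measurable
  have hDint : Integrable fun x => ‖fderiv ℝ v x‖ ^ 2 * zeta 1 x ^ 4 :=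
    zetapow_int one_pos (by norm_num) (hcd.norm.pow 2)
  have hFle : ∀ y ∈ B', F y ≤ ENNReal.ofReal 16 * ∫⁻ x in B, ∫⁻ θ in Ioc (0:ℝ) 1, H ((1 - θ) • x + θ • y) := by
    intro y hy
    have hy' : ‖y‖ ≤ 1/2 := by simpa [B'] using (mem_ball_zero_iff.1 hy).le
    rw [hF]
    have e1 : ∫⁻ x, ENNReal.ofReal ((v x - v y) ^ 2 * zeta 1 x ^ 4) =
        ∫⁻ x in B, ENNReal.ofReal ((v x - v y) ^ 2 * zeta 1 x ^ 4) := by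
      rw [← lintegral_indicator measurableSet_ball]
      congr 1; ext x
      by_cases hx : x ∈ B
      · rw [indicator_of_mem hx]
      · rw [indicator_of_notMem hx, zeta_zero one_pos (by simpa [B] using hx)]; simp
    simp only
    rw [e1, ← lintegral_const_mul']
    · apply setLIntegral_mono' measurableSet_ball
      intro x hx
      have hx' : ‖x‖ ≤ 1 := by simpa using (mem_ball_zero_iff.1 hx).le
      rw [← lintegral_const_mul' _ _ (by simp)]
      have h1 := seg_sq hv hx' (hy'.trans (by norm_num))
      rw [← intervalIntegral.integral_const_mul] at h1
      have h2 : (v x - v y) ^ 2 * zeta 1 x ^ 4 ≤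
          ∫ θ in (0:ℝ)..1, 16 * (‖fderiv ℝ v ((1 - θ) • x + θ • y)‖ ^ 2 * zeta 1 ((1 - θ) • x + θ • y) ^ 4) := by
        refine (mul_le_mul_of_nonneg_right h1 (pow_nonneg (zeta_nonneg 1 x) 4)).trans ?_
        rw [← intervalIntegral.integral_mul_const]
        apply intervalIntegral.integral_mono_on (by norm_num)
        · exact (Continuous.intervalIntegrable (by fun_prop) _ _)
        · exact (Continuous.intervalIntegrable (by fun_prop) _ _)
        · intro θ hθ
          have h3 := zeta_seg hx' hy' hθ.1 hθ.2
          have h4 := pow_le_pow_left₀ (mul_nonneg (by norm_num) (zeta_nonneg 1 x)) h3 4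
          rw [mul_pow] at h4
          have h5 : 4 * zeta 1 x ^ 4 ≤ 16 * zeta 1 ((1 - θ) • x + θ • y) ^ 4 := by
            have := pow_nonneg (zeta_nonneg 1 x) 4
            nlinarith
          nlinarith [sq_nonneg ‖fderiv ℝ v ((1 - θ) • x + θ • y)‖]
      refine (ENNReal.ofReal_le_ofReal h2).trans ?_
      rw [intervalIntegral.integral_of_le zero_le_one, ofReal_integral_eq_lintegral_ofReal]
      · apply le_of_eq
        congr 1; ext θ
        rw [ENNReal.ofReal_mul (by norm_num)]
      · exact (Continuous.integrableOn_Ioc (by fun_prop))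
      · exact ae_of_all _ fun θ => by positivity
    · simp
  have hGle : ∫⁻ y in B', F y ≤ ENNReal.ofReal (16 * 2 ^ N) * volume B * ∫⁻ x, H x := by
    have hjm : Measurable fun p : (E N × E N) × ℝ => H ((1 - p.2) • p.1.2 + p.2 • p.1.1) :=
      (hHc.comp (by fun_prop)).measurable
    calc ∫⁻ y in B', F y ≤ ∫⁻ y in B', ENNReal.ofReal 16 * ∫⁻ x in B, ∫⁻ θ in Ioc (0:ℝ) 1, H ((1 - θ) • x + θ • y) :=
          setLIntegral_mono' measurableSet_ball hFle
      _ = ENNReal.ofReal 16 * ∫⁻ y in B', ∫⁻ x in B, ∫⁻ θ in Ioc (0:ℝ) 1, H ((1 - θ) • x + θ • y) :=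
          lintegral_const_mul' _ _ (by simp)
      _ = ENNReal.ofReal 16 * ∫⁻ y in B', ∫⁻ θ in Ioc (0:ℝ) 1, ∫⁻ x in B, H ((1 - θ) • x + θ • y) := by
          congr 1; congr 1; ext y
          apply lintegral_lintegral_swap
          exact (hHc.comp (by fun_prop : Continuous fun p : E N × ℝ => (1 - p.2) • p.1 + p.2 • y)).measurable.aemeasurable
      _ = ENNReal.ofReal 16 * ∫⁻ θ in Ioc (0:ℝ) 1, ∫⁻ y in B', ∫⁻ x in B, H ((1 - θ) • x + θ • y) := by
          congr 1
          apply lintegral_lintegral_swap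
          apply Measurable.aemeasurable
          apply Measurable.lintegral_prod_right'
            (f := fun p : (E N × ℝ) × E N => H ((1 - p.1.2) • p.2 + p.1.2 • p.1.1))
          exact (hHc.comp (by fun_prop)).measurable
      _ ≤ ENNReal.ofReal 16 * ∫⁻ θ in Ioc (0:ℝ) 1, ENNReal.ofReal (2 ^ N) * volume B * ∫⁻ x, H x := by
          gcongr with θ
          rcases le_total θ (1/2) with h | h
          · calc ∫⁻ y in B', ∫⁻ x in B, H ((1 - θ) • x + θ • y)
                ≤ ∫⁻ y in B', ENNReal.ofReal (2 ^ N) * ∫⁻ x, H x := by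
                  gcongr with y
                  exact (setLIntegral_le_lintegral _ _).trans (lint_homothety hHm (by linarith) _)
              _ = ENNReal.ofReal (2 ^ N) * (∫⁻ x, H x) * volume B' := by simp
              _ ≤ ENNReal.ofReal (2 ^ N) * (∫⁻ x, H x) * volume B := by gcongr
              _ = _ := by ring
          · calc ∫⁻ y in B', ∫⁻ x in B, H ((1 - θ) • x + θ • y)
                = ∫⁻ x in B, ∫⁻ y in B', H ((1 - θ) • x + θ • y) := by
                  apply lintegral_lintegral_swap
                  exact (hHc.comp (by fun_prop : Continuous fun p : E N × E N => (1 - θ) • p.2 + θ • p.1)).measurable.aemeasurable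
              _ ≤ ∫⁻ x in B, ENNReal.ofReal (2 ^ N) * ∫⁻ x, H x := by
                  gcongr with x
                  refine (setLIntegral_le_lintegral _ _).trans ?_
                  simp_rw [add_comm ((1 - θ) • x)]
                  exact (lint_homothety hHm (by linarith) _)
              _ = ENNReal.ofReal (2 ^ N) * (∫⁻ x, H x) * volume B := by simp
              _ = _ := by ring
      _ = _ := by
          simp [ENNReal.ofReal_mul]; ring
  obtain ⟨y, hy, hyle⟩ := exists_le_setLAverage (μ := volume) (s := B') (f := F) hB'0 hB't hFm.aemeasurable
  refine ⟨y, ?_⟩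
  rw [setLAverage_eq] at hyle
  have h1 : F y ≤ C0 * ∫⁻ x, H x := by
    refine hyle.trans ((ENNReal.div_le_div_right hGle _).trans (le_of_eq ?_))
    rw [hC0, ENNReal.div_eq_inv_mul, ENNReal.div_eq_inv_mul]; ring
  have hDn : 0 ≤ ∫ x, ‖fderiv ℝ v x‖ ^ 2 * zeta 1 x ^ 4 := integral_nonneg fun x => by positivity
  rw [← ofReal_integral_eq_lintegral_ofReal hDint (ae_of_all _ fun x => by positivity)] at h1
  rw [integral_eq_lintegral_of_nonneg_ae (ae_of_all _ fun x => by positivity)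
    ((by fun_prop : Continuous _).aestronglyMeasurable)]
  refine (ENNReal.toReal_mono (ENNReal.mul_ne_top hC0t ENNReal.ofReal_ne_top) h1).trans ?_
  rw [ENNReal.toReal_mul, ENNReal.toReal_ofReal hDn]
  nlinarith

lemma lsi_ptwise {c : ℝ} (hc : 1 < c) {τ z : ℝ} (hτ : 0 < τ) (hz0 : 0 ≤ z) (hz1 : z ≤ 1) :
    (τ ^ 2 * Real.log (τ ^ 2) - τ ^ 2 + 1) * z ^ 4 ≤
      (8 + 2 ^ (2 * c) / (c - 1)) * ((τ - 1) ^ 2 * z ^ 2 + |(τ - 1) * z ^ 2| ^ (2 * c)) := by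
  have hK : 0 ≤ (2:ℝ) ^ (2 * c) / (c - 1) := div_nonneg (by positivity) (by linarith)
  have hz42 : z ^ 4 ≤ z ^ 2 := pow_le_pow_of_le_one hz0 hz1 (by norm_num)
  have hP : 0 ≤ |(τ - 1) * z ^ 2| ^ (2 * c) := by positivity
  rcases le_or_gt τ 2 with h | h
  · have hl : Real.log (τ ^ 2) ≤ 2 * (τ - 1) := by
      rw [Real.log_pow]; push_cast
      linarith [Real.log_le_sub_one_of_pos hτ]
    have h1 : τ ^ 2 * Real.log (τ ^ 2) - τ ^ 2 + 1 ≤ 8 * (τ - 1) ^ 2 := by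
      have := mul_le_mul_of_nonneg_left hl (sq_nonneg τ)
      nlinarith [mul_nonneg (sub_nonneg.2 h) (sq_nonneg (τ - 1)), sq_nonneg (τ-1)]
    calc _ ≤ 8 * (τ - 1) ^ 2 * z ^ 4 := by gcongr
      _ ≤ 8 * (τ - 1) ^ 2 * z ^ 2 := by gcongr
      _ ≤ _ := by nlinarith [mul_nonneg hK hP, mul_nonneg hK (mul_nonneg (sq_nonneg (τ-1)) (sq_nonneg z))]
  · rcases hz0.eq_or_lt with h0 | h0
    · subst h0; simp; positivity
    have hl : Real.log (τ ^ 2) = 2 * Real.log (τ * z ^ 2) + 2 * Real.log ((z ^ 2)⁻¹) := by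
      rw [Real.log_mul hτ.ne' (by positivity), Real.log_inv, Real.log_pow]; push_cast; ring
    have h1 : Real.log ((z ^ 2)⁻¹) ≤ (z ^ 2)⁻¹ := by
      linarith [Real.log_le_sub_one_of_pos (show 0 < (z ^ 2)⁻¹ by positivity)]
    have h2 : 2 * Real.log (τ * z ^ 2) ≤ (τ * z ^ 2) ^ (2 * (c - 1)) / (c - 1) := by
      have hp : 0 < τ * z ^ 2 := by positivity
      have := Real.log_le_sub_one_of_pos (Real.rpow_pos_of_pos hp (2 * (c - 1)))
      rw [Real.log_rpow hp] at this
      rw [le_div_iff₀ (by linarith)]; linarith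
    have h3 : τ ^ 2 * z ^ 4 * Real.log (τ ^ 2) ≤ (τ * z ^ 2) ^ (2 * c) / (c - 1) + 2 * (τ ^ 2 * z ^ 2) := by
      rw [hl]
      have e : (τ * z ^ 2) ^ (2 * c) = τ ^ 2 * z ^ 4 * (τ * z ^ 2) ^ (2 * (c - 1)) := by
        rw [show 2 * c = 2 + 2 * (c - 1) by ring, Real.rpow_add (by positivity)]
        rw [Real.rpow_two]; ring
      have e2 : τ ^ 2 * z ^ 4 * (z ^ 2)⁻¹ = τ ^ 2 * z ^ 2 := by field_simp
      have hq : 0 ≤ τ ^ 2 * z ^ 4 := by positivity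
      have a1 := mul_le_mul_of_nonneg_left h2 hq
      have a2 := mul_le_mul_of_nonneg_left h1 hq
      rw [e, mul_div_assoc]; rw [e2] at a2; linarith
    have h4 : (τ * z ^ 2) ^ (2 * c) ≤ 2 ^ (2 * c) * |(τ - 1) * z ^ 2| ^ (2 * c) := by
      rw [← Real.mul_rpow (by norm_num) (abs_nonneg _)]
      apply Real.rpow_le_rpow (by positivity) _ (by linarith)
      rw [abs_of_nonneg (mul_nonneg (by linarith) (by positivity))]
      nlinarith [sq_nonneg z]
    have h5 : τ ^ 2 ≤ 4 * (τ - 1) ^ 2 := by nlinarith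
    have h6 : τ ^ 2 * z ^ 2 ≤ 4 * (τ - 1) ^ 2 * z ^ 2 := by gcongr
    have h7 : (τ * z ^ 2) ^ (2 * c) / (c - 1) ≤ 2 ^ (2 * c) / (c - 1) * |(τ - 1) * z ^ 2| ^ (2 * c) := by
      rw [div_mul_eq_mul_div]; gcongr
    have h8 : 0 ≤ (τ ^ 2 - 1) * z ^ 4 := mul_nonneg (by nlinarith) (by positivity)
    nlinarith [mul_nonneg hK (mul_nonneg (sq_nonneg (τ-1)) (sq_nonneg z))]

lemma mu0_pos (N : ℕ) : 0 < ∫ x : E N, zeta 1 x ^ 4 := by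
  apply Continuous.integral_pos_of_hasCompactSupport_nonneg_nonzero (x := (0 : E N))
  · exact (zeta_cont 1).pow 4
  · simpa using zetapow_cs (N := N) one_pos (k := 4) (by norm_num) (fun _ => 1)
  · intro x; exact pow_nonneg (zeta_nonneg 1 x) 4
  · simp [zeta]

lemma int_le3 {α : Type*} [MeasurableSpace α] {μ : Measure α} {f a b c : α → ℝ} (hf : Integrable f μ)
    (ha : Integrable a μ) (hb : Integrable b μ) (hc : Integrable c μ) (p q r : ℝ)
    (h : ∀ x, f x ≤ p * a x + q * b x + r * c x) :
    ∫ x, f x ∂μ ≤ p * (∫ x, a x ∂μ) + q * (∫ x, b x ∂μ) + r * ∫ x, c x ∂μ := by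
  rw [← int_lin3 ha hb hc]
  exact integral_mono hf (((ha.const_mul p).add (hb.const_mul q)).add (hc.const_mul r)) h

lemma fderiv_mul_zeta {N : ℕ} {g : E N → ℝ} (hgC : ContDiff ℝ 1 g) {ρ : ℝ} (h0 : 0 < ρ) (h1 : ρ ≤ 1) (x : E N) :
    ‖fderiv ℝ (fun x => g x * zeta ρ x ^ 2) x‖ ^ 2 ≤
      2 * (‖fderiv ℝ g x‖ ^ 2 * zeta ρ x ^ 4) + 32 * (g x ^ 2 * zeta ρ x ^ 2) := by
  have hz0 := zeta_nonneg ρ x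
  rcases le_or_gt ‖x‖ ρ with hx | hx
  · have h2 : HasFDerivAt (fun x => g x * zeta ρ x ^ 2) _ x :=
      (hgC.differentiable (by norm_num) x).hasFDerivAt.mul (zetapow_hasFDeriv ρ 0 x)
    rw [h2.fderiv]
    have h3 : ‖g x • (((0:ℕ) + 2 : ℝ) * zeta ρ x ^ (0+1)) • (-((2:ℝ) • innerSL ℝ x)) + zeta ρ x ^ (0+2) • fderiv ℝ g x‖
        ≤ 4 * (|g x| * zeta ρ x) + zeta ρ x ^ 2 * ‖fderiv ℝ g x‖ := by
      refine (norm_add_le _ _).trans ?_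
      rw [norm_smul, norm_smul, norm_smul, norm_neg, norm_smul, innerSL_apply_norm]
      simp only [Real.norm_eq_abs, abs_mul, abs_pow, abs_of_nonneg hz0]
      norm_num
      nlinarith [mul_nonneg (abs_nonneg (g x)) hz0]
    refine (pow_le_pow_left₀ (norm_nonneg _) h3 2).trans ?_
    have e : |g x| ^ 2 = g x ^ 2 := sq_abs _
    rw [← e]
    nlinarith [sq_nonneg (4 * (|g x| * zeta ρ x) - zeta ρ x ^ 2 * ‖fderiv ℝ g x‖)]
  · have : (fun x => g x * zeta ρ x ^ 2) =ᶠ[nhds x] fun _ => 0 := by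
      filter_upwards [continuous_norm.continuousAt.eventually (lt_mem_nhds hx)] with w hw
      rw [zeta_zero h0 (le_of_lt hw)]; simp
    rw [this.fderiv_eq]; simp; positivity

lemma mulzeta_int {N : ℕ} {g : E N → ℝ} (hgC : ContDiff ℝ 1 g) {ρ : ℝ} (h0 : 0 < ρ) :
    Integrable fun x => ‖fderiv ℝ (fun x => g x * zeta ρ x ^ 2) x‖ ^ 2 := by
  have hfC : ContDiff ℝ 1 (fun x => g x * zeta ρ x ^ 2) := hgC.mul (zetapow_contDiff ρ 0)
  have hfcs := zetapow_cs (N := N) h0 (k := 2) (by norm_num) g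
  exact cs_int ((hfC.continuous_fderiv (by norm_num)).norm.pow 2) (by
    simpa [Function.comp_def] using (hfcs.fderiv (𝕜 := ℝ)).comp_left (g := fun y : E N →L[ℝ] ℝ => ‖y‖ ^ 2) (by simp))

set_option maxHeartbeats 1000000 in
lemma lsi {N : ℕ} (hN : 2 ≤ N) : ∃ C : ℝ, 0 < C ∧ ∀ v : E N → ℝ, ContDiff ℝ 1 v → (∀ x, 0 < v x) →
    (∫ x, v x ^ 2 * Real.log (v x ^ 2) * zeta 1 x ^ 4) - (∫ x, v x ^ 2 * zeta 1 x ^ 4) *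
      Real.log ((∫ x, v x ^ 2 * zeta 1 x ^ 4) / ∫ x : E N, zeta 1 x ^ 4) ≤
      C * ∫ x, ‖fderiv ℝ v x‖ ^ 2 * zeta 1 x ^ 4 := by
  obtain ⟨CP, hCP, hpoin⟩ := poincare N
  obtain ⟨CG, hCG, hgn⟩ := gn hN
  have hχ := chi_gt hN
  set χ := chi N
  set μ0 := ∫ x : E N, zeta 1 x ^ 4 with hμ0
  have hμ0p : 0 < μ0 := mu0_pos N
  set c1 := 2 * CP + 2 * μ0 with hc1
  have hc1p : 0 < c1 := by positivity
  set c2 := 1 + (1 + (N:ℝ)) ^ 2 * c1 with hc2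
  have hc2p : 0 < c2 := by positivity
  set c3 := CG * c1 ^ (χ - 1) * (2 + 32 * c2) with hc3
  have hc3p : 0 < c3 := by positivity
  set K := 8 + 2 ^ (2 * χ) / (χ - 1) with hK
  have hKp : 0 < K := by
    have : 0 < χ - 1 := by linarith
    positivity
  refine ⟨K * (c2 + c3), by positivity, fun v hv hpos => ?_⟩
  obtain ⟨y, hy⟩ := hpoin v hv
  have hcd : Continuous (fderiv ℝ v) := hv.continuous_fderiv (by norm_num)
  have hc := hv.continuous
  have hzc : Continuous (zeta 1 : E N → ℝ) := zeta_cont 1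
  set D := ∫ x, ‖fderiv ℝ v x‖ ^ 2 * zeta 1 x ^ 4 with hD
  have hD0 : 0 ≤ D := integral_nonneg fun x => by positivity
  set J := ∫ x, v x ^ 2 * zeta 1 x ^ 4 with hJ
  set A := v y + √D with hA
  have hA0 : 0 < A := by have := hpos y; positivity
  have hAD : D ≤ A ^ 2 := by
    have h1 := Real.sq_sqrt hD0
    nlinarith [hpos y, Real.sqrt_nonneg D]
  set g : E N → ℝ := fun x => v x - A with hg
  have hgC : ContDiff ℝ 1 g := hv.sub contDiff_const
  have hgc : Continuous g := hgC.continuous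
  have hgd : ∀ x, fderiv ℝ g x = fderiv ℝ v x := fun x => fderiv_sub_const _
  have iz : Integrable fun x : E N => zeta 1 x ^ 4 := by
    simpa using zetapow_int (N := N) one_pos (k := 4) (by norm_num) (f := fun _ => 1) continuous_const
  have ig4 : Integrable fun x => g x ^ 2 * zeta 1 x ^ 4 := zetapow_int one_pos (by norm_num) (by fun_prop)
  have ig2 : Integrable fun x => g x ^ 2 * zeta 1 x ^ 2 := zetapow_int one_pos (by norm_num) (by fun_prop)
  have iD : Integrable fun x => ‖fderiv ℝ v x‖ ^ 2 * zeta 1 x ^ 4 := zetapow_int one_pos (by norm_num) (by fun_prop)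
  have iy : Integrable fun x => (v x - v y) ^ 2 * zeta 1 x ^ 4 := zetapow_int one_pos (by norm_num) (by fun_prop)
  have iJ : Integrable fun x => v x ^ 2 * zeta 1 x ^ 4 := zetapow_int one_pos (by norm_num) (by fun_prop)
  have b1 : ∫ x, g x ^ 2 * zeta 1 x ^ 4 ≤ c1 * D := by
    have := int_le3 ig4 iy iz iz 2 0 (2 * D) (by
      intro x
      have h1 := Real.sq_sqrt hD0
      have h2 : g x ^ 2 ≤ 2 * (v x - v y) ^ 2 + 2 * D := by
        simp only [hg, hA]; nlinarith [sq_nonneg (v x - v y + √D)]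
      have := mul_le_mul_of_nonneg_right h2 (pow_nonneg (zeta_nonneg 1 x) 4)
      linarith)
    rw [← hμ0] at this
    rw [hc1]; nlinarith
  have b2 : ∫ x, g x ^ 2 * zeta 1 x ^ 2 ≤ c2 * D := by
    have := hardy hgC
    simp_rw [hgd] at this
    rw [hc2]
    have h2 := mul_le_mul_of_nonneg_left b1 (show 0 ≤ (1 + (N:ℝ)) ^ 2 by positivity)
    linarith
  have hfC : ContDiff ℝ 1 (fun x => g x * zeta 1 x ^ 2) := hgC.mul (zetapow_contDiff 1 0)
  have hfcs := zetapow_cs (N := N) one_pos (k := 2) (by norm_num) g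
  have b3 : ∫ x, |g x * zeta 1 x ^ 2| ^ (2 * χ) ≤ c3 * D ^ χ := by
    refine (hgn _ hfC hfcs).trans ?_
    have a1 : ∫ x, (g x * zeta 1 x ^ 2) ^ 2 ≤ c1 * D := by
      refine le_trans (le_of_eq ?_) b1
      congr 1; ext x; ring
    have hfd : ∀ x, ‖fderiv ℝ (fun x => g x * zeta 1 x ^ 2) x‖ ^ 2 ≤
        2 * (‖fderiv ℝ v x‖ ^ 2 * zeta 1 x ^ 4) + 32 * (g x ^ 2 * zeta 1 x ^ 2) + 0 * (g x ^ 2 * zeta 1 x ^ 2) := by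
      intro x
      have := fderiv_mul_zeta hgC one_pos le_rfl x
      rw [hgd] at this; linarith
    have a2 : ∫ x, ‖fderiv ℝ (fun x => g x * zeta 1 x ^ 2) x‖ ^ 2 ≤ (2 + 32 * c2) * D := by
      have := int_le3 (mulzeta_int hgC one_pos) iD ig2 ig2 2 32 0 hfd
      linarith
    calc CG * (∫ x, (g x * zeta 1 x ^ 2) ^ 2) ^ (χ - 1) * ∫ x, ‖fderiv ℝ (fun x => g x * zeta 1 x ^ 2) x‖ ^ 2
        ≤ CG * (c1 * D) ^ (χ - 1) * ((2 + 32 * c2) * D) := by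
          gcongr
      _ = c3 * (D ^ (χ - 1) * D) := by rw [Real.mul_rpow hc1p.le hD0, hc3]; ring
      _ = c3 * D ^ χ := by
          congr 1
          rcases hD0.eq_or_lt with h | h
          · rw [← h, Real.zero_rpow (by linarith : χ ≠ 0), mul_zero]
          · rw [← Real.rpow_add_one h.ne']; congr 1; ring
  have b4 : A ^ (2 - 2 * χ) * D ^ χ ≤ D := by
    rcases hD0.eq_or_lt with h | h
    · rw [← h, Real.zero_rpow (by linarith : χ ≠ 0), mul_zero]
    · have e : A ^ (2 - 2 * χ) = (A ^ 2) ^ (1 - χ) := by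
        rw [← Real.rpow_natCast, ← Real.rpow_mul hA0.le]; congr 1; push_cast; ring
      rw [e]
      have h2 : (A ^ 2) ^ (1 - χ) ≤ D ^ (1 - χ) :=
        Real.rpow_le_rpow_of_nonpos h hAD (by linarith)
      calc _ ≤ D ^ (1 - χ) * D ^ χ := by gcongr
        _ = D := by rw [← Real.rpow_add h]; simp
  -- the pointwise bound
  have ip : Integrable fun x => |g x * zeta 1 x ^ 2| ^ (2 * χ) := by
    refine cs_int ((hgc.mul (hzc.pow 2)).abs.rpow_const fun x => Or.inr (by linarith)) ?_
    simpa [Function.comp_def] using hfcs.comp_left (g := fun t => |t| ^ (2 * χ)) (by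
      simp; rw [Real.zero_rpow]; linarith)
  have il : Integrable fun x => v x ^ 2 * Real.log (v x ^ 2) * zeta 1 x ^ 4 := by
    apply zetapow_int one_pos (by norm_num)
    exact (hc.pow 2).mul ((hc.pow 2).log fun x => (pow_pos (hpos x) 2).ne')
  have hpt : ∀ x, 1 * (v x ^ 2 * Real.log (v x ^ 2) * zeta 1 x ^ 4) + (- Real.log (A ^ 2) - 1) * (v x ^ 2 * zeta 1 x ^ 4) +
      A ^ 2 * zeta 1 x ^ 4 ≤ K * (g x ^ 2 * zeta 1 x ^ 2) + (K * A ^ (2 - 2 * χ)) * |g x * zeta 1 x ^ 2| ^ (2 * χ)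
        + 0 * zeta 1 x ^ 4 := by
    intro x
    have := lsi_ptwise hχ (div_pos (hpos x) hA0) (zeta_nonneg 1 x) (zeta_le_one one_pos le_rfl x)
    have h2 := mul_le_mul_of_nonneg_left this (sq_nonneg A)
    have e1 : A ^ 2 * (((v x / A) ^ 2 * Real.log ((v x / A) ^ 2) - (v x / A) ^ 2 + 1) * zeta 1 x ^ 4) =
        1 * (v x ^ 2 * Real.log (v x ^ 2) * zeta 1 x ^ 4) + (- Real.log (A ^ 2) - 1) * (v x ^ 2 * zeta 1 x ^ 4) +
      A ^ 2 * zeta 1 x ^ 4 := by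
      rw [div_pow, Real.log_div (pow_pos (hpos x) 2).ne' (by positivity)]
      field_simp; ring
    have e2 : v x / A - 1 = g x / A := by simp only [hg]; field_simp
    have e3 : |g x / A * zeta 1 x ^ 2| ^ (2 * χ) = A ^ (- (2 * χ)) * |g x * zeta 1 x ^ 2| ^ (2 * χ) := by
      rw [show g x / A * zeta 1 x ^ 2 = A⁻¹ * (g x * zeta 1 x ^ 2) by field_simp, abs_mul, abs_of_pos (inv_pos.2 hA0),
        Real.mul_rpow (by positivity) (abs_nonneg _), Real.inv_rpow hA0.le, Real.rpow_neg hA0.le]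
    have e4 : A ^ (2 - 2 * χ) = A ^ 2 * A ^ (-(2 * χ)) := by
      rw [sub_eq_add_neg, Real.rpow_add hA0, Real.rpow_two]
    rw [e1, e2, e3] at h2
    rw [e4]
    refine h2.trans (le_of_eq ?_)
    field_simp; ring
  have iL : Integrable fun x => 1 * (v x ^ 2 * Real.log (v x ^ 2) * zeta 1 x ^ 4) +
      (- Real.log (A ^ 2) - 1) * (v x ^ 2 * zeta 1 x ^ 4) + A ^ 2 * zeta 1 x ^ 4 :=
    ((il.const_mul 1).add (iJ.const_mul (- Real.log (A ^ 2) - 1))).add (iz.const_mul (A ^ 2))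
  have hint2 := int_le3 iL ig2 ip iz K (K * A ^ (2 - 2 * χ)) 0 hpt
  rw [int_lin3 il iJ iz] at hint2
  rw [← hJ, ← hμ0] at hint2
  have hJp : 0 < J := by
    apply Continuous.integral_pos_of_hasCompactSupport_nonneg_nonzero (x := (0 : E N))
    · fun_prop
    · exact zetapow_cs one_pos (by norm_num) _
    · intro x; exact mul_nonneg (sq_nonneg _) (pow_nonneg (zeta_nonneg 1 x) 4)
    · simp [zeta, (hpos 0).ne']
  have hlog : J * Real.log (A ^ 2) + J - A ^ 2 * μ0 ≤ J * Real.log (J / μ0) := by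
    have h := Real.log_le_sub_one_of_pos (show 0 < A ^ 2 / (J / μ0) by positivity)
    rw [Real.log_div (by positivity) (by positivity)] at h
    have h2 := mul_le_mul_of_nonneg_left h hJp.le
    have e : J * (A ^ 2 / (J / μ0) - 1) = A ^ 2 * μ0 - J := by field_simp
    rw [e] at h2; linarith
  have b5 : K * (∫ x, g x ^ 2 * zeta 1 x ^ 2) ≤ K * (c2 * D) := by gcongr
  have b6 : K * A ^ (2 - 2 * χ) * (∫ x, |g x * zeta 1 x ^ 2| ^ (2 * χ)) ≤ K * (c3 * D) := by
    calc _ ≤ K * A ^ (2 - 2 * χ) * (c3 * D ^ χ) := by gcongr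
      _ = K * c3 * (A ^ (2 - 2 * χ) * D ^ χ) := by ring
      _ ≤ K * c3 * D := by gcongr
      _ = _ := by ring
  linarith

lemma par_cont {N : ℕ} {F : E N → ℝ → ℝ} (hF : Continuous fun p : E N × ℝ => F p.1 p.2) {ρ : ℝ} (h0 : 0 < ρ)
    {k : ℕ} (hk : k ≠ 0) : Continuous fun t => ∫ x, F x t * zeta ρ x ^ k := by
  have hz := zeta_cont (N := N) ρ
  have h := continuous_parametric_integral_of_continuous (μ := (volume : Measure (E N)))
    (f := fun t x => F x t * zeta ρ x ^ k) (s := closedBall (0 : E N) ρ) ?_ (isCompact_closedBall _ _)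
  · refine h.congr fun t => ?_
    apply setIntegral_eq_integral_of_forall_compl_eq_zero
    intro x hx; rw [zeta_zero' h0 hx]; simp [hk]
  · exact (hF.comp (by fun_prop : Continuous fun p : ℝ × E N => (p.2, p.1))).mul ((hz.comp continuous_snd).pow k)

lemma par_deriv {N : ℕ} {F F' : E N → ℝ → ℝ} (hF : Continuous fun p : E N × ℝ => F p.1 p.2)
    (hF' : Continuous fun p : E N × ℝ => F' p.1 p.2) (hd : ∀ x t, HasDerivAt (F x) (F' x t) t)
    {ρ : ℝ} (h0 : 0 < ρ) {k : ℕ} (hk : k ≠ 0) (t : ℝ) :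
    HasDerivAt (fun t => ∫ x, F x t * zeta ρ x ^ k) (∫ x, F' x t * zeta ρ x ^ k) t := by
  have hFt : ∀ t, Continuous fun x => F x t := fun t =>
    hF.comp (by fun_prop : Continuous fun x : E N => (x, t))
  have hFt' : ∀ t, Continuous fun x => F' x t := fun t =>
    hF'.comp (by fun_prop : Continuous fun x : E N => (x, t))
  obtain ⟨M, hM⟩ := ((isCompact_closedBall (0 : E N) ρ).prod (isCompact_closedBall t 1)).exists_bound_of_continuousOn hF'.continuousOn
  refine (hasDerivAt_integral_of_dominated_loc_of_deriv_le (μ := (volume : Measure (E N))) (s := ball t 1)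
    (F := fun t x => F x t * zeta ρ x ^ k)
    (F' := fun t x => F' x t * zeta ρ x ^ k) (x₀ := t) (bound := fun x => M * zeta ρ x ^ k)
    (ball_mem_nhds t one_pos) ?_ ?_ ?_ ?_ ?_ ?_).2
  · exact Filter.Eventually.of_forall fun t => (zetapow_int h0 hk (hFt t)).1
  · exact zetapow_int h0 hk (hFt t)
  · exact (zetapow_int h0 hk (hFt' t)).1
  · refine ae_of_all _ fun x s hs => ?_
    by_cases hx : x ∈ closedBall (0 : E N) ρ
    · rw [norm_mul, norm_pow, Real.norm_of_nonneg (zeta_nonneg ρ x)]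
      exact mul_le_mul_of_nonneg_right (hM (x, s) ⟨hx, ball_subset_closedBall hs⟩) (pow_nonneg (zeta_nonneg ρ x) k)
    · simp [zeta_zero' h0 hx, hk]
  · exact zetapow_int h0 hk continuous_const
  · exact ae_of_all _ fun x s _ => (hd x s).mul_const _

/-- positive smooth functions satisfying the family of energy inequalities -/
structure SS (N : ℕ) (C0 a : ℝ) (w : E N → ℝ → ℝ) : Prop where
  smooth : ContDiff ℝ 2 (fun p : E N × ℝ => w p.1 p.2)
  pos : ∀ x t, 0 < w x t
  energy : ∀ t ∈ Ioo (-a) a, ∀ p : ℝ, 0 < p → ∀ ρ ∈ Ioc (0:ℝ) 1,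
    p / 2 * (∫ x, ‖fderiv ℝ (fun y => w y t) x‖ ^ 2 * w x t ^ (-p - 1) * zeta ρ x ^ 4) -
      C0 * (1 + 1 / p) * (∫ x, w x t ^ (1 - p) * zeta ρ x ^ 2) ≤
      ∫ x, deriv (w x) t * w x t ^ (-p) * zeta ρ x ^ 4

lemma SS.cont {N : ℕ} {C0 a : ℝ} {w : E N → ℝ → ℝ} (h : SS N C0 a w) :
    Continuous (fun p : E N × ℝ => w p.1 p.2) := h.smooth.continuous

lemma SS.rpow_cont {N : ℕ} {C0 a : ℝ} {w : E N → ℝ → ℝ} (h : SS N C0 a w) {q : ℝ → ℝ} (hq : Continuous q) :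
    Continuous (fun p : E N × ℝ => w p.1 p.2 ^ q p.2) :=
  h.cont.rpow (hq.comp continuous_snd) fun p => Or.inl (h.pos _ _).ne'

lemma SS.slice {N : ℕ} {C0 a : ℝ} {w : E N → ℝ → ℝ} (h : SS N C0 a w) (t : ℝ) :
    ContDiff ℝ 2 (fun x => w x t) := h.smooth.comp (by fun_prop : ContDiff ℝ 2 fun x : E N => (x, t))

lemma SS.slice_rpow {N : ℕ} {C0 a : ℝ} {w : E N → ℝ → ℝ} (h : SS N C0 a w) (m t : ℝ) :
    ContDiff ℝ 1 (fun x => w x t ^ m) :=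
  ((h.slice t).of_le (by norm_num)).rpow_const_of_ne fun x => (h.pos x t).ne'

lemma SS.tderiv {N : ℕ} {C0 a : ℝ} {w : E N → ℝ → ℝ} (h : SS N C0 a w) (x : E N) (t : ℝ) :
    HasDerivAt (w x) (deriv (w x) t) t := by
  have : ContDiff ℝ 2 (w x) := h.smooth.comp (by fun_prop : ContDiff ℝ 2 fun t : ℝ => (x, t))
  exact (this.differentiable (by norm_num) t).hasDerivAt

lemma SS.tderiv_cont {N : ℕ} {C0 a : ℝ} {w : E N → ℝ → ℝ} (h : SS N C0 a w) :
    Continuous (fun p : E N × ℝ => deriv (w p.1) p.2) := by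
  have hc : Continuous (fderiv ℝ (fun p : E N × ℝ => w p.1 p.2)) := h.smooth.continuous_fderiv (by norm_num)
  have e : ∀ p : E N × ℝ, deriv (w p.1) p.2 = fderiv ℝ (fun p : E N × ℝ => w p.1 p.2) p ((0 : E N), (1:ℝ)) := by
    intro p
    have h1 := (h.smooth.differentiable (by norm_num) p).hasFDerivAt
    have h2 : HasDerivAt (fun t : ℝ => (p.1, t)) ((0 : E N), (1:ℝ)) p.2 :=
      (hasDerivAt_const p.2 p.1).prodMk (hasDerivAt_id p.2)
    exact (h1.comp_hasDerivAt p.2 h2).deriv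
  simp_rw [e]
  fun_prop

lemma SS.grad_rpow {N : ℕ} {C0 a : ℝ} {w : E N → ℝ → ℝ} (h : SS N C0 a w) (m t : ℝ) (x : E N) :
    ‖fderiv ℝ (fun x => w x t ^ m) x‖ ^ 2 = m ^ 2 * (‖fderiv ℝ (fun y => w y t) x‖ ^ 2 * w x t ^ (2 * m - 2)) := by
  have h1 := ((h.slice t).differentiable (by norm_num) x).hasFDerivAt
  have h2 := h1.rpow_const (p := m) (Or.inl (h.pos x t).ne')
  rw [h2.fderiv, norm_smul, mul_pow, norm_mul, mul_pow, Real.norm_eq_abs, sq_abs,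
    Real.norm_of_nonneg (Real.rpow_nonneg (h.pos x t).le _), ← Real.rpow_natCast (w x t ^ (m-1)),
    ← Real.rpow_mul (h.pos x t).le]
  rw [show (m - 1) * ((2:ℕ):ℝ) = 2 * m - 2 by push_cast; ring]; ring

/-- energy inequality in terms of `V = w^{q/2}` -/
lemma SS.vform {N : ℕ} {C0 a : ℝ} {w : E N → ℝ → ℝ} (h : SS N C0 a w) {t : ℝ} (ht : t ∈ Ioo (-a) a)
    {q : ℝ} (hq : q < 1) (hq0 : q ≠ 0) {ρ : ℝ} (hρ : ρ ∈ Ioc (0:ℝ) 1) :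
    2 * (1 - q) / q ^ 2 * (∫ x, ‖fderiv ℝ (fun x => w x t ^ (q / 2)) x‖ ^ 2 * zeta ρ x ^ 4) -
      C0 * (1 + 1 / (1 - q)) * (∫ x, w x t ^ q * zeta ρ x ^ 2) ≤
      ∫ x, deriv (w x) t * w x t ^ (q - 1) * zeta ρ x ^ 4 := by
  have := h.energy t ht (1 - q) (by linarith) ρ hρ
  simp_rw [show 1 - (1 - q) = q by ring, show -(1 - q) = q - 1 by ring] at this
  refine le_trans (le_of_eq ?_) this
  congr 1
  have e : ∀ x, ‖fderiv ℝ (fun x => w x t ^ (q / 2)) x‖ ^ 2 * zeta ρ x ^ 4 =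
      (q ^ 2 / 4) * (‖fderiv ℝ (fun y => w y t) x‖ ^ 2 * w x t ^ (q - 1 - 1) * zeta ρ x ^ 4) := by
    intro x
    rw [h.grad_rpow, show 2 * (q / 2) - 2 = q - 1 - 1 by ring]; ring
  simp_rw [e]
  rw [integral_const_mul]
  field_simp; ring

lemma SS.sq_half {N : ℕ} {C0 a : ℝ} {w : E N → ℝ → ℝ} (h : SS N C0 a w) (q t : ℝ) (x : E N) :
    (w x t ^ (q / 2)) ^ 2 = w x t ^ q := by
  rw [← Real.rpow_natCast, ← Real.rpow_mul (h.pos x t).le]; congr 1; push_cast; ring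

/-- weighted moments -/
def mom {N : ℕ} (w : E N → ℝ → ℝ) (q t : ℝ) : ℝ := ∫ x, w x t ^ q * zeta 1 x ^ 4

lemma mom_pos {N : ℕ} {C0 a : ℝ} {w : E N → ℝ → ℝ} (h : SS N C0 a w) (q t : ℝ) : 0 < mom w q t := by
  have hz := zeta_cont (N := N) 1
  have hc : Continuous fun x => w x t ^ q := (h.slice_rpow q t).continuous
  apply Continuous.integral_pos_of_hasCompactSupport_nonneg_nonzero (x := (0 : E N))
  · fun_prop
  · exact zetapow_cs one_pos (by norm_num) _
  · intro x; exact mul_nonneg (Real.rpow_nonneg (h.pos _ _).le _) (pow_nonneg (zeta_nonneg 1 x) 4)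
  · simp [zeta, (Real.rpow_pos_of_pos (h.pos 0 t) q).ne']

set_option maxHeartbeats 1000000 in
lemma gross_step {N : ℕ} {C0 : ℝ} (hC0 : 0 ≤ C0) {CL : ℝ} (hCL0 : 0 < CL)
    (hCL : ∀ v : E N → ℝ, ContDiff ℝ 1 v → (∀ x, 0 < v x) →
    (∫ x, v x ^ 2 * Real.log (v x ^ 2) * zeta 1 x ^ 4) - (∫ x, v x ^ 2 * zeta 1 x ^ 4) *
      Real.log ((∫ x, v x ^ 2 * zeta 1 x ^ 4) / ∫ x : E N, zeta 1 x ^ 4) ≤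
      CL * ∫ x, ‖fderiv ℝ v x‖ ^ 2 * zeta 1 x ^ 4)
    {a : ℝ} {w : E N → ℝ → ℝ} (h : SS N C0 a w) {q0 : ℝ} (hq0 : 0 < q0) (hq1 : q0 ≤ 1/2)
    (hq2 : 2 * q0 * CL ≤ 1/2) (hq3 : 3 * C0 * q0 ^ 2 ≤ 1/2) {ta tb qa σ : ℝ} (hta : -a < ta) (hab : ta < tb)
    (htb : tb < a) (hσ0 : 0 ≤ σ) (hσ : σ ≤ 2 * q0)
    (hq : ∀ t ∈ Icc ta tb, qa - σ * (t - ta) ≠ 0 ∧ |qa - σ * (t - ta)| ≤ q0) :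
    1 / qa * Real.log (mom w qa ta / ∫ x : E N, zeta 1 x ^ 4) - 3 * C0 * (1 + (N:ℝ)) ^ 2 * (tb - ta) ≤
    1 / (qa - σ * (tb - ta)) * Real.log (mom w (qa - σ * (tb - ta)) tb / ∫ x : E N, zeta 1 x ^ 4) := by
  set μ0 := ∫ x : E N, zeta 1 x ^ 4 with hμ0
  have hμ0p : 0 < μ0 := mu0_pos N
  set Q : ℝ → ℝ := fun t => qa - σ * (t - ta) with hQ
  have hQc : Continuous Q := by fun_prop
  have hQd : ∀ t, HasDerivAt Q (-σ) t := by
    intro t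
    have := (((hasDerivAt_id t).sub_const ta).const_mul σ).const_sub qa
    simpa using this
  set C1 := 3 * C0 * (1 + (N:ℝ)) ^ 2 with hC1
  have hwc := h.cont
  set F : E N → ℝ → ℝ := fun x t => w x t ^ Q t with hF
  set F' : E N → ℝ → ℝ := fun x t => deriv (w x) t * Q t * w x t ^ (Q t - 1) + (-σ) * w x t ^ Q t * Real.log (w x t) with hF'
  have hFc : Continuous fun p : E N × ℝ => F p.1 p.2 := h.rpow_cont hQc
  have hlc : Continuous fun p : E N × ℝ => Real.log (w p.1 p.2) := hwc.log fun p => (h.pos _ _).ne'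
  have hFc' : Continuous fun p : E N × ℝ => F' p.1 p.2 :=
    ((h.tderiv_cont.mul (hQc.comp continuous_snd)).mul (h.rpow_cont (hQc.sub continuous_const))).add
      ((continuous_const.mul (h.rpow_cont hQc)).mul hlc)
  have hFd : ∀ x t, HasDerivAt (F x) (F' x t) t := fun x t => (h.tderiv x t).rpow (hQd t) (h.pos x t)
  have hJd := fun t => par_deriv hFc hFc' hFd (ρ := 1) one_pos (k := 4) (by norm_num) t
  set J : ℝ → ℝ := fun t => ∫ x, F x t * zeta 1 x ^ 4 with hJ
  have hJm : ∀ t, J t = mom w (Q t) t := fun t => rfl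
  have hJp : ∀ t, 0 < J t := fun t => mom_pos h _ _
  set Nf : ℝ → ℝ := fun t => 1 / Q t * Real.log (J t / μ0) + C1 * t with hNf
  have hNd : ∀ t ∈ Icc ta tb, ∃ d, 0 ≤ d ∧ HasDerivAt Nf d t := by
    intro t ht
    obtain ⟨hQ0, hQ1⟩ := hq t ht
    have hq0' : Q t ≠ 0 := hQ0
    have ht' : t ∈ Ioo (-a) a := ⟨hta.trans_le ht.1, ht.2.trans_lt htb⟩
    have hQle : Q t ≤ 1/2 := (le_abs_self _).trans (hQ1.trans hq1)
    have hd1 := ((hQd t).inv hq0').mul (((hJd t).div_const μ0).log (div_pos (hJp t) hμ0p).ne')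
    have hd2 : HasDerivAt Nf (-(-σ) / Q t ^ 2 * Real.log (J t / μ0) +
      (Q t)⁻¹ * ((∫ x, F' x t * zeta 1 x ^ 4) / μ0 / (J t / μ0)) + C1 * 1) t := by
      have := hd1.add ((hasDerivAt_id t).const_mul C1)
      simp only [hNf, one_div]
      exact this
    refine ⟨_, ?_, hd2⟩
    set q := Q t with hqdef
    -- the pieces
    have hv := h.vform ht' (q := q) (by linarith) hq0' (ρ := 1) ⟨one_pos, le_rfl⟩
    have hvC := h.slice_rpow (q/2) t
    have hls := hCL _ hvC (fun x => Real.rpow_pos_of_pos (h.pos x t) _)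
    have hha := hardy hvC
    simp_rw [h.sq_half q t] at hls hha
    have hwt : Continuous fun x => w x t := (h.slice t).continuous
    have hwtq : ∀ m : ℝ, Continuous fun x => w x t ^ m := fun m => (h.slice_rpow m t).continuous
    have hwtl : Continuous fun x => Real.log (w x t) := hwt.log fun x => (h.pos x t).ne'
    have hwtd : Continuous fun x => deriv (w x) t :=
      h.tderiv_cont.comp (by fun_prop : Continuous fun x : E N => (x, t))
    set D := ∫ x, ‖fderiv ℝ (fun x => w x t ^ (q / 2)) x‖ ^ 2 * zeta 1 x ^ 4 with hD
    have hD0 : 0 ≤ D := integral_nonneg fun x => by have := zeta_nonneg 1 x; positivity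
    have eJ : (∫ x, w x t ^ q * zeta 1 x ^ 4) = J t := rfl
    rw [eJ] at hls hha
    set Z := ∫ x, w x t ^ q * zeta 1 x ^ 2 with hZ
    set G := ∫ x, deriv (w x) t * w x t ^ (q - 1) * zeta 1 x ^ 4 with hG
    set S := ∫ x, w x t ^ q * Real.log (w x t ^ q) * zeta 1 x ^ 4 with hS
    have iS : Integrable fun x => w x t ^ q * Real.log (w x t) * zeta 1 x ^ 4 :=
      zetapow_int one_pos (by norm_num) ((hwtq q).mul hwtl)
    have iG : Integrable fun x => deriv (w x) t * w x t ^ (q - 1) * zeta 1 x ^ 4 :=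
      zetapow_int one_pos (by norm_num) (hwtd.mul (hwtq _))
    have eS : S = q * ∫ x, w x t ^ q * Real.log (w x t) * zeta 1 x ^ 4 := by
      rw [hS, ← integral_const_mul]; congr 1; ext x
      rw [Real.log_rpow (h.pos x t)]; ring
    have eF : (∫ x, F' x t * zeta 1 x ^ 4) = q * G + (-σ) * (S / q) := by
      rw [eS, mul_div_cancel_left₀ _ hq0', hG, ← integral_const_mul, ← integral_const_mul, ← integral_add (iG.const_mul _) (iS.const_mul _)]
      congr 1; ext x; simp only [hF', ← hqdef]; ring
    rw [eF]
    have hJt := hJp t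
    have goal : 0 ≤ (σ / q ^ 2 * (J t * Real.log (J t / μ0)) - σ / q ^ 2 * S + G + C1 * J t) := by
      have hq2p : 0 < q ^ 2 := by positivity
      have k1 : σ / q ^ 2 * (S - J t * Real.log (J t / μ0)) ≤ 2 * q0 / q ^ 2 * (CL * D) := by
        refine (mul_le_mul_of_nonneg_left hls (by positivity)).trans ?_
        gcongr
      have k2 : 2 * q0 / q ^ 2 * (CL * D) ≤ (1/2) / q ^ 2 * D := by
        have : 2 * q0 / q ^ 2 * (CL * D) = (2 * q0 * CL) / q ^ 2 * D := by ring
        rw [this]; gcongr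
      have k3 : C0 * (1 + 1 / (1 - q)) * Z ≤ 3 * C0 * Z := by
        have hZ0 : 0 ≤ Z := integral_nonneg fun x =>
          mul_nonneg (Real.rpow_nonneg (h.pos _ _).le _) (pow_nonneg (zeta_nonneg 1 x) 2)
        have : 1 / (1 - q) ≤ 2 := by rw [div_le_iff₀] <;> linarith
        have h3 : C0 * (1 + 1 / (1 - q)) ≤ 3 * C0 := by
          have := mul_le_mul_of_nonneg_left this hC0
          linarith
        exact mul_le_mul_of_nonneg_right h3 hZ0
      have k4 : 3 * C0 * Z ≤ 3 * C0 * D + C1 * J t := by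
        have := mul_le_mul_of_nonneg_left hha (show 0 ≤ 3 * C0 by positivity)
        rw [hC1]; linarith
      have k5 : 3 * C0 * D ≤ (1/2) / q ^ 2 * D := by
        gcongr
        rw [le_div_iff₀ hq2p]
        have hh : q ^ 2 ≤ q0 ^ 2 := by rw [← sq_abs q]; exact pow_le_pow_left₀ (abs_nonneg _) hQ1 2
        exact (mul_le_mul_of_nonneg_left hh (by positivity)).trans hq3
      have k6 : (1:ℝ) / q ^ 2 * D ≤ 2 * (1 - q) / q ^ 2 * D := by gcongr; linarith
      have k7 : (1:ℝ) / q ^ 2 * D = (1/2) / q ^ 2 * D + (1/2) / q ^ 2 * D := by ring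
      linarith
    have e : -(-σ) / q ^ 2 * Real.log (J t / μ0) + q⁻¹ * ((q * G + -σ * (S / q)) / μ0 / (J t / μ0)) + C1 * 1 =
        (σ / q ^ 2 * (J t * Real.log (J t / μ0)) - σ / q ^ 2 * S + G + C1 * J t) / J t := by
      field_simp; ring
    rw [e]; positivity
  have hmono : MonotoneOn Nf (Icc ta tb) := by
    apply monotoneOn_of_deriv_nonneg (convex_Icc _ _)
    · intro t ht
      obtain ⟨d, _, hd⟩ := hNd t ht
      exact hd.continuousAt.continuousWithinAt
    · intro t ht
      obtain ⟨d, _, hd⟩ := hNd t (interior_subset ht)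
      exact hd.differentiableAt.differentiableWithinAt
    · intro t ht
      obtain ⟨d, hd0, hd⟩ := hNd t (interior_subset ht)
      rw [hd.deriv]; exact hd0
  have := hmono (left_mem_Icc.2 hab.le) (right_mem_Icc.2 hab.le) hab.le
  simp only [hNf, hJm, hQ, sub_self, mul_zero, sub_zero] at this
  linarith

lemma crossover {N : ℕ} (hN : 2 ≤ N) {C0 : ℝ} (hC0 : 0 ≤ C0) : ∃ q0 : ℝ, 0 < q0 ∧ q0 ≤ 1/2 ∧ ∃ C : ℝ, 0 < C ∧
    ∀ (a : ℝ) (w : E N → ℝ → ℝ), SS N C0 a w → a ≤ 1 → ∀ t1 ∈ Ioc (-a) (-1/2), ∀ t2 ∈ Ico (1/2) a,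
      mom w q0 t1 * mom w (-q0) t2 ≤ C := by
  obtain ⟨CL, hCL0, hCL⟩ := lsi hN
  set μ0 := ∫ x : E N, zeta 1 x ^ 4 with hμ0
  have hμ0p : 0 < μ0 := mu0_pos N
  set C1 := 3 * C0 * (1 + (N:ℝ)) ^ 2 with hC1
  have hC1p : 0 ≤ C1 := by positivity
  set q0 : ℝ := min (1/2) (min (1 / (4 * CL)) (1 / (6 * C0 + 1))) with hq0
  have hq0p : 0 < q0 := by rw [hq0]; positivity
  have hq01 : q0 ≤ 1/2 := min_le_left _ _
  have hq02 : 2 * q0 * CL ≤ 1/2 := by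
    have : q0 ≤ 1 / (4 * CL) := (min_le_right _ _).trans (min_le_left _ _)
    rw [le_div_iff₀ (by positivity)] at this; linarith
  have hq03 : 3 * C0 * q0 ^ 2 ≤ 1/2 := by
    have : q0 ≤ 1 / (6 * C0 + 1) := (min_le_right _ _).trans (min_le_right _ _)
    rw [le_div_iff₀ (by positivity)] at this
    have h2 : q0 ^ 2 ≤ q0 := by nlinarith
    nlinarith
  refine ⟨q0, hq0p, hq01, μ0 ^ 2 * Real.exp (q0 * (2 * C1)), by positivity, fun a w h ha t1 ht1 t2 ht2 => ?_⟩
  have ha2 : 1/2 < a := ht2.1.trans_lt ht2.2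
  -- derivative at q = 0
  set ℓ : ℝ → ℝ := fun q => Real.log (mom w q 0 / μ0) with hℓ
  have hw0 : Continuous fun p : E N × ℝ => w p.1 0 := h.cont.comp (by fun_prop : Continuous fun p : E N × ℝ => (p.1, (0:ℝ)))
  have hrc : Continuous fun p : E N × ℝ => w p.1 0 ^ p.2 :=
    hw0.rpow continuous_snd fun p => Or.inl (h.pos _ _).ne'
  have hdm := par_deriv (N := N) (F := fun x q => w x 0 ^ q) (F' := fun x q => w x 0 ^ q * Real.log (w x 0))
    hrc (hrc.mul (hw0.log fun p => (h.pos _ _).ne'))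
    (fun x q => Real.hasStrictDerivAt_const_rpow (h.pos x 0) q |>.hasDerivAt) (ρ := 1) one_pos (k := 4) (by norm_num) 0
  have hmp : 0 < mom w 0 0 := mom_pos h 0 0
  have hld := (hdm.div_const μ0).log (div_pos hmp hμ0p).ne'
  obtain ⟨L, hL⟩ : ∃ L, HasDerivAt ℓ L 0 := ⟨_, hld⟩
  have hℓ0 : ℓ 0 = 0 := by
    simp only [hℓ, mom, Real.rpow_zero, one_mul]
    rw [← hμ0, div_self hμ0p.ne', Real.log_one]
  rw [hasDerivAt_iff_tendsto_slope_zero] at hL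
  simp only [zero_add, hℓ0, sub_zero, smul_eq_mul] at hL
  have lim1 : Filter.Tendsto (fun δ : ℝ => δ⁻¹ * ℓ δ) (nhdsWithin 0 (Ioi 0)) (nhds L) :=
    hL.mono_left (nhdsWithin_mono _ fun x hx => (ne_of_gt hx : x ≠ 0))
  have lim2 : Filter.Tendsto (fun δ : ℝ => (-δ)⁻¹ * ℓ (-δ)) (nhdsWithin 0 (Ioi 0)) (nhds L) := by
    refine hL.comp (tendsto_nhdsWithin_iff.2 ⟨?_, ?_⟩)
    · have : Filter.Tendsto (fun δ : ℝ => -δ) (nhds 0) (nhds (-0)) := (continuous_neg).tendsto 0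
      rw [neg_zero] at this
      exact this.mono_left nhdsWithin_le_nhds
    · filter_upwards [self_mem_nhdsWithin] with δ hδ
      simp only [mem_compl_iff, mem_singleton_iff, neg_eq_zero]
      exact ne_of_gt hδ
  have hev : ∀ᶠ δ : ℝ in nhdsWithin 0 (Ioi 0), δ ∈ Ioo 0 q0 := Ioo_mem_nhdsGT hq0p
  have r1 : 1 / q0 * Real.log (mom w q0 t1 / μ0) - C1 ≤ L := by
    refine ge_of_tendsto lim1 (hev.mono fun δ hδ => ?_)
    have ht1' : 0 < -t1 := by linarith [ht1.2]
    have e : q0 - (q0 - δ) / (-t1) * (0 - t1) = δ := by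
      rw [zero_sub, div_mul_cancel₀ _ ht1'.ne']; ring
    have hg := gross_step hC0 hCL0 hCL h hq0p hq01 hq02 hq03 (ta := t1) (tb := 0) (qa := q0)
      (σ := (q0 - δ) / (-t1)) ht1.1 (by linarith) (by linarith) (div_nonneg (by linarith [hδ.2]) ht1'.le)
      (by rw [div_le_iff₀ ht1']; nlinarith [ht1.2, hδ.1]) (by
        intro t ht
        have h1 : (q0 - δ) / (-t1) * (t - t1) ≤ (q0 - δ) := by
          rw [div_mul_eq_mul_div, div_le_iff₀ ht1']
          have : t - t1 ≤ -t1 := by linarith [ht.2]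
          exact mul_le_mul_of_nonneg_left this (by linarith [hδ.2])
        have h2 : 0 ≤ (q0 - δ) / (-t1) * (t - t1) :=
          mul_nonneg (div_nonneg (by linarith [hδ.2]) ht1'.le) (by linarith [ht.1])
        have h3 := hδ.1
        refine ⟨by apply ne_of_gt; linarith, ?_⟩
        rw [abs_le]; constructor <;> linarith)
    rw [e, ← hμ0, ← hC1] at hg
    have : C1 * (0 - t1) ≤ C1 := by nlinarith [ht1.1]
    rw [← one_div]
    simp only [hℓ]; linarith
  have r2 : L - C1 ≤ 1 / (-q0) * Real.log (mom w (-q0) t2 / μ0) := by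
    have : Filter.Tendsto (fun δ : ℝ => (-δ)⁻¹ * ℓ (-δ) - C1) (nhdsWithin 0 (Ioi 0)) (nhds (L - C1)) :=
      lim2.sub_const C1
    refine le_of_tendsto this (hev.mono fun δ hδ => ?_)
    have ht2' : 0 < t2 := by linarith [ht2.1]
    have e : -δ - (q0 - δ) / t2 * (t2 - 0) = -q0 := by field_simp; ring
    have hg := gross_step hC0 hCL0 hCL h hq0p hq01 hq02 hq03 (ta := 0) (tb := t2) (qa := -δ)
      (σ := (q0 - δ) / t2) (by linarith) ht2' ht2.2 (div_nonneg (by linarith [hδ.2]) ht2'.le)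
      (by rw [div_le_iff₀ ht2']; nlinarith [ht2.1, hδ.1]) (by
        intro t ht
        have h1 : (q0 - δ) / t2 * (t - 0) ≤ (q0 - δ) := by
          rw [div_mul_eq_mul_div, div_le_iff₀ ht2']
          have : t - 0 ≤ t2 := by linarith [ht.2]
          exact mul_le_mul_of_nonneg_left this (by linarith [hδ.2])
        have h2 : 0 ≤ (q0 - δ) / t2 * (t - 0) :=
          mul_nonneg (div_nonneg (by linarith [hδ.2]) ht2'.le) (by linarith [ht.1])
        have h3 := hδ.1
        refine ⟨by apply ne_of_lt; linarith, ?_⟩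
        rw [abs_le]; constructor <;> linarith)
    rw [e, ← hμ0, ← hC1] at hg
    have : C1 * (t2 - 0) ≤ C1 := by nlinarith [ht2.2]
    rw [← one_div]
    simp only [hℓ]; linarith
  have m1 := mom_pos h q0 t1
  have m2 := mom_pos h (-q0) t2
  have r3 : Real.log (mom w q0 t1 / μ0) + Real.log (mom w (-q0) t2 / μ0) ≤ q0 * (2 * C1) := by
    have e1 : Real.log (mom w q0 t1 / μ0) = q0 * (1 / q0 * Real.log (mom w q0 t1 / μ0)) := by field_simp
    have e2 : Real.log (mom w (-q0) t2 / μ0) = - (q0 * (1 / (-q0) * Real.log (mom w (-q0) t2 / μ0))) := by field_simp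
    rw [e1, e2]
    have := mul_le_mul_of_nonneg_left (r1.trans (by linarith : L ≤ 1 / (-q0) * Real.log (mom w (-q0) t2 / μ0) + C1)) hq0p.le
    linarith
  rw [← Real.log_mul (by positivity) (by positivity), Real.log_le_iff_le_exp (by positivity)] at r3
  have e : mom w q0 t1 * mom w (-q0) t2 = μ0 ^ 2 * (mom w q0 t1 / μ0 * (mom w (-q0) t2 / μ0)) := by field_simp
  rw [e]; gcongr

lemma gn_ball {N : ℕ} (hN : 2 ≤ N) : ∃ C : ℝ, 0 < C ∧ ∀ v : E N → ℝ, ContDiff ℝ 1 v → (∀ x, 0 ≤ v x) →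
    ∀ ρ' ρ : ℝ, 0 < ρ' → ρ' < ρ → ρ ≤ 1 →
    ∫ x in closedBall (0 : E N) ρ', v x ^ (2 * chi N) ≤
      C * (ρ ^ 2 - ρ' ^ 2) ^ (-(4 * chi N)) * (∫ x, v x ^ 2 * zeta ρ x ^ 4) ^ (chi N - 1) *
       (2 * (∫ x, ‖fderiv ℝ v x‖ ^ 2 * zeta ρ x ^ 4) + 32 * ∫ x, v x ^ 2 * zeta ρ x ^ 2) := by
  obtain ⟨C, hC, hgn⟩ := gn hN
  have hχ := chi_gt hN
  refine ⟨C, hC, fun v hv hv0 ρ' ρ h0 h1 h2 => ?_⟩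
  have hρ : 0 < ρ := h0.trans h1
  have hd : 0 < ρ ^ 2 - ρ' ^ 2 := by nlinarith
  set d := ρ ^ 2 - ρ' ^ 2 with hdd
  have hz := zeta_cont (N := N) ρ
  have hcd : Continuous (fderiv ℝ v) := hv.continuous_fderiv (by norm_num)
  have hvc := hv.continuous
  have hfC : ContDiff ℝ 1 (fun x => v x * zeta ρ x ^ 2) := hv.mul (zetapow_contDiff ρ 0)
  have hfcs := zetapow_cs (N := N) hρ (k := 2) (by norm_num) v
  have g := hgn _ hfC hfcs
  have iD : Integrable fun x => ‖fderiv ℝ v x‖ ^ 2 * zeta ρ x ^ 4 := zetapow_int hρ (by norm_num) (by fun_prop)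
  have iZ : Integrable fun x => v x ^ 2 * zeta ρ x ^ 2 := zetapow_int hρ (by norm_num) (by fun_prop)
  have a2 := int_le3 (mulzeta_int hv hρ) iD iZ iZ 2 32 0 (fun x => by
    have := fderiv_mul_zeta hv hρ h2 x; linarith)
  have e1 : (∫ x, (v x * zeta ρ x ^ 2) ^ 2) = ∫ x, v x ^ 2 * zeta ρ x ^ 4 := by congr 1; ext x; ring
  rw [e1] at g
  have iF : Integrable fun x => |v x * zeta ρ x ^ 2| ^ (2 * chi N) := by
    apply cs_int
    · exact (hfC.continuous.abs).rpow_const fun x => Or.inr (by linarith)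
    · refine HasCompactSupport.intro (isCompact_closedBall (0 : E N) ρ) fun x hx => ?_
      rw [zeta_zero' hρ hx]; simp; exact Real.zero_rpow (by linarith)
  have e2 : ∫ x in closedBall (0 : E N) ρ', v x ^ (2 * chi N) ≤
      ∫ x in closedBall (0 : E N) ρ', d ^ (-(4 * chi N)) * |v x * zeta ρ x ^ 2| ^ (2 * chi N) := by
    refine setIntegral_mono_on ?_ (iF.integrableOn.const_mul _) measurableSet_closedBall fun x hx => ?_
    · exact (hvc.rpow_const fun x => Or.inr (by linarith)).continuousOn.integrableOn_compact (isCompact_closedBall _ _)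
    · have hx' : ‖x‖ ≤ ρ' := by simpa using hx
      have hzx : d ≤ zeta ρ x := by
        refine le_trans ?_ (le_max_left _ _)
        have := pow_le_pow_left₀ (norm_nonneg x) hx' 2
        linarith
      have : d ^ (4 * chi N) ≤ (zeta ρ x ^ 2) ^ (2 * chi N) := by
        rw [← Real.rpow_natCast, ← Real.rpow_mul (zeta_nonneg ρ x), show ((2:ℕ):ℝ) * (2 * chi N) = 4 * chi N by push_cast; ring]
        exact Real.rpow_le_rpow hd.le hzx (by linarith)
      rw [abs_of_nonneg (mul_nonneg (hv0 x) (pow_nonneg (zeta_nonneg ρ x) 2)), Real.mul_rpow (hv0 x) (pow_nonneg (zeta_nonneg ρ x) 2),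
        Real.rpow_neg hd.le, inv_mul_eq_div, le_div_iff₀ (by positivity)]
      exact mul_le_mul_of_nonneg_left this (Real.rpow_nonneg (hv0 x) _)
  have e3 : ∫ x in closedBall (0 : E N) ρ', |v x * zeta ρ x ^ 2| ^ (2 * chi N) ≤ ∫ x, |v x * zeta ρ x ^ 2| ^ (2 * chi N) :=
    setIntegral_le_integral iF (ae_of_all _ fun x => by positivity)
  rw [integral_const_mul] at e2
  have hY : 0 ≤ (∫ x, v x ^ 2 * zeta ρ x ^ 4) ^ (chi N - 1) := Real.rpow_nonneg (integral_nonneg fun x => by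
    have := zeta_nonneg ρ x; positivity) _
  calc _ ≤ d ^ (-(4 * chi N)) * ∫ x in closedBall (0 : E N) ρ', |v x * zeta ρ x ^ 2| ^ (2 * chi N) := e2
    _ ≤ d ^ (-(4 * chi N)) * (C * (∫ x, v x ^ 2 * zeta ρ x ^ 4) ^ (chi N - 1) *
       (2 * (∫ x, ‖fderiv ℝ v x‖ ^ 2 * zeta ρ x ^ 4) + 32 * (∫ x, v x ^ 2 * zeta ρ x ^ 2) + 0 * (∫ x, v x ^ 2 * zeta ρ x ^ 2))) := by
        refine mul_le_mul_of_nonneg_left (e3.trans (g.trans ?_)) (by positivity)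
        exact mul_le_mul_of_nonneg_left a2 (by positivity)
    _ = _ := by ring

lemma ball_par_cont {N : ℕ} {F : E N → ℝ → ℝ} (hF : Continuous fun p : E N × ℝ => F p.1 p.2) (ρ : ℝ) :
    Continuous fun t => ∫ x in closedBall (0 : E N) ρ, F x t := by
  exact continuous_parametric_integral_of_continuous (μ := (volume : Measure (E N)))
    (f := fun t x => F x t) (s := closedBall (0 : E N) ρ)
    (hF.comp (by fun_prop : Continuous fun p : ℝ × E N => (p.2, p.1))) (isCompact_closedBall _ _)

lemma zeta_int_le_ball {N : ℕ} {v : E N → ℝ} (hv : Continuous v) (hv0 : ∀ x, 0 ≤ v x) {ρ : ℝ} (h0 : 0 < ρ) (h1 : ρ ≤ 1)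
    {k : ℕ} (hk : k ≠ 0) : ∫ x, v x * zeta ρ x ^ k ≤ ∫ x in closedBall (0 : E N) ρ, v x := by
  rw [← setIntegral_eq_integral_of_forall_compl_eq_zero (s := closedBall (0 : E N) ρ)
    (fun x hx => by rw [zeta_zero' h0 hx]; simp [hk])]
  refine setIntegral_mono_on (zetapow_int h0 hk hv).integrableOn
    (hv.continuousOn.integrableOn_compact (isCompact_closedBall _ _)) measurableSet_closedBall fun x _ => ?_
  exact mul_le_of_le_one_right (hv0 x) (pow_le_one₀ (zeta_nonneg ρ x) (zeta_le_one h0 h1 x))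

lemma prh {N : ℕ} (hN : 2 ≤ N) {c : ℝ} (hc : 0 < c) : ∃ K : ℝ, 0 < K ∧ ∀ (V : E N → ℝ → ℝ),
    (Continuous fun p : E N × ℝ => V p.1 p.2) → (∀ t, ContDiff ℝ 1 fun x => V x t) →
    (Continuous fun p : E N × ℝ => ‖fderiv ℝ (fun x => V x p.2) p.1‖ ^ 2) → (∀ x t, 0 ≤ V x t) →
    ∀ ρ' ρ τ τ' T1 b : ℝ, 0 < ρ' → ρ' < ρ → ρ ≤ 1 → τ < τ' → τ' ≤ T1 → T1 - τ ≤ 2 → 0 ≤ b →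
    (∀ t ∈ Icc τ T1, ∃ d, HasDerivAt (fun t => ∫ x, V x t ^ 2 * zeta ρ x ^ 4) d t ∧
      d + c * (∫ x, ‖fderiv ℝ (fun x => V x t) x‖ ^ 2 * zeta ρ x ^ 4) ≤ b * ∫ x, V x t ^ 2 * zeta ρ x ^ 2) →
    ∫ t in τ'..T1, ∫ x in closedBall (0 : E N) ρ', V x t ^ (2 * chi N) ≤
      K * (ρ ^ 2 - ρ' ^ 2) ^ (-(4 * chi N)) * ((1 + 2 * b) / (τ' - τ) * ∫ t in τ..T1, ∫ x in closedBall (0 : E N) ρ, V x t ^ 2) ^ chi N := by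
  obtain ⟨C, hC, hgn⟩ := gn_ball hN
  have hχ := chi_gt hN
  refine ⟨C * (2 / c + 64), by positivity, fun V hVc hVC hDc hV0 ρ' ρ τ τ' T1 b h0 h1 h2 hτ hT hT2 hb hE => ?_⟩
  have hρ : 0 < ρ := h0.trans h1
  have hd : 0 < ρ ^ 2 - ρ' ^ 2 := by nlinarith
  set d0 := (ρ ^ 2 - ρ' ^ 2) ^ (-(4 * chi N)) with hd0
  have hd0p : 0 < d0 := Real.rpow_pos_of_pos hd _
  have hV2 : Continuous fun p : E N × ℝ => V p.1 p.2 ^ 2 := hVc.pow 2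
  set y : ℝ → ℝ := fun t => ∫ x, V x t ^ 2 * zeta ρ x ^ 4 with hy
  set D : ℝ → ℝ := fun t => ∫ x, ‖fderiv ℝ (fun x => V x t) x‖ ^ 2 * zeta ρ x ^ 4 with hD
  set Z : ℝ → ℝ := fun t => ∫ x, V x t ^ 2 * zeta ρ x ^ 2 with hZ
  set A : ℝ → ℝ := fun t => ∫ x in closedBall (0 : E N) ρ, V x t ^ 2 with hA
  have hDC : Continuous D := par_cont (F := fun x t => ‖fderiv ℝ (fun x => V x t) x‖ ^ 2) hDc hρ (by norm_num)
  have hAC : Continuous A := ball_par_cont (F := fun x t => V x t ^ 2) hV2 ρ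
  have hVt : ∀ t, Continuous fun x => V x t ^ 2 := fun t => (hVC t).continuous.pow 2
  have hyA : ∀ t, y t ≤ A t := fun t => zeta_int_le_ball (hVt t) (fun x => sq_nonneg _) hρ h2 (by norm_num)
  have hZA : ∀ t, Z t ≤ A t := fun t => zeta_int_le_ball (hVt t) (fun x => sq_nonneg _) hρ h2 (by norm_num)
  have hD0 : ∀ t, 0 ≤ D t := fun t => integral_nonneg fun x => by have := zeta_nonneg ρ x; positivity
  have hy0 : ∀ t, 0 ≤ y t := fun t => integral_nonneg fun x => by have := zeta_nonneg ρ x; positivity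
  have hA0 : ∀ t, 0 ≤ A t := fun t => integral_nonneg fun x => by positivity
  set G : ℝ → ℝ := fun t => (t - τ) * y t + c * (∫ s in τ..t, (s - τ) * D s) - (1 + 2 * b) * ∫ s in τ..t, A s with hG
  have hGd : ∀ t ∈ Icc τ T1, ∃ e, e ≤ 0 ∧ HasDerivAt G e t := by
    intro t ht
    obtain ⟨d, hd, hle⟩ := hE t ht
    have i1 : HasDerivAt (fun t => ∫ s in τ..t, (s - τ) * D s) ((t - τ) * D t) t := by
      have : Continuous fun s => (s - τ) * D s := by fun_prop
      exact (this.integral_hasStrictDerivAt τ t).hasDerivAt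
    have i2 : HasDerivAt (fun t => ∫ s in τ..t, A s) (A t) t := (hAC.integral_hasStrictDerivAt τ t).hasDerivAt
    have i3 : HasDerivAt G (1 * y t + (t - τ) * d + c * ((t - τ) * D t) - (1 + 2 * b) * A t) t :=
      ((((hasDerivAt_id t).sub_const τ).mul hd).add (i1.const_mul c)).sub (i2.const_mul (1 + 2 * b))
    refine ⟨_, ?_, i3⟩
    have ht0 : 0 ≤ t - τ := by linarith [ht.1]
    have k1 := mul_le_mul_of_nonneg_left hle ht0
    have k2 : (t - τ) * (b * Z t) ≤ 2 * (b * A t) := by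
      have : t - τ ≤ 2 := by linarith [ht.2]
      have h3 := mul_le_mul_of_nonneg_left (hZA t) hb
      have h4 : 0 ≤ b * A t := mul_nonneg hb (hA0 t)
      calc (t - τ) * (b * Z t) ≤ (t - τ) * (b * A t) := mul_le_mul_of_nonneg_left h3 ht0
        _ ≤ 2 * (b * A t) := mul_le_mul_of_nonneg_right this h4
    have k3 := hyA t
    have k4 : (t - τ) * (d + c * D t) = (t - τ) * d + c * ((t - τ) * D t) := by ring
    have k1' : (t - τ) * (d + c * D t) ≤ (t - τ) * (b * Z t) := k1
    linarith
  have hanti : AntitoneOn G (Icc τ T1) := by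
    apply antitoneOn_of_deriv_nonpos (convex_Icc _ _)
    · intro t ht
      obtain ⟨e, _, he⟩ := hGd t ht
      exact he.continuousAt.continuousWithinAt
    · intro t ht
      obtain ⟨e, _, he⟩ := hGd t (interior_subset ht)
      exact he.differentiableAt.differentiableWithinAt
    · intro t ht
      obtain ⟨e, he0, he⟩ := hGd t (interior_subset ht)
      rw [he.deriv]; exact he0
  have hT' : τ ≤ T1 := hτ.le.trans hT
  set Y := ∫ t in τ..T1, A t with hY
  have hY0 : 0 ≤ Y := intervalIntegral.integral_nonneg hT' fun t _ => hA0 t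
  have hδ : 0 < τ' - τ := by linarith
  set M := (1 + 2 * b) / (τ' - τ) * Y with hM
  have hM0 : 0 ≤ M := by positivity
  have hMY : (τ' - τ) * M = (1 + 2 * b) * Y := by rw [hM]; field_simp
  have hG0 : G τ = 0 := by simp [hG]
  have key : ∀ t ∈ Icc τ T1, (t - τ) * y t + c * (∫ s in τ..t, (s - τ) * D s) ≤ (τ' - τ) * M := by
    intro t ht
    have h3 := hanti (left_mem_Icc.2 hT') ht ht.1
    rw [hG0] at h3
    have h4 : ∫ s in τ..t, A s ≤ Y := by
      rw [hY]
      exact intervalIntegral.integral_mono_interval le_rfl ht.1 ht.2 (ae_of_all _ hA0) (hAC.intervalIntegrable _ _)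
    have h5 := mul_le_mul_of_nonneg_left h4 (show 0 ≤ 1 + 2 * b by positivity)
    simp only [hG] at h3
    rw [hMY]; linarith
  have hyM : ∀ t ∈ Icc τ' T1, y t ≤ M := by
    intro t ht
    have h3 := key t ⟨hτ.le.trans ht.1, ht.2⟩
    have h4 : 0 ≤ ∫ s in τ..t, (s - τ) * D s := intervalIntegral.integral_nonneg (hτ.le.trans ht.1) fun s hs =>
      mul_nonneg (by linarith [hs.1]) (hD0 s)
    have h5 : (τ' - τ) * y t ≤ (t - τ) * y t := mul_le_mul_of_nonneg_right (by linarith [ht.1]) (hy0 t)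
    have h6 := mul_nonneg hc.le h4
    exact le_of_mul_le_mul_left (by linarith) hδ
  have hDM : ∫ t in τ'..T1, D t ≤ M / c := by
    have h3 := key T1 (right_mem_Icc.2 hT')
    have hcD : Continuous fun s => (s - τ) * D s := by fun_prop
    have h4 : ∫ s in τ'..T1, (s - τ) * D s ≤ ∫ s in τ..T1, (s - τ) * D s := by
      refine intervalIntegral.integral_mono_interval hτ.le hT le_rfl ?_ (hcD.intervalIntegrable _ _)
      refine (ae_restrict_iff' measurableSet_Ioc).2 (ae_of_all _ fun s hs => mul_nonneg (by linarith [hs.1]) (hD0 s))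
    have h5 : ∫ s in τ'..T1, (τ' - τ) * D s ≤ ∫ s in τ'..T1, (s - τ) * D s := by
      refine intervalIntegral.integral_mono_on hT ((by fun_prop : Continuous fun s => (τ' - τ) * D s).intervalIntegrable _ _) (hcD.intervalIntegrable _ _) fun s hs => ?_
      exact mul_le_mul_of_nonneg_right (by linarith [hs.1]) (hD0 s)
    rw [intervalIntegral.integral_const_mul] at h5
    have h6 : 0 ≤ (T1 - τ) * y T1 := mul_nonneg (by linarith) (hy0 _)
    have h7 : c * ((τ' - τ) * ∫ t in τ'..T1, D t) ≤ (τ' - τ) * M :=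
      (mul_le_mul_of_nonneg_left (h5.trans h4) hc.le).trans (by linarith)
    rw [le_div_iff₀ hc]
    exact le_of_mul_le_mul_left (by linarith) hδ
  have hAM : ∫ t in τ'..T1, A t ≤ 2 * M := by
    have h3 : ∫ t in τ'..T1, A t ≤ Y :=
      intervalIntegral.integral_mono_interval hτ.le hT le_rfl (ae_of_all _ hA0) (hAC.intervalIntegrable _ _)
    have h4 : Y ≤ (1 + 2 * b) * Y := le_mul_of_one_le_left hY0 (by linarith)
    have h5 : (τ' - τ) * M ≤ 2 * M := mul_le_mul_of_nonneg_right (by linarith) hM0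
    linarith
  have hpt : ∀ t ∈ Icc τ' T1, ∫ x in closedBall (0 : E N) ρ', V x t ^ (2 * chi N) ≤
      C * d0 * M ^ (chi N - 1) * (2 * D t + 32 * A t) := by
    intro t ht
    refine (hgn _ (hVC t) (fun x => hV0 x t) ρ' ρ h0 h1 h2).trans ?_
    have h3 : y t ^ (chi N - 1) ≤ M ^ (chi N - 1) := Real.rpow_le_rpow (hy0 t) (hyM t ht) (by linarith)
    have h4 : 2 * D t + 32 * Z t ≤ 2 * D t + 32 * A t := by linarith [hZA t]
    have h5 : 0 ≤ Z t := integral_nonneg fun x => by have := zeta_nonneg ρ x; positivity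
    have h6 := hD0 t
    have h7 := hy0 t
    change C * d0 * y t ^ (chi N - 1) * (2 * D t + 32 * Z t) ≤ _
    gcongr
  have hLc : Continuous fun t => ∫ x in closedBall (0 : E N) ρ', V x t ^ (2 * chi N) :=
    ball_par_cont (F := fun x t => V x t ^ (2 * chi N)) (hVc.rpow_const fun p => Or.inr (by linarith)) ρ'
  have hRc : Continuous fun t => C * d0 * M ^ (chi N - 1) * (2 * D t + 32 * A t) := by fun_prop
  have h8 := intervalIntegral.integral_mono_on (μ := volume) hT (hLc.intervalIntegrable _ _) (hRc.intervalIntegrable _ _) hpt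
  have h2D : Continuous fun t => 2 * D t := by fun_prop
  have h32A : Continuous fun t => 32 * A t := by fun_prop
  rw [intervalIntegral.integral_const_mul, intervalIntegral.integral_add (h2D.intervalIntegrable _ _) (h32A.intervalIntegrable _ _),
    intervalIntegral.integral_const_mul, intervalIntegral.integral_const_mul] at h8
  have hMχ : M ^ (chi N - 1) * M = M ^ chi N := by
    rcases hM0.eq_or_lt with h | h
    · rw [← h, mul_zero, Real.zero_rpow (by linarith)]
    · nth_rewrite 2 [← Real.rpow_one M]
      rw [← Real.rpow_add h]; congr 1; ring
  calc _ ≤ _ := h8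
    _ ≤ C * d0 * M ^ (chi N - 1) * ((2 / c + 64) * M) := by
      have h9 : 0 ≤ M ^ (chi N - 1) := Real.rpow_nonneg hM0 _
      refine mul_le_mul_of_nonneg_left ?_ (by positivity)
      have : 2 * (M / c) = 2 / c * M := by ring
      linarith
    _ = C * (2 / c + 64) * d0 * (M ^ (chi N - 1) * M) := by ring
    _ = _ := by rw [hMχ]

lemma SS.grad_cont {N : ℕ} {C0 a : ℝ} {w : E N → ℝ → ℝ} (h : SS N C0 a w) :
    Continuous (fun p : E N × ℝ => ‖fderiv ℝ (fun y => w y p.2) p.1‖ ^ 2) := by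
  have hc : Continuous (fderiv ℝ (fun p : E N × ℝ => w p.1 p.2)) := h.smooth.continuous_fderiv (by norm_num)
  have e : ∀ p : E N × ℝ, fderiv ℝ (fun y => w y p.2) p.1 =
      (fderiv ℝ (fun p : E N × ℝ => w p.1 p.2) p).comp (ContinuousLinearMap.inl ℝ (E N) ℝ) := by
    intro p
    have h1 := (h.smooth.differentiable (by norm_num) p).hasFDerivAt
    have h2 : HasFDerivAt (fun y : E N => (y, p.2)) (ContinuousLinearMap.inl ℝ (E N) ℝ) p.1 := hasFDerivAt_prodMk_left p.1 p.2
    exact (HasFDerivAt.comp (g := fun p : E N × ℝ => w p.1 p.2) p.1 h1 h2).fderiv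
  simp_rw [e]
  fun_prop

lemma SS.grad_rpow_cont {N : ℕ} {C0 a : ℝ} {w : E N → ℝ → ℝ} (h : SS N C0 a w) (m : ℝ) :
    Continuous (fun p : E N × ℝ => ‖fderiv ℝ (fun y => w y p.2 ^ m) p.1‖ ^ 2) := by
  simp_rw [h.grad_rpow m]
  exact continuous_const.mul (h.grad_cont.mul (h.rpow_cont (q := fun _ => 2 * m - 2) continuous_const))

lemma SS.mom_deriv {N : ℕ} {C0 a : ℝ} {w : E N → ℝ → ℝ} (h : SS N C0 a w) (q : ℝ) {ρ : ℝ} (hρ : 0 < ρ) (t : ℝ) :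
    HasDerivAt (fun t => ∫ x, w x t ^ q * zeta ρ x ^ 4)
      (q * ∫ x, deriv (w x) t * w x t ^ (q - 1) * zeta ρ x ^ 4) t := by
  have := par_deriv (F := fun x t => w x t ^ q) (F' := fun x t => deriv (w x) t * q * w x t ^ (q - 1))
    (h.rpow_cont (q := fun _ => q) continuous_const)
    ((h.tderiv_cont.mul continuous_const).mul (h.rpow_cont (q := fun _ => q - 1) continuous_const))
    (fun x t => (h.tderiv x t).rpow_const (Or.inl (h.pos x t).ne')) hρ (k := 4) (by norm_num) t
  convert this using 1
  rw [← integral_const_mul]; congr 1; ext x; ring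

lemma SS.half_chi {N : ℕ} {C0 a : ℝ} {w : E N → ℝ → ℝ} (h : SS N C0 a w) (q χ t : ℝ) (x : E N) :
    (w x t ^ (q / 2)) ^ (2 * χ) = w x t ^ (q * χ) := by
  rw [← Real.rpow_mul (h.pos x t).le]; congr 1; ring

lemma step_neg {N : ℕ} (hN : 2 ≤ N) {C0 : ℝ} (hC0 : 0 ≤ C0) : ∃ K : ℝ, 0 < K ∧ ∀ (a : ℝ) (w : E N → ℝ → ℝ), SS N C0 a w → a ≤ 1 →
    ∀ m ρ' ρ τ τ' T1 : ℝ, 0 < m → 0 < ρ' → ρ' < ρ → ρ ≤ 1 → -a < τ → τ < τ' → τ' ≤ T1 → T1 < a →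
    ∫ t in τ'..T1, ∫ x in closedBall (0 : E N) ρ', w x t ^ (-m * chi N) ≤
      K * (ρ ^ 2 - ρ' ^ 2) ^ (-(4 * chi N)) * ((1 + 2 * (2 * C0 * m)) / (τ' - τ) *
        ∫ t in τ..T1, ∫ x in closedBall (0 : E N) ρ, w x t ^ (-m)) ^ chi N := by
  obtain ⟨K, hK, hp⟩ := prh hN (c := 2) two_pos
  refine ⟨K, hK, fun a w h ha m ρ' ρ τ τ' T1 hm h0 h1 h2 h3 h4 h5 h6 => ?_⟩
  have hρ : 0 < ρ := h0.trans h1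
  have := hp (fun x t => w x t ^ (-m / 2)) (h.rpow_cont (q := fun _ => -m / 2) continuous_const)
    (fun t => h.slice_rpow _ t) (h.grad_rpow_cont _) (fun x t => Real.rpow_nonneg (h.pos x t).le _)
    ρ' ρ τ τ' T1 (2 * C0 * m) h0 h1 h2 h4 h5 (by linarith) (by positivity) ?_
  · simp_rw [h.sq_half, h.half_chi] at this
    exact this
  · intro t ht
    have ht' : t ∈ Ioo (-a) a := ⟨h3.trans_le ht.1, ht.2.trans_lt h6⟩
    simp_rw [h.sq_half]
    refine ⟨_, h.mom_deriv (-m) hρ t, ?_⟩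
    have hv := h.vform ht' (q := -m) (by linarith) (by linarith) (ρ := ρ) ⟨hρ, h2⟩
    set D := ∫ x, ‖fderiv ℝ (fun x => w x t ^ (-m / 2)) x‖ ^ 2 * zeta ρ x ^ 4 with hD
    have hD0 : 0 ≤ D := integral_nonneg fun x => by have := zeta_nonneg ρ x; positivity
    set Z := ∫ x, w x t ^ (-m) * zeta ρ x ^ 2 with hZ
    have hZ0 : 0 ≤ Z := integral_nonneg fun x =>
          mul_nonneg (Real.rpow_nonneg (h.pos _ _).le _) (pow_nonneg (zeta_nonneg ρ x) 2)
    set G := ∫ x, deriv (w x) t * w x t ^ (-m - 1) * zeta ρ x ^ 4 with hG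
    have k1 := mul_le_mul_of_nonneg_left hv hm.le
    have k2 : m * (2 * (1 - -m) / (-m) ^ 2 * D) = 2 / m * D + 2 * D := by field_simp; ring
    have k3 : 1 / (1 - -m) ≤ 1 := by rw [div_le_one] <;> linarith
    have k4 : C0 * (1 + 1 / (1 - -m)) * Z ≤ C0 * 2 * Z := by gcongr; linarith
    have k5 := mul_le_mul_of_nonneg_left k4 hm.le
    have k6 : 0 ≤ 2 / m * D := by positivity
    rw [mul_sub, k2] at k1
    linarith

set_option maxHeartbeats 200000 in
lemma step_pos {N : ℕ} (hN : 2 ≤ N) {C0 : ℝ} (hC0 : 0 ≤ C0) {q : ℝ} (hq : 0 < q) (hq1 : q < 1) :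
    ∃ K : ℝ, 0 < K ∧ ∀ (a : ℝ) (w : E N → ℝ → ℝ), SS N C0 a w → a ≤ 1 →
    ∀ ρ' ρ τ τ' T1 : ℝ, 0 < ρ' → ρ' < ρ → ρ ≤ 1 → -a < τ → τ < τ' → τ' ≤ T1 → T1 < a →
    ∫ t in (-T1)..(-τ'), ∫ x in closedBall (0 : E N) ρ', w x t ^ (q * chi N) ≤
      K * (ρ ^ 2 - ρ' ^ 2) ^ (-(4 * chi N)) * ((1 + 2 * (C0 * (1 + 1 / (1 - q)) * q)) / (τ' - τ) *
        ∫ t in (-T1)..(-τ), ∫ x in closedBall (0 : E N) ρ, w x t ^ q) ^ chi N := by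
  have hq1' : 0 < 1 - q := by linarith
  obtain ⟨K, hK, hp⟩ := prh hN (c := 2 * (1 - q) / q) (by positivity)
  refine ⟨K, hK, fun a w h ha ρ' ρ τ τ' T1 h0 h1 h2 h3 h4 h5 h6 => ?_⟩
  have hρ : 0 < ρ := h0.trans h1
  have hneg : Continuous fun p : E N × ℝ => (p.1, -p.2) := by fun_prop
  have c1 : Continuous fun p : E N × ℝ => w p.1 (-p.2) ^ (q / 2) := by
    have := (h.rpow_cont (q := fun _ => q / 2) continuous_const).comp hneg
    simpa only [Function.comp_def] using this
  have c2 : Continuous (fun p : E N × ℝ => ‖fderiv ℝ (fun y => w y (-p.2) ^ (q / 2)) p.1‖ ^ 2) := by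
    have := (h.grad_rpow_cont (q/2)).comp hneg
    simpa only [Function.comp_def] using this
  have := hp (fun x t => w x (-t) ^ (q / 2)) c1
    (fun t => h.slice_rpow _ (-t)) c2 (fun x t => Real.rpow_nonneg (h.pos x (-t)).le _)
    ρ' ρ τ τ' T1 (C0 * (1 + 1 / (1 - q)) * q) h0 h1 h2 h4 h5 (by linarith) (by positivity) ?_
  · simp_rw [h.sq_half, h.half_chi] at this
    rw [intervalIntegral.integral_comp_neg (fun t => ∫ x in closedBall (0 : E N) ρ', w x t ^ (q * chi N)),
      intervalIntegral.integral_comp_neg (fun t => ∫ x in closedBall (0 : E N) ρ, w x t ^ q)] at this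
    exact this
  · intro t ht
    have ht' : -t ∈ Ioo (-a) a := ⟨by linarith [ht.2], by linarith [ht.1]⟩
    simp_rw [h.sq_half]
    have hd : HasDerivAt (fun t => ∫ x, w x (-t) ^ q * zeta ρ x ^ 4)
      ((q * ∫ x, deriv (w x) (-t) * w x (-t) ^ (q - 1) * zeta ρ x ^ 4) * (-1)) t :=
      HasDerivAt.comp (h₂ := fun t => ∫ x, w x t ^ q * zeta ρ x ^ 4) t (h.mom_deriv q hρ (-t)) (hasDerivAt_neg t)
    refine ⟨_, hd, ?_⟩
    have hv := h.vform ht' (q := q) (by linarith) (by linarith) (ρ := ρ) ⟨hρ, h2⟩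
    set D := ∫ x, ‖fderiv ℝ (fun x => w x (-t) ^ (q / 2)) x‖ ^ 2 * zeta ρ x ^ 4 with hD
    set Z := ∫ x, w x (-t) ^ q * zeta ρ x ^ 2 with hZ
    set G := ∫ x, deriv (w x) (-t) * w x (-t) ^ (q - 1) * zeta ρ x ^ 4 with hG
    have k1 := mul_le_mul_of_nonneg_left hv hq.le
    have k2 : q * (2 * (1 - q) / q ^ 2 * D) = 2 * (1 - q) / q * D := by field_simp
    rw [mul_sub, k2] at k1
    linarith

lemma moser_seq {χ D B : ℝ} (hχ : 1 < χ) (hD : 0 < D) (hB : 1 ≤ B) : ∃ G : ℝ, 1 ≤ G ∧ ∀ Y : ℕ → ℝ, (∀ j, 0 ≤ Y j) →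
    (∀ j, Y (j + 1) ≤ (D * B ^ j * Y j) ^ χ) → ∀ j, Y j ≤ (G * Y 0) ^ (χ ^ j) := by
  have hB0 : 0 < B := by linarith
  have hχ1 : 0 < χ - 1 := by linarith
  set α := χ / (χ - 1) with hα
  have hα0 : 0 < α := by positivity
  set H := max 1 (D ^ χ * B ^ α) with hH
  have hH1 : 1 ≤ H := le_max_left _ _
  set G := H ^ (1 / (χ - 1)) with hG
  have hG1 : 1 ≤ G := Real.one_le_rpow hH1 (by positivity)
  have hG0 : 0 < G := by linarith
  have hGχ : G ^ (χ - 1) = H := by rw [hG, ← Real.rpow_mul (by linarith)]; rw [one_div_mul_cancel hχ1.ne', Real.rpow_one]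
  refine ⟨G, hG1, fun Y hY hstep => ?_⟩
  have key : ∀ j : ℕ, G * B ^ (α * j) * Y j ≤ (G * Y 0) ^ (χ ^ j) := by
    intro j
    induction j with
    | zero => simp
    | succ j ih =>
      have hZ0 : 0 ≤ G * B ^ (α * j) * Y j := by have := hY j; positivity
      have h1 : (G * B ^ (α * j) * Y j) ^ χ ≤ (G * Y 0) ^ (χ ^ (j + 1)) := by
        rw [pow_succ, Real.rpow_mul (mul_nonneg hG0.le (hY 0))]
        exact Real.rpow_le_rpow hZ0 ih (by linarith)
      refine le_trans ?_ h1
      have h2 : G * B ^ (α * (j + 1 : ℕ)) * Y (j + 1) ≤ G * B ^ (α * (j + 1 : ℕ)) * (D * B ^ j * Y j) ^ χ :=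
        mul_le_mul_of_nonneg_left (hstep j) (by positivity)
      refine h2.trans ?_
      rw [Real.mul_rpow (by positivity) (hY j), Real.mul_rpow (by positivity) (hY j), ← mul_assoc]
      refine mul_le_mul_of_nonneg_right ?_ (Real.rpow_nonneg (hY j) _)
      rw [Real.mul_rpow hD.le (by positivity), Real.mul_rpow hG0.le (by positivity), ← Real.rpow_natCast B j,
        ← Real.rpow_mul hB0.le, ← Real.rpow_mul hB0.le]
      have e1 : G ^ χ = G * H := by
        rw [← hGχ]; nth_rewrite 2 [← Real.rpow_one G]; rw [← Real.rpow_add hG0]; congr 1; ring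
      have e2 : B ^ (α * ((j + 1 : ℕ) : ℝ)) * B ^ ((j:ℝ) * χ) = B ^ α * B ^ (α * j * χ) := by
        rw [← Real.rpow_add hB0, ← Real.rpow_add hB0]; congr 1
        rw [hα]; push_cast; field_simp; ring
      have e3 : D ^ χ * B ^ α ≤ H := le_max_right _ _
      rw [e1]
      calc G * B ^ (α * ((j + 1 : ℕ) : ℝ)) * (D ^ χ * B ^ ((j:ℝ) * χ))
          = G * (D ^ χ) * (B ^ (α * ((j + 1 : ℕ) : ℝ)) * B ^ ((j:ℝ) * χ)) := by ring
        _ = G * (D ^ χ * B ^ α) * B ^ (α * j * χ) := by rw [e2]; ring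
        _ ≤ G * H * B ^ (α * j * χ) := by gcongr
  intro j
  refine le_trans ?_ (key j)
  refine le_mul_of_one_le_left (hY j) ?_
  have := Real.one_le_rpow hB (by positivity : 0 ≤ α * j)
  exact one_le_mul_of_one_le_of_one_le hG1 this

/-- space-time integral -/
def sint {N : ℕ} (w : E N → ℝ → ℝ) (q ρ a b : ℝ) : ℝ := ∫ t in a..b, ∫ x in closedBall (0 : E N) ρ, w x t ^ q

lemma SS.slice_int_cont {N : ℕ} {C0 a : ℝ} {w : E N → ℝ → ℝ} (h : SS N C0 a w) (q ρ : ℝ) :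
    Continuous fun t => ∫ x in closedBall (0 : E N) ρ, w x t ^ q :=
  ball_par_cont (F := fun x t => w x t ^ q) (h.rpow_cont (q := fun _ => q) continuous_const) ρ

lemma SS.slice_int_nonneg {N : ℕ} {C0 a : ℝ} {w : E N → ℝ → ℝ} (h : SS N C0 a w) (q ρ t : ℝ) :
    0 ≤ ∫ x in closedBall (0 : E N) ρ, w x t ^ q :=
  integral_nonneg fun x => Real.rpow_nonneg (h.pos x t).le _

lemma SS.sint_nonneg {N : ℕ} {C0 a : ℝ} {w : E N → ℝ → ℝ} (h : SS N C0 a w) (q ρ : ℝ) {s t : ℝ} (hst : s ≤ t) :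
    0 ≤ sint w q ρ s t :=
  intervalIntegral.integral_nonneg hst fun t _ => h.slice_int_nonneg q ρ t

lemma moser_Y {N : ℕ} (hN : 2 ≤ N) {C0 : ℝ} (hC0 : 0 ≤ C0) {q0 : ℝ} (hq0 : 0 < q0) : ∃ G : ℝ, 1 ≤ G ∧
    ∀ (a : ℝ) (w : E N → ℝ → ℝ), SS N C0 a w → a ≤ 1 → ∀ T1 ∈ Ioo (3/4) a, ∀ j : ℕ,
      sint w (-(q0 * chi N ^ j)) (1/2 + (1/2) ^ j / 4) (3/4 - (1/2) ^ j / 4) T1 ≤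
        (G * sint w (-q0) (3/4) (1/2) T1) ^ (chi N ^ j) := by
  have hχ := chi_gt hN
  set χ := chi N with hχd
  have hχ0 : 0 < χ := by linarith
  obtain ⟨K, hK, hstep⟩ := step_neg hN hC0
  obtain ⟨G, hG, hseq⟩ := moser_seq (χ := χ) (D := K ^ (1 / χ) * 8 ^ 5 * (1 + 4 * C0 * q0)) (B := 32 * χ) hχ (by positivity) (by linarith)
  refine ⟨G, hG, fun a w h ha T1 hT j => ?_⟩
  have hpow : ∀ j : ℕ, (0:ℝ) < (1/2) ^ j ∧ ((1/2:ℝ)) ^ j ≤ 1 := fun j =>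
    ⟨by positivity, pow_le_one₀ (by norm_num) (by norm_num)⟩
  have hs := hseq (fun j => sint w (-(q0 * χ ^ j)) (1/2 + (1/2) ^ j / 4) (3/4 - (1/2) ^ j / 4) T1)
    (fun j => h.sint_nonneg _ _ (by linarith [(hpow j).1, hT.1])) ?_ j
  · refine hs.trans (le_of_eq ?_)
    congr 2
    simp only [pow_zero, mul_one]
    norm_num
  · intro j
    obtain ⟨e1, e2⟩ := hpow j
    set e : ℝ := (1/2) ^ j with he
    have he' : (1/2 : ℝ) ^ (j + 1) = e / 2 := by rw [pow_succ]; ring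
    have hm : 0 < q0 * χ ^ j := by positivity
    have h1 := hstep a w h ha (q0 * χ ^ j) (1/2 + e / 2 / 4) (1/2 + e / 4) (3/4 - e / 4) (3/4 - e / 2 / 4) T1 hm
      (by linarith) (by linarith) (by linarith) (by linarith [hT.1, hT.2]) (by linarith) (by linarith [hT.1]) hT.2
    simp only [he']
    have hexp : -(q0 * χ ^ (j + 1)) = -(q0 * χ ^ j) * χ := by rw [pow_succ]; ring
    rw [hexp]
    refine h1.trans ?_
    rw [← hχd]
    change _ * (_ * sint w (-(q0 * χ ^ j)) (1/2 + e / 4) (3/4 - e / 4) T1) ^ χ ≤ _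
    have hS0 := h.sint_nonneg (-(q0 * χ ^ j)) (1/2 + e / 4) (show 3/4 - e / 4 ≤ T1 by linarith [hT.1])
    set S := sint w (-(q0 * χ ^ j)) (1/2 + e / 4) (3/4 - e / 4) T1
    have e3 : e / 8 ≤ (1/2 + e / 4) ^ 2 - (1/2 + e / 2 / 4) ^ 2 := by nlinarith
    have e4 : ((1/2 + e / 4) ^ 2 - (1/2 + e / 2 / 4) ^ 2) ^ (-(4 * χ)) ≤ ((e / 8)⁻¹ ^ 4) ^ χ := by
      rw [Real.rpow_neg (by linarith), ← Real.inv_rpow (by linarith), ← Real.rpow_natCast ((e/8)⁻¹) 4, ← Real.rpow_mul (by positivity)]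
      push_cast
      refine Real.rpow_le_rpow (inv_nonneg.2 (by linarith)) ?_ (by positivity)
      exact inv_anti₀ (by positivity) e3
    have hχj : 1 ≤ χ ^ j := one_le_pow₀ hχ.le
    have e5 : (1 + 2 * (2 * C0 * (q0 * χ ^ j))) / (3/4 - e / 2 / 4 - (3/4 - e / 4)) ≤ (1 + 4 * C0 * q0) * χ ^ j * (e/8)⁻¹ := by
      rw [show 3/4 - e / 2 / 4 - (3/4 - e / 4) = e / 8 by ring, div_eq_mul_inv]
      refine mul_le_mul_of_nonneg_right ?_ (by positivity)
      nlinarith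
    have e6 : (K ^ (1/χ)) ^ χ = K := by rw [← Real.rpow_mul hK.le, one_div_mul_cancel hχ0.ne', Real.rpow_one]
    have e7 : (e / 8)⁻¹ = 8 * 2 ^ j := by rw [he]; field_simp; rw [← mul_pow]; norm_num
    calc _ ≤ K * ((e / 8)⁻¹ ^ 4) ^ χ * ((1 + 4 * C0 * q0) * χ ^ j * (e/8)⁻¹ * S) ^ χ := by
          have : 0 ≤ (1 + 2 * (2 * C0 * (q0 * χ ^ j))) / (3/4 - e / 2 / 4 - (3/4 - e / 4)) * S := by
            rw [show 3/4 - e / 2 / 4 - (3/4 - e / 4) = e / 8 by ring]; positivity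
          gcongr
      _ = (K ^ (1/χ) * (e / 8)⁻¹ ^ 4 * ((1 + 4 * C0 * q0) * χ ^ j * (e/8)⁻¹ * S)) ^ χ := by
          rw [Real.mul_rpow (x := K ^ (1/χ) * (e / 8)⁻¹ ^ 4) (by positivity) (by positivity),
            Real.mul_rpow (x := K ^ (1/χ)) (by positivity) (by positivity), e6]
      _ = _ := by
          congr 1
          rw [e7, mul_pow 32 χ j, show (32:ℝ) = 2 ^ 5 by norm_num, ← pow_mul, mul_comm 5 j, pow_mul]; ring

lemma moser_D {N : ℕ} (hN : 2 ≤ N) {C0 : ℝ} (hC0 : 0 ≤ C0) {q0 : ℝ} (hq0 : 0 < q0) : ∃ G : ℝ, 1 ≤ G ∧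
    ∀ (a : ℝ) (w : E N → ℝ → ℝ), SS N C0 a w → a ≤ 1 → ∀ xs ∈ ball (0 : E N) (1/2), ∀ ts ∈ Ioo (3/4) a,
      w xs ts ^ (-q0) ≤ G * sint w (-q0) (3/4) (1/2) ts := by
  have hχ := chi_gt hN
  obtain ⟨G, hG, hY⟩ := moser_Y hN hC0 hq0
  set χ := chi N with hχd
  refine ⟨G, hG, fun a w h ha xs hxs ts hts => ?_⟩
  by_contra! hlt
  set S := G * sint w (-q0) (3/4) (1/2) ts with hS
  have hS0 : 0 ≤ S := mul_nonneg (by linarith) (h.sint_nonneg _ _ (by linarith [hts.1]))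
  obtain ⟨l, hl1, hl2⟩ := exists_between hlt
  have hl0 : 0 < l := by linarith
  -- neighbourhood
  have hc : Continuous fun p : E N × ℝ => w p.1 p.2 ^ (-q0) := h.rpow_cont (q := fun _ => -q0) continuous_const
  have hev : ∀ᶠ p in nhds ((xs, ts) : E N × ℝ), l < w p.1 p.2 ^ (-q0) :=
    (hc.tendsto (xs, ts)).eventually (lt_mem_nhds hl2)
  obtain ⟨δ, hδ0, hδ⟩ := Metric.eventually_nhds_iff_ball.1 hev
  set δ' := min (δ / 2) (min ((1/2 - dist xs 0)) (ts - 3/4)) with hδ'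
  have hxs' : dist xs 0 < 1/2 := hxs
  have hδ'0 : 0 < δ' := by
    apply lt_min (by linarith) (lt_min (by linarith) (by linarith [hts.1]))
  have d1 : δ' ≤ δ / 2 := min_le_left _ _
  have d2 : δ' ≤ 1/2 - dist xs 0 := (min_le_right _ _).trans (min_le_left _ _)
  have d3 : δ' ≤ ts - 3/4 := (min_le_right _ _).trans (min_le_right _ _)
  set v := (volume (closedBall xs (δ' / 2))).toReal with hv
  have hv0 : 0 < v := ENNReal.toReal_pos (measure_closedBall_pos _ _ (by linarith)).ne' measure_closedBall_lt_top.ne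
  have hlow : ∀ j : ℕ, l ^ (χ ^ j) * (v * δ') ≤ S ^ (χ ^ j) := by
    intro j
    refine le_trans ?_ (hY a w h ha ts hts j)
    have hpw : ∀ x ∈ closedBall xs (δ' / 2), ∀ t ∈ Icc (ts - δ') ts, l ^ (χ ^ j) ≤ w x t ^ (-(q0 * χ ^ j)) := by
      intro x hx t ht
      have hm : (x, t) ∈ ball ((xs, ts) : E N × ℝ) δ := by
        rw [mem_ball, Prod.dist_eq, max_lt_iff]
        constructor
        · have : dist x xs ≤ δ' / 2 := hx
          show dist x xs < δ
          linarith
        · show dist t ts < δ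
          rw [Real.dist_eq, abs_lt]; constructor <;> linarith [ht.1, ht.2]
      rw [show -(q0 * χ ^ j) = -q0 * χ ^ j by ring, Real.rpow_mul (h.pos x t).le]
      exact Real.rpow_le_rpow hl0.le (hδ _ hm).le (by positivity)
    have hp : (0:ℝ) < (1/2) ^ j := by positivity
    have hcont := h.slice_int_cont (-(q0 * χ ^ j)) (1/2 + (1/2) ^ j / 4)
    have s1 : ∀ t ∈ Icc (ts - δ') ts, l ^ (χ ^ j) * v ≤ ∫ x in closedBall (0 : E N) (1/2 + (1/2) ^ j / 4), w x t ^ (-(q0 * χ ^ j)) := by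
      intro t ht
      have hct : Continuous fun x => w x t ^ (-(q0 * χ ^ j)) := (h.slice_rpow _ t).continuous
      have i1 : l ^ (χ ^ j) * v = ∫ x in closedBall xs (δ' / 2), l ^ (χ ^ j) := by
        rw [setIntegral_const, smul_eq_mul, mul_comm]; rfl
      rw [i1]
      refine (setIntegral_mono_on (continuous_const.continuousOn.integrableOn_compact (isCompact_closedBall _ _))
        (hct.continuousOn.integrableOn_compact (isCompact_closedBall _ _)) measurableSet_closedBall (fun x hx => hpw x hx t ht)).trans ?_
      refine setIntegral_mono_set (hct.continuousOn.integrableOn_compact (isCompact_closedBall _ _))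
        (ae_of_all _ fun x => Real.rpow_nonneg (h.pos x t).le _) (Filter.Eventually.of_forall ?_)
      exact closedBall_subset_closedBall' (by linarith)
    have s2 : l ^ (χ ^ j) * (v * δ') ≤ sint w (-(q0 * χ ^ j)) (1/2 + (1/2) ^ j / 4) (ts - δ') ts := by
      have := intervalIntegral.integral_mono_on (μ := volume) (by linarith : ts - δ' ≤ ts) (continuous_const.intervalIntegrable _ _)
        (hcont.intervalIntegrable _ _) s1
      rw [intervalIntegral.integral_const, smul_eq_mul] at this
      refine le_trans (le_of_eq (by ring)) this
    refine s2.trans ?_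
    exact intervalIntegral.integral_mono_interval (by linarith) (by linarith) le_rfl
      (ae_of_all _ fun t => h.slice_int_nonneg _ _ t) (hcont.intervalIntegrable _ _)
  -- contradiction
  have hr : S / l < 1 := by rw [div_lt_one hl0]; exact hl1
  have hlim : Filter.Tendsto (fun j : ℕ => (S / l) ^ j) Filter.atTop (nhds 0) :=
    tendsto_pow_atTop_nhds_zero_of_lt_one (by positivity) hr
  have hχt : Filter.Tendsto (fun j : ℕ => χ ^ j) Filter.atTop Filter.atTop := tendsto_pow_atTop_atTop_of_one_lt hχ
  have hup : ∀ n : ℕ, v * δ' ≤ (S / l) ^ n := by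
    intro n
    obtain ⟨j, hj⟩ := (hχt.eventually_ge_atTop (n : ℝ)).exists
    have h1 := hlow j
    have h2 : v * δ' ≤ (S / l) ^ (χ ^ j) := by
      rw [Real.div_rpow hS0 hl0.le, le_div_iff₀ (by positivity)]; linarith
    refine h2.trans ?_
    rw [← Real.rpow_natCast (S / l) n]
    rcases hS0.eq_or_lt with h3 | h3
    · exfalso
      rw [← h3, zero_div, Real.zero_rpow (by positivity)] at h2
      exact absurd h2 (not_le.2 (by positivity))
    · exact Real.rpow_le_rpow_of_exponent_ge (by positivity) hr.le hj
  have := ge_of_tendsto' hlim hup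
  exact absurd this (not_le.2 (by positivity))

lemma phaseD {N : ℕ} (hN : 2 ≤ N) {C0 : ℝ} (hC0 : 0 ≤ C0) : ∃ q0 : ℝ, 0 < q0 ∧ ∃ C : ℝ, 0 < C ∧
    ∀ (a : ℝ) (w : E N → ℝ → ℝ), SS N C0 a w → a ≤ 1 → ∀ t1 ∈ Ioc (-a) (-1/2),
      ∀ xs ∈ ball (0 : E N) (1/2), ∀ ts ∈ Ioo (3/4) a, mom w q0 t1 ≤ C * w xs ts ^ q0 := by
  obtain ⟨q0, hq0, hq01, C, hC, hcr⟩ := crossover hN hC0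
  obtain ⟨G, hG, hm⟩ := moser_D hN hC0 hq0
  refine ⟨q0, hq0, G * ((16/7) ^ 4 * C), by positivity, fun a w h ha t1 ht1 xs hxs ts hts => ?_⟩
  have h1 := hm a w h ha xs hxs ts hts
  have hm0 := mom_pos h q0 t1
  have hM : Continuous fun t => mom w (-q0) t :=
    par_cont (F := fun x t => w x t ^ (-q0)) (h.rpow_cont (q := fun _ => -q0) continuous_const) one_pos (by norm_num)
  have h2 : ∀ t ∈ Icc (1/2) ts, ∫ x in closedBall (0 : E N) (3/4), w x t ^ (-q0) ≤ (16/7) ^ 4 * mom w (-q0) t := by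
    intro t _
    have hct : Continuous fun x => w x t ^ (-q0) := (h.slice_rpow _ t).continuous
    have hi : Integrable fun x => w x t ^ (-q0) * zeta 1 x ^ 4 := zetapow_int one_pos (by norm_num) hct
    have : ∫ x in closedBall (0 : E N) (3/4), w x t ^ (-q0) ≤ ∫ x in closedBall (0 : E N) (3/4), (16/7) ^ 4 * (w x t ^ (-q0) * zeta 1 x ^ 4) := by
      refine setIntegral_mono_on (hct.continuousOn.integrableOn_compact (isCompact_closedBall _ _))
        (hi.integrableOn.const_mul _) measurableSet_closedBall fun x hx => ?_
      have hx' : ‖x‖ ≤ 3/4 := by simpa using hx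
      have hz : 7/16 ≤ zeta 1 x := le_trans (by nlinarith [norm_nonneg x]) (le_max_left _ _)
      have hz4 : (7/16:ℝ) ^ 4 ≤ zeta 1 x ^ 4 := pow_le_pow_left₀ (by norm_num) hz 4
      have hw := (Real.rpow_nonneg (h.pos x t).le (-q0))
      calc w x t ^ (-q0) = (16/7) ^ 4 * (w x t ^ (-q0) * (7/16) ^ 4) := by norm_num; ring
        _ ≤ _ := by gcongr
    refine this.trans ?_
    rw [integral_const_mul]
    refine mul_le_mul_of_nonneg_left ?_ (by positivity)
    exact setIntegral_le_integral hi (ae_of_all _ fun x => mul_nonneg (Real.rpow_nonneg (h.pos x t).le _) (pow_nonneg (zeta_nonneg _ _) _))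
  have h3 : mom w q0 t1 * sint w (-q0) (3/4) (1/2) ts ≤ (16/7) ^ 4 * C := by
    have k1 : ∀ t ∈ Icc (1/2) ts, mom w q0 t1 * ∫ x in closedBall (0 : E N) (3/4), w x t ^ (-q0) ≤ (16/7) ^ 4 * C := by
      intro t ht
      calc _ ≤ mom w q0 t1 * ((16/7) ^ 4 * mom w (-q0) t) := mul_le_mul_of_nonneg_left (h2 t ht) hm0.le
        _ = (16/7) ^ 4 * (mom w q0 t1 * mom w (-q0) t) := by ring
        _ ≤ _ := mul_le_mul_of_nonneg_left (hcr a w h ha t1 ht1 t ⟨ht.1, ht.2.trans_lt hts.2⟩) (by positivity)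
    have hcc : Continuous fun t => mom w q0 t1 * ∫ x in closedBall (0 : E N) (3/4), w x t ^ (-q0) :=
      continuous_const.mul (h.slice_int_cont (-q0) (3/4))
    have k2 := intervalIntegral.integral_mono_on (μ := volume) (by linarith [hts.1] : 1/2 ≤ ts)
      (hcc.intervalIntegrable _ _) (continuous_const.intervalIntegrable _ _) k1
    rw [intervalIntegral.integral_const_mul, intervalIntegral.integral_const, smul_eq_mul] at k2
    refine le_trans k2 (mul_le_of_le_one_left (a := ts - 1/2) (by positivity) (by linarith [hts.2]))
  have hw := h.pos xs ts
  have h4 : mom w q0 t1 * w xs ts ^ (-q0) ≤ G * ((16/7) ^ 4 * C) := by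
    calc _ ≤ mom w q0 t1 * (G * sint w (-q0) (3/4) (1/2) ts) := mul_le_mul_of_nonneg_left h1 hm0.le
      _ = G * (mom w q0 t1 * sint w (-q0) (3/4) (1/2) ts) := by ring
      _ ≤ _ := mul_le_mul_of_nonneg_left h3 (by linarith)
  rw [Real.rpow_neg hw.le, ← div_eq_mul_inv, div_le_iff₀ (by positivity)] at h4
  exact h4

/-- the inductive property -/
def PE (N : ℕ) (C0 q : ℝ) : Prop := ∀ ρ ∈ Ico (1/2 : ℝ) 1, ∀ τ ∈ Ioc (1/2 : ℝ) (3/4), ∃ C : ℝ, 0 < C ∧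
    ∀ (a : ℝ) (w : E N → ℝ → ℝ), SS N C0 a w → a ≤ 1 → ∀ T1 ∈ Ioo (3/4) a,
      ∀ xs ∈ ball (0 : E N) (1/2), ∀ ts ∈ Ioo (3/4) a, sint w q ρ (-T1) (-τ) ≤ C * w xs ts ^ q

lemma pe_base {N : ℕ} (hN : 2 ≤ N) {C0 : ℝ} (hC0 : 0 ≤ C0) : ∃ q0 : ℝ, 0 < q0 ∧ ∀ q, 0 < q → q ≤ q0 → PE N C0 q := by
  obtain ⟨q0, hq0, C, hC, hD⟩ := phaseD hN hC0
  refine ⟨q0, hq0, fun q hq hqq ρ hρ τ hτ => ?_⟩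
  have hz0 : 0 < 1 - ρ ^ 2 := by nlinarith [hρ.1, hρ.2]
  set v := (volume (closedBall (0 : E N) ρ)).toReal with hv
  have hv0 : 0 ≤ v := ENNReal.toReal_nonneg
  refine ⟨v + ((1 - ρ ^ 2) ^ 4)⁻¹ * C, by positivity, fun a w h ha T1 hT xs hxs ts hts => ?_⟩
  set m := w xs ts with hm
  have hm0 : 0 < m := h.pos _ _
  have k1 : ∀ t ∈ Icc (-T1) (-τ), ∫ x in closedBall (0 : E N) ρ, w x t ^ q ≤ (v + ((1 - ρ ^ 2) ^ 4)⁻¹ * C) * m ^ q := by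
    intro t ht
    have hd := hD a w h ha t ⟨by linarith [ht.1, hT.2], by linarith [ht.2, hτ.1]⟩ xs hxs ts hts
    have hct : Continuous fun x => w x t ^ q := (h.slice_rpow _ t).continuous
    have hct0 : Continuous fun x => w x t ^ q0 := (h.slice_rpow _ t).continuous
    have hi : Integrable fun x => w x t ^ q0 * zeta 1 x ^ 4 := zetapow_int one_pos (by norm_num) hct0
    have i1 : IntegrableOn (fun _ : E N => m ^ q) (closedBall (0 : E N) ρ) :=
      continuous_const.continuousOn.integrableOn_compact (isCompact_closedBall _ _)
    have i2 : IntegrableOn (fun x => m ^ q * (m ^ q0)⁻¹ * ((1 - ρ ^ 2) ^ 4)⁻¹ * (w x t ^ q0 * zeta 1 x ^ 4)) (closedBall (0 : E N) ρ) :=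
      hi.integrableOn.const_mul _
    have : ∫ x in closedBall (0 : E N) ρ, w x t ^ q ≤ ∫ x in closedBall (0 : E N) ρ,
        (m ^ q + m ^ q * (m ^ q0)⁻¹ * ((1 - ρ ^ 2) ^ 4)⁻¹ * (w x t ^ q0 * zeta 1 x ^ 4)) := by
      refine setIntegral_mono_on (hct.continuousOn.integrableOn_compact (isCompact_closedBall _ _))
        (i1.add i2) measurableSet_closedBall fun x hx => ?_
      have hx' : ‖x‖ ≤ ρ := by simpa using hx
      have hz : 1 - ρ ^ 2 ≤ zeta 1 x := le_trans (by nlinarith [norm_nonneg x]) (le_max_left _ _)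
      have hz4 : (1 - ρ ^ 2) ^ 4 ≤ zeta 1 x ^ 4 := pow_le_pow_left₀ hz0.le hz 4
      have hw := h.pos x t
      have e1 : w x t ^ q ≤ m ^ q + m ^ q * (m ^ q0)⁻¹ * w x t ^ q0 := by
        have hr : 0 < w x t / m := by positivity
        have e2 : (w x t / m) ^ q ≤ 1 + (w x t / m) ^ q0 := by
          rcases le_total (w x t / m) 1 with h1 | h1
          · have := Real.rpow_le_one hr.le h1 hq.le
            have h3 : 0 ≤ (w x t / m) ^ q0 := by positivity
            linarith
          · have := Real.rpow_le_rpow_of_exponent_le h1 hqq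
            linarith
        rw [Real.div_rpow hw.le hm0.le, Real.div_rpow hw.le hm0.le, div_le_iff₀ (by positivity)] at e2
        refine e2.trans (le_of_eq ?_)
        field_simp
      refine e1.trans ?_
      have e3 : w x t ^ q0 ≤ ((1 - ρ ^ 2) ^ 4)⁻¹ * (w x t ^ q0 * zeta 1 x ^ 4) := by
        rw [inv_mul_eq_div, le_div_iff₀ (by positivity)]
        gcongr
      have e4 : 0 ≤ m ^ q * (m ^ q0)⁻¹ := by positivity
      have := mul_le_mul_of_nonneg_left e3 e4
      linarith
    refine this.trans ?_
    rw [integral_add i1 i2, setIntegral_const, integral_const_mul, smul_eq_mul]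
    have e5 : ∫ x in closedBall (0 : E N) ρ, w x t ^ q0 * zeta 1 x ^ 4 ≤ C * m ^ q0 := le_trans
      (setIntegral_le_integral hi (ae_of_all _ fun x => mul_nonneg (Real.rpow_nonneg (h.pos x t).le _) (pow_nonneg (zeta_nonneg _ _) _))) hd
    have e6 : 0 ≤ m ^ q * (m ^ q0)⁻¹ * ((1 - ρ ^ 2) ^ 4)⁻¹ := by positivity
    have e7 := mul_le_mul_of_nonneg_left e5 e6
    have e8 : m ^ q * (m ^ q0)⁻¹ * ((1 - ρ ^ 2) ^ 4)⁻¹ * (C * m ^ q0) = ((1 - ρ ^ 2) ^ 4)⁻¹ * C * m ^ q := by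
      have : m ^ q0 ≠ 0 := by positivity
      field_simp
    have e9 : (volume : Measure (E N)).real (closedBall (0 : E N) ρ) = v := rfl
    rw [e9]
    linarith
  have k2 := intervalIntegral.integral_mono_on (μ := volume) (by linarith [hT.1, hτ.2] : -T1 ≤ -τ)
    ((h.slice_int_cont q ρ).intervalIntegrable _ _) (continuous_const.intervalIntegrable _ _) k1
  rw [intervalIntegral.integral_const, smul_eq_mul] at k2
  refine le_trans k2 (mul_le_of_le_one_left (a := -τ - -T1) (by positivity) (by linarith [hT.2, hτ.1]))

lemma pe_step {N : ℕ} (hN : 2 ≤ N) {C0 : ℝ} (hC0 : 0 ≤ C0) {q : ℝ} (hq : 0 < q) (hq1 : q < 1) (hP : PE N C0 q) :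
    PE N C0 (q * chi N) := by
  intro ρ hρ τ hτ
  have hχ := chi_gt hN
  obtain ⟨K, hK, hst⟩ := step_pos hN hC0 hq hq1
  obtain ⟨C, hC, hp⟩ := hP ((ρ + 1) / 2) ⟨by linarith [hρ.1], by linarith [hρ.2]⟩ ((τ + 1/2) / 2)
    ⟨by linarith [hτ.1], by linarith [hτ.1, hτ.2]⟩
  have h1q : 0 < 1 - q := by linarith
  have hτ' : 0 < τ - (τ + 1/2) / 2 := by linarith [hτ.1]
  have hρ' : 0 < ((ρ + 1) / 2) ^ 2 - ρ ^ 2 := by nlinarith [hρ.1, hρ.2]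
  set b := (1 + 2 * (C0 * (1 + 1 / (1 - q)) * q)) / (τ - (τ + 1/2) / 2) with hb
  have hb0 : 0 < b := by positivity
  refine ⟨K * (((ρ + 1) / 2) ^ 2 - ρ ^ 2) ^ (-(4 * chi N)) * (b * C) ^ chi N, by positivity,
    fun a w h ha T1 hT xs hxs ts hts => ?_⟩
  have h1 := hst a w h ha ρ ((ρ + 1) / 2) ((τ + 1/2) / 2) τ T1 (by linarith [hρ.1]) (by linarith [hρ.2]) (by linarith [hρ.2])
    (by linarith [hτ.1, hT.1, hT.2]) (by linarith [hτ.1]) (by linarith [hτ.2, hT.1]) hT.2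
  have h2 := hp a w h ha T1 hT xs hxs ts hts
  have h3 := h.sint_nonneg q ((ρ + 1) / 2) (by linarith [hτ.2, hT.1] : -T1 ≤ -((τ + 1/2) / 2))
  have hm0 : 0 < w xs ts := h.pos _ _
  refine h1.trans ?_
  rw [← hb]
  change _ * (b * sint w q ((ρ + 1) / 2) (-T1) (-((τ + 1/2) / 2))) ^ chi N ≤ _
  rw [Real.rpow_mul hm0.le, mul_assoc (K * _), ← Real.mul_rpow (by positivity) (by positivity), mul_assoc b]
  gcongr

lemma phaseE {N : ℕ} (hN : 2 ≤ N) {C0 : ℝ} (hC0 : 0 ≤ C0) {q : ℝ} (hq : 0 < q) (hqχ : q < chi N) : PE N C0 q := by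
  have hχ := chi_gt hN
  obtain ⟨q0, hq0, hbase⟩ := pe_base hN hC0
  have key : ∀ n : ℕ, ∀ q : ℝ, 0 < q → q < chi N → q ≤ q0 * chi N ^ n → PE N C0 q := by
    intro n
    induction n with
    | zero => intro q hq _ h; exact hbase q hq (by simpa using h)
    | succ n ih =>
      intro q hq h1 h2
      have hχ0 : 0 < chi N := by linarith
      have h3 := ih (q / chi N) (by positivity) (by rw [div_lt_iff₀ hχ0]; nlinarith) (by
        rw [div_le_iff₀ hχ0]; rw [pow_succ] at h2; linarith)
      have := pe_step hN hC0 (by positivity) (by rw [div_lt_one hχ0]; exact h1) h3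
      rwa [div_mul_cancel₀ _ hχ0.ne'] at this
  obtain ⟨n, hn⟩ := ((tendsto_pow_atTop_atTop_of_one_lt hχ).eventually_ge_atTop (q / q0)).exists
  rw [div_le_iff₀ hq0] at hn
  exact key n q hq hqχ (by linarith)

lemma int_le_dom {α : Type*} [MeasurableSpace α] {μ : Measure α} {f g : α → ℝ} (hg : Integrable g μ)
    (hg0 : 0 ≤ᵐ[μ] g) (h : f ≤ᵐ[μ] g) : ∫ x, f x ∂μ ≤ ∫ x, g x ∂μ := by
  by_cases hf : Integrable f μ
  · exact integral_mono_ae hf hg h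
  · rw [integral_undef hf]; exact integral_nonneg_of_ae hg0

lemma alg_aux {p a b e f : ℝ} (hp : 0 < p) (hb : 0 < b) (hab : b ≤ a) (he : 0 ≤ e) (hf : 0 ≤ f) :
    (a - b) * (a ^ (-p) * e ^ 2 - b ^ (-p) * f ^ 2) ≤ (1 + 1 / p) * (a ^ (1 - p) * (max (e - f) 0) ^ 2) := by
  have ha : 0 < a := hb.trans_le hab
  have h1 : a ^ (-p) * (1 + p * (1 - b / a)) ≤ b ^ (-p) := by
    have h2 := Real.add_one_le_exp (p * (1 - b / a))
    have h3 : Real.log (b / a) ≤ b / a - 1 := Real.log_le_sub_one_of_pos (by positivity)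
    have h4 : Real.exp (p * (1 - b / a)) ≤ (b / a) ^ (-p) := by
      rw [Real.rpow_def_of_pos (by positivity)]
      apply Real.exp_le_exp.2
      nlinarith
    have h5 : b ^ (-p) = a ^ (-p) * (b / a) ^ (-p) := by
      rw [Real.div_rpow hb.le ha.le]; field_simp
    rw [h5]
    exact mul_le_mul_of_nonneg_left (by linarith) (by positivity)
  have hap : 0 < a ^ (-p) := by positivity
  have e1 : a ^ (1 - p) = a * a ^ (-p) := by
    rw [show 1 - p = 1 + -p by ring, Real.rpow_add ha, Real.rpow_one]
  set θ := 1 - b / a with hθ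
  have hba : a - b = a * θ := by rw [hθ]; field_simp
  have hθ0 : 0 ≤ θ := by rw [hθ, sub_nonneg, div_le_one ha]; exact hab
  have hθ1 : θ ≤ 1 := by rw [hθ]; linarith [div_pos hb ha]
  have h6 : a ^ (-p) * e ^ 2 - b ^ (-p) * f ^ 2 ≤ a ^ (-p) * (e ^ 2 - (1 + p * θ) * f ^ 2) := by
    have := mul_le_mul_of_nonneg_right h1 (sq_nonneg f)
    linarith
  have h7 : θ * (e ^ 2 - (1 + p * θ) * f ^ 2) ≤ (1 + 1 / p) * (max (e - f) 0) ^ 2 := by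
    rcases le_total e f with hef | hef
    · have : e ^ 2 - (1 + p * θ) * f ^ 2 ≤ 0 := by
        have h8 : e ^ 2 ≤ f ^ 2 := pow_le_pow_left₀ he hef 2
        have h9 : 0 ≤ p * θ * f ^ 2 := by positivity
        linarith
      exact (mul_nonpos_of_nonneg_of_nonpos hθ0 this).trans (by positivity)
    · rw [max_eq_left (by linarith)]
      set d := e - f with hd
      have hd0 : 0 ≤ d := by linarith
      have he' : e = d + f := by linarith
      have h8 : 2 * (θ * f) * d ≤ p * (θ * f) ^ 2 + 1 / p * d ^ 2 := by
        have : 0 ≤ (p * (θ * f) - d) ^ 2 / p := by positivity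
        have e2 : (p * (θ * f) - d) ^ 2 / p = p * (θ * f) ^ 2 + 1 / p * d ^ 2 - 2 * (θ * f) * d := by field_simp; ring
        linarith
      have h9 : θ * d ^ 2 ≤ d ^ 2 := mul_le_of_le_one_left (sq_nonneg d) hθ1
      rw [he']
      calc θ * ((d + f) ^ 2 - (1 + p * θ) * f ^ 2) = θ * d ^ 2 + 2 * (θ * f) * d - p * (θ * f) ^ 2 := by ring
        _ ≤ _ := by linarith
  calc (a - b) * (a ^ (-p) * e ^ 2 - b ^ (-p) * f ^ 2) ≤ (a - b) * (a ^ (-p) * (e ^ 2 - (1 + p * θ) * f ^ 2)) :=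
        mul_le_mul_of_nonneg_left h6 (by linarith)
    _ = (a * a ^ (-p)) * (θ * (e ^ 2 - (1 + p * θ) * f ^ 2)) := by rw [hba]; ring
    _ ≤ (a * a ^ (-p)) * ((1 + 1 / p) * (max (e - f) 0) ^ 2) := mul_le_mul_of_nonneg_left h7 (by positivity)
    _ = _ := by rw [e1]; ring

lemma alg_nl {p a b e f : ℝ} (hp : 0 < p) (ha : 0 < a) (hb : 0 < b) (he : 0 ≤ e) (hf : 0 ≤ f) :
    (a - b) * (a ^ (-p) * e ^ 2 - b ^ (-p) * f ^ 2) ≤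
      (1 + 1 / p) * (a ^ (1 - p) * (max (e - f) 0) ^ 2) + (1 + 1 / p) * (b ^ (1 - p) * (max (f - e) 0) ^ 2) := by
  rcases le_total b a with h | h
  · have := alg_aux hp hb h he hf
    have h2 : 0 ≤ (1 + 1 / p) * (b ^ (1 - p) * (max (f - e) 0) ^ 2) := by positivity
    linarith
  · have := alg_aux hp ha h hf he
    have h2 : 0 ≤ (1 + 1 / p) * (a ^ (1 - p) * (max (e - f) 0) ^ 2) := by positivity
    linarith

/-- smooth cutoff approximating `zeta^2` -/
def eta {N : ℕ} (k ρ : ℝ) (x : E N) : ℝ := (ρ ^ 2 - ‖x‖ ^ 2) ^ 2 * expNegInvGlue (k * (ρ ^ 2 - ‖x‖ ^ 2))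

lemma eta_smooth {N : ℕ} (k ρ : ℝ) : ContDiff ℝ (⊤ : ℕ∞) (eta k ρ : E N → ℝ) := by
  have h : ContDiff ℝ (⊤ : ℕ∞) (fun x : E N => ρ ^ 2 - ‖x‖ ^ 2) := contDiff_const.sub (contDiff_norm_sq ℝ)
  have h2 : ContDiff ℝ (⊤ : ℕ∞) (fun x : E N => expNegInvGlue (k * (ρ ^ 2 - ‖x‖ ^ 2))) :=
    expNegInvGlue.contDiff.comp (contDiff_const.mul h)
  exact (h.pow 2).mul h2

lemma glue_le_one (s : ℝ) : expNegInvGlue s ≤ 1 := by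
  unfold expNegInvGlue
  split_ifs with h
  · norm_num
  · push Not at h
    rw [Real.exp_le_one_iff]; have := inv_pos.2 h; linarith

lemma eta_eq {N : ℕ} {k : ℝ} (hk : 0 < k) (ρ : ℝ) (x : E N) : eta k ρ x = zeta ρ x ^ 2 * expNegInvGlue (k * zeta ρ x) := by
  unfold eta zeta
  rcases le_total (ρ ^ 2 - ‖x‖ ^ 2) 0 with h | h
  · rw [max_eq_right h, expNegInvGlue.zero_of_nonpos (mul_nonpos_of_nonneg_of_nonpos hk.le h)]; simp
  · rw [max_eq_left h]

lemma eta_nonneg {N : ℕ} (k ρ : ℝ) (x : E N) : 0 ≤ eta k ρ x :=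
  mul_nonneg (sq_nonneg _) (expNegInvGlue.nonneg _)

lemma eta_le {N : ℕ} {k : ℝ} (hk : 0 < k) (ρ : ℝ) (x : E N) : eta k ρ x ≤ zeta ρ x ^ 2 := by
  rw [eta_eq hk]; exact mul_le_of_le_one_right (by positivity) (glue_le_one _)

lemma psi_lip {k z z' : ℝ} (hk : 0 < k) (hz' : 0 ≤ z') (h : z' ≤ z) :
    z ^ 2 * expNegInvGlue (k * z) - z' ^ 2 * expNegInvGlue (k * z') ≤ 3 * z * (z - z') := by
  have hz : 0 ≤ z := hz'.trans h
  rcases hz'.eq_or_lt with h0 | h0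
  · rw [← h0]
    have := mul_le_mul_of_nonneg_left (glue_le_one (k * z)) (sq_nonneg z)
    have := expNegInvGlue.nonneg (k * z)
    simp; nlinarith [sq_nonneg z]
  · have hz0 : 0 < z := h0.trans_le h
    have e : ∀ y, 0 < y → expNegInvGlue (k * y) = Real.exp (-(k * y)⁻¹) := by
      intro y hy; unfold expNegInvGlue; rw [if_neg]; push Not; positivity
    rw [e z hz0, e z' h0]
    set g := Real.exp (-(k * z)⁻¹) with hg
    have hg0 : 0 < g := Real.exp_pos _
    have hg1 : g ≤ 1 := by rw [hg, Real.exp_le_one_iff]; have : 0 < (k * z)⁻¹ := by positivity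
                           linarith
    have hgk : g ≤ k * z := by
      have h1 : (k * z)⁻¹ ≤ Real.exp ((k * z)⁻¹) := by linarith [Real.add_one_le_exp ((k * z)⁻¹)]
      rw [hg, Real.exp_neg]
      exact inv_le_of_inv_le₀ (by positivity) h1
    have hg' : g * (1 - (z - z') / (k * z * z')) ≤ Real.exp (-(k * z')⁻¹) := by
      have : Real.exp (-(k * z')⁻¹) = g * Real.exp (-((z - z') / (k * z * z'))) := by
        rw [hg, ← Real.exp_add]; congr 1; field_simp; ring
      rw [this]
      refine mul_le_mul_of_nonneg_left ?_ hg0.le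
      have := Real.add_one_le_exp (-((z - z') / (k * z * z')))
      linarith
    have h2 := mul_le_mul_of_nonneg_left hg' (sq_nonneg z')
    have h3 : z' ^ 2 * (g * (1 - (z - z') / (k * z * z'))) = z' ^ 2 * g - g * (z' / (k * z)) * (z - z') := by
      field_simp
    have h4 : g * (z' / (k * z)) ≤ z := by
      have : z' / (k * z) ≤ z / (k * z) := by gcongr
      calc g * (z' / (k * z)) ≤ (k * z) * (z / (k * z)) := by gcongr
        _ = z := by field_simp
    have h5 := mul_le_mul_of_nonneg_right h4 (sub_nonneg.2 h)
    have h6 : (z ^ 2 - z' ^ 2) * g ≤ 2 * z * (z - z') := by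
      calc (z ^ 2 - z' ^ 2) * g ≤ (z ^ 2 - z' ^ 2) * 1 := mul_le_mul_of_nonneg_left hg1 (by nlinarith)
        _ ≤ _ := by nlinarith [mul_nonneg (sub_nonneg.2 h) (sub_nonneg.2 h)]
    linarith

lemma zeta_lip {N : ℕ} {ρ : ℝ} (h0 : 0 < ρ) (h1 : ρ ≤ 1) (x y : E N) (h : zeta ρ y ≤ zeta ρ x) :
    zeta ρ x - zeta ρ y ≤ 2 * ‖x - y‖ := by
  rcases le_or_gt ρ ‖x‖ with hx | hx
  · rw [zeta_zero h0 hx] at h ⊢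
    have := zeta_nonneg ρ y; have := norm_nonneg (x - y); linarith
  have hn : ‖y‖ ≤ ‖x‖ + ‖x - y‖ := by
    have := norm_sub_norm_le y x; rw [norm_sub_rev] at this; linarith
  have ex : zeta ρ x = ρ ^ 2 - ‖x‖ ^ 2 := max_eq_left (by nlinarith [norm_nonneg x])
  rcases le_or_gt ρ ‖y‖ with hy | hy
  · rw [zeta_zero h0 hy, ex, sub_zero]
    have : ρ ^ 2 - ‖x‖ ^ 2 = (ρ - ‖x‖) * (ρ + ‖x‖) := by ring
    rw [this]
    have := norm_nonneg x
    calc (ρ - ‖x‖) * (ρ + ‖x‖) ≤ ‖x - y‖ * 2 := by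
          apply mul_le_mul <;> first | positivity | linarith
      _ = _ := by ring
  · have ey : zeta ρ y = ρ ^ 2 - ‖y‖ ^ 2 := max_eq_left (by nlinarith [norm_nonneg y])
    rw [ex, ey]
    have := norm_nonneg x
    have := norm_nonneg y
    have : ρ ^ 2 - ‖x‖ ^ 2 - (ρ ^ 2 - ‖y‖ ^ 2) = (‖y‖ - ‖x‖) * (‖y‖ + ‖x‖) := by ring
    rw [this]
    calc (‖y‖ - ‖x‖) * (‖y‖ + ‖x‖) ≤ ‖x - y‖ * 2 := by
          apply mul_le_mul <;> first | positivity | linarith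
      _ = _ := by ring

lemma eta_lip {N : ℕ} {k : ℝ} (hk : 0 < k) {ρ : ℝ} (h0 : 0 < ρ) (h1 : ρ ≤ 1) (x y : E N) :
    max (eta k ρ x - eta k ρ y) 0 ≤ 6 * zeta ρ x * min ‖x - y‖ 1 := by
  have hx := zeta_nonneg ρ x
  have hy := zeta_nonneg ρ y
  have hn := norm_nonneg (x - y)
  have hm : 0 ≤ min ‖x - y‖ 1 := le_min hn zero_le_one
  refine max_le ?_ (by positivity)
  rcases le_total (zeta ρ y) (zeta ρ x) with h | h
  · have p1 : eta k ρ x - eta k ρ y ≤ 3 * zeta ρ x * (zeta ρ x - zeta ρ y) := by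
      rw [eta_eq hk, eta_eq hk]; exact psi_lip hk hy h
    have p2 := zeta_lip h0 h1 x y h
    have p3 : zeta ρ x - zeta ρ y ≤ 2 * min ‖x - y‖ 1 := by
      rw [mul_min_of_nonneg _ _ zero_le_two]
      exact le_min p2 (by linarith [zeta_le_one h0 h1 x])
    calc _ ≤ _ := p1
      _ ≤ 3 * zeta ρ x * (2 * min ‖x - y‖ 1) := by gcongr
      _ = _ := by ring
  · have : eta k ρ x ≤ eta k ρ y := by
      rw [eta_eq hk, eta_eq hk]
      have : expNegInvGlue (k * zeta ρ x) ≤ expNegInvGlue (k * zeta ρ y) :=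
        expNegInvGlue.monotone (by gcongr)
      have := expNegInvGlue.nonneg (k * zeta ρ x)
      gcongr
    have : (0:ℝ) ≤ 6 * zeta ρ x * min ‖x - y‖ 1 := by positivity
    linarith

lemma eta_grad {N : ℕ} {k : ℝ} (hk : 0 < k) {ρ : ℝ} (h0 : 0 < ρ) (h1 : ρ ≤ 1) (x : E N) :
    ‖fderiv ℝ (eta k ρ) x‖ ≤ 6 * zeta ρ x := by
  have hd := ((eta_smooth (N := N) k ρ).differentiable (by simp) x).hasFDerivAt
  refine le_of_forall_pos_le_add fun ε hε => ?_
  have hz := (zeta_cont (N := N) ρ).tendsto x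
  have hev : ∀ᶠ y in nhds x, zeta ρ y < zeta ρ x + ε / 6 := hz.eventually (gt_mem_nhds (by linarith))
  refine hd.le_of_lip' (by have := zeta_nonneg ρ x; positivity) (hev.mono fun y hy => ?_)
  have a1 := eta_lip hk h0 h1 x y
  have a2 := eta_lip hk h0 h1 y x
  have b1 : min ‖x - y‖ 1 ≤ ‖y - x‖ := by rw [norm_sub_rev y x]; exact min_le_left _ _
  have b2 : min ‖y - x‖ 1 ≤ ‖y - x‖ := min_le_left _ _
  have c1 := (le_max_left _ _).trans a1
  have c2 := (le_max_left _ _).trans a2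
  have hx := zeta_nonneg ρ x
  have hy' := zeta_nonneg ρ y
  have hn := norm_nonneg (y - x)
  have d1 : 6 * zeta ρ x * min ‖x - y‖ 1 ≤ (6 * zeta ρ x + ε) * ‖y - x‖ :=
    mul_le_mul (by linarith) b1 (le_min (norm_nonneg _) zero_le_one) (by positivity)
  have d2 : 6 * zeta ρ y * min ‖y - x‖ 1 ≤ (6 * zeta ρ x + ε) * ‖y - x‖ :=
    mul_le_mul (by linarith) b2 (le_min (norm_nonneg _) zero_le_one) (by positivity)
  rw [Real.norm_eq_abs, abs_le]; constructor <;> linarith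

lemma eta_lim {N : ℕ} (ρ : ℝ) (x : E N) :
    Filter.Tendsto (fun n : ℕ => eta ((n:ℝ) + 1) ρ x) Filter.atTop (nhds (zeta ρ x ^ 2)) := by
  have hk : ∀ n : ℕ, (0:ℝ) < (n:ℝ) + 1 := fun n => by positivity
  simp_rw [fun n : ℕ => eta_eq (hk n) ρ x]
  rcases (zeta_nonneg ρ x).eq_or_lt with h | h
  · simp [← h]
  · have e : ∀ n : ℕ, expNegInvGlue (((n:ℝ) + 1) * zeta ρ x) = Real.exp (-(1 / ((n:ℝ) + 1)) * (zeta ρ x)⁻¹) := by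
      intro n; unfold expNegInvGlue; rw [if_neg (by push Not; positivity)]; congr 1
      rw [mul_inv]; ring
    simp_rw [e]
    have h1 : Filter.Tendsto (fun n : ℕ => -(1 / ((n:ℝ) + 1)) * (zeta ρ x)⁻¹) Filter.atTop (nhds (-0 * (zeta ρ x)⁻¹)) :=
      (tendsto_one_div_add_atTop_nhds_zero_nat.neg).mul_const _
    have h2 := (Real.continuous_exp.tendsto _).comp h1
    have h3 := h2.const_mul (zeta ρ x ^ 2)
    simpa using h3

lemma m1_int {N : ℕ} (hN : 2 ≤ N) {s : ℝ} (hs : s ∈ Ioo (0:ℝ) 1) :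
    Integrable fun z : E N => min (‖z‖ ^ 2) 1 * ‖z‖ ^ (-((N:ℝ) + 2 * s)) := by
  haveI : Nontrivial (E N) := by
    haveI : Nonempty (Fin N) := ⟨⟨0, by omega⟩⟩
    infer_instance
  rw [integrable_fun_norm_addHaar (volume : Measure (E N)) (f := fun y : ℝ => min (y ^ 2) 1 * y ^ (-((N:ℝ) + 2 * s)))]
  rw [finrank_euclideanSpace_fin, ← Ioc_union_Ioi_eq_Ioi (zero_le_one (α := ℝ))]
  have e : ∀ y : ℝ, 0 < y → y ^ (N - 1) * y ^ (-((N:ℝ) + 2 * s)) = y ^ (-1 - 2 * s) := by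
    intro y hy
    rw [← Real.rpow_natCast, ← Real.rpow_add hy]; congr 1
    rw [Nat.cast_sub (by omega)]; push_cast; ring
  apply IntegrableOn.union
  · have : IntegrableOn (fun y : ℝ => y ^ (1 - 2 * s)) (Ioc 0 1) := by
      rw [← intervalIntegrable_iff_integrableOn_Ioc_of_le zero_le_one]
      exact intervalIntegral.intervalIntegrable_rpow' (by linarith [hs.2])
    refine this.congr_fun (fun y hy => ?_) measurableSet_Ioc
    have hy0 := hy.1
    have : min (y ^ 2) 1 = y ^ 2 := min_eq_left (pow_le_one₀ hy.1.le hy.2)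
    simp only [smul_eq_mul]
    rw [this, mul_left_comm, e y hy.1, ← Real.rpow_natCast y 2, ← Real.rpow_add hy.1]; congr 1; push_cast; ring
  · have : IntegrableOn (fun y : ℝ => y ^ (-1 - 2 * s)) (Ioi 1) :=
      integrableOn_Ioi_rpow_of_lt (by linarith [hs.1]) one_pos
    refine this.congr_fun (fun y hy => ?_) measurableSet_Ioi
    have hy1 : (1:ℝ) < y := hy
    have : min (y ^ 2) 1 = 1 := min_eq_right (one_le_pow₀ hy1.le)
    simp only [smul_eq_mul]
    rw [this, one_mul, e y (by linarith)]

lemma double_dom {N : ℕ} {f : E N → E N → ℝ} {F1 F2 m1 m2 : E N → ℝ} (hF1 : Integrable F1) (hF2 : Integrable F2)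
    (hm1 : Integrable m1) (hm2 : Integrable m2) (p1 : ∀ x, 0 ≤ F1 x) (p2 : ∀ x, 0 ≤ F2 x) (p3 : ∀ x, 0 ≤ m1 x) (p4 : ∀ x, 0 ≤ m2 x)
    (hev : ∀ x, m1 (-x) = m1 x)
    (h : ∀ x y, f x y ≤ (F1 x * m1 (x - y) + F2 x * m2 y) + (F1 y * m1 (x - y) + F2 y * m2 x)) :
    ∫ x, ∫ y, f x y ≤ 2 * ((∫ x, F1 x) * (∫ x, m1 x) + (∫ x, F2 x) * (∫ x, m2 x)) := by
  have i1 : Integrable (fun z : E N × E N => F1 z.2 * m1 (z.1 - z.2)) (volume.prod volume) := by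
    have := Integrable.convolution_integrand (L := ContinuousLinearMap.mul ℝ ℝ) (μ := volume) (ν := volume) hF1 hm1
    simpa using this
  have i2 : Integrable (fun z : E N × E N => F1 z.1 * m1 (z.1 - z.2)) (volume.prod volume) := by
    have := i1.swap
    refine this.congr (Filter.Eventually.of_forall fun z => ?_)
    simp only [Function.comp, Prod.fst_swap, Prod.snd_swap]
    rw [← hev (z.1 - z.2), neg_sub]
  have i3 : Integrable (fun z : E N × E N => F2 z.1 * m2 z.2) (volume.prod volume) := hF2.mul_prod hm2
  have i4 : Integrable (fun z : E N × E N => F2 z.2 * m2 z.1) (volume.prod volume) := i3.swap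
  have i5 : Integrable (fun z : E N × E N => (F1 z.1 * m1 (z.1 - z.2) + F2 z.1 * m2 z.2) + (F1 z.2 * m1 (z.1 - z.2) + F2 z.2 * m2 z.1)) (volume.prod volume) :=
    (i2.add i3).add (i1.add i4)
  have nn : ∀ x y, 0 ≤ (F1 x * m1 (x - y) + F2 x * m2 y) + (F1 y * m1 (x - y) + F2 y * m2 x) := fun x y => by
    have := p1 x; have := p1 y; have := p2 x; have := p2 y; have := p3 (x - y); have := p4 x; have := p4 y
    positivity
  have s1 : ∫ x, ∫ y, f x y ≤ ∫ x, ∫ y, ((F1 x * m1 (x - y) + F2 x * m2 y) + (F1 y * m1 (x - y) + F2 y * m2 x)) := by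
    refine int_le_dom i5.integral_prod_left (Filter.Eventually.of_forall fun x => integral_nonneg (nn x)) ?_
    filter_upwards [i5.prod_right_ae] with x hx
    exact int_le_dom hx (Filter.Eventually.of_forall (nn x)) (Filter.Eventually.of_forall (h x))
  refine s1.trans (le_of_eq ?_)
  rw [← integral_prod (fun z : E N × E N => (F1 z.1 * m1 (z.1 - z.2) + F2 z.1 * m2 z.2) + (F1 z.2 * m1 (z.1 - z.2) + F2 z.2 * m2 z.1)) i5]
  rw [integral_add (f := fun z : E N × E N => F1 z.1 * m1 (z.1 - z.2) + F2 z.1 * m2 z.2) (g := fun z : E N × E N => F1 z.2 * m1 (z.1 - z.2) + F2 z.2 * m2 z.1) (i2.add i3) (i1.add i4)]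
  rw [integral_add i2 i3, integral_add i1 i4]
  have e3 : ∫ z : E N × E N, F2 z.1 * m2 z.2 ∂(volume.prod volume) = (∫ x, F2 x) * (∫ x, m2 x) := integral_prod_mul _ _
  have e4 : ∫ z : E N × E N, F2 z.2 * m2 z.1 ∂(volume.prod volume) = (∫ x, F2 x) * (∫ x, m2 x) := by
    rw [← e3, ← integral_prod_swap (fun z : E N × E N => F2 z.1 * m2 z.2)]; rfl
  have e2 : ∫ z : E N × E N, F1 z.1 * m1 (z.1 - z.2) ∂(volume.prod volume) = (∫ x, F1 x) * (∫ x, m1 x) := by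
    rw [integral_prod _ i2]
    simp_rw [integral_const_mul]
    rw [← integral_mul_const]
    congr 1; ext x; congr 1
    exact integral_sub_left_eq_self m1 volume x
  have e1 : ∫ z : E N × E N, F1 z.2 * m1 (z.1 - z.2) ∂(volume.prod volume) = (∫ x, F1 x) * (∫ x, m1 x) := by
    rw [← e2, ← integral_prod_swap (fun z : E N × E N => F1 z.1 * m1 (z.1 - z.2))]
    congr 1; ext z; simp only [Prod.fst_swap, Prod.snd_swap]
    rw [← hev (z.1 - z.2), neg_sub]
  rw [e1, e2, e3, e4]; ring

lemma nl_ptwise {N : ℕ} {s Λ : ℝ} (hs : s ∈ Ioo (0:ℝ) 1) (hΛ : 1 ≤ Λ) {κ : E N → E N → ℝ}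
    (hκ : ∀ x y : E N, x ≠ y → 0 ≤ κ x y ∧ κ x y ≤ Λ * ‖x - y‖ ^ (-((N : ℝ) + 2 * s)))
    {U V : E N → ℝ} {x0 : E N} {r R A p ρ k : ℝ} (hr : 0 < r) (hR : r < R / 2) (hp : 0 < p) (hρ0 : 0 < ρ)
    (hρ1 : ρ ≤ 1) (hk : 0 < k) (hA : 0 < A) (hVp : ∀ x, 0 < V x) (hU : ∀ x ∈ ball x0 R, 0 ≤ U x)
    (hUV : ∀ x ∈ closedBall x0 r, V x = U x + A) {ψ F m : E N → ℝ}
    (hψ : ∀ x, ψ x = V x ^ (-p) * eta k ρ (r⁻¹ • (x - x0)) ^ 2)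
    (hF : ∀ x, F x = 36 * (1 + 1 / p) * (V x ^ (1 - p) * zeta ρ (r⁻¹ • (x - x0)) ^ 2))
    (hm : ∀ z, m z = Λ * (min (‖r⁻¹ • z‖ ^ 2) 1 * ‖z‖ ^ (-((N : ℝ) + 2 * s)))) (x y : E N) :
    (U x - U y) * (ψ x - ψ y) * κ x y ≤
      (F x * m (x - y) + ψ x * (ball x0 R)ᶜ.indicator (fun y => Λ * 2 ^ ((N : ℝ) + 2 * s) * (max (-(U y)) 0 * ‖y - x0‖ ^ (-((N : ℝ) + 2 * s)))) y) +
      (F y * m (x - y) + ψ y * (ball x0 R)ᶜ.indicator (fun y => Λ * 2 ^ ((N : ℝ) + 2 * s) * (max (-(U y)) 0 * ‖y - x0‖ ^ (-((N : ℝ) + 2 * s)))) x) := by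
  set d := (N : ℝ) + 2 * s with hd
  have hd0 : 0 ≤ d := by have := hs.1; positivity
  have hΛ0 : 0 < Λ := by linarith
  set Tt : E N → ℝ := (ball x0 R)ᶜ.indicator (fun y => Λ * 2 ^ d * (max (-(U y)) 0 * ‖y - x0‖ ^ (-d))) with hTt
  have Tt0 : ∀ y, 0 ≤ Tt y := fun y => indicator_nonneg (fun y _ => by positivity) y
  have ψ0 : ∀ x, 0 ≤ ψ x := fun x => by rw [hψ]; have := hVp x; positivity
  have F0 : ∀ x, 0 ≤ F x := fun x => by rw [hF]; have := hVp x; positivity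
  have m0 : ∀ x, 0 ≤ m x := fun x => by rw [hm]; positivity
  have hz : ∀ x, x ∉ closedBall x0 r → zeta ρ (r⁻¹ • (x - x0)) = 0 := fun x hx => by
    apply zeta_zero hρ0
    rw [mem_closedBall, dist_eq_norm, not_le] at hx
    rw [norm_smul, norm_inv, Real.norm_of_nonneg hr.le]
    have : 1 ≤ r⁻¹ * ‖x - x0‖ := by rw [inv_mul_eq_div, one_le_div hr]; exact hx.le
    linarith
  have he : ∀ x, x ∉ closedBall x0 r → eta k ρ (r⁻¹ • (x - x0)) = 0 := fun x hx => by
    rw [eta_eq hk, hz x hx]; simp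
  have hψ1 : ∀ x, x ∉ closedBall x0 r → ψ x = 0 := fun x hx => by rw [hψ, he x hx]; simp
  have hsub : closedBall x0 r ⊆ ball x0 R := closedBall_subset_ball (by linarith)
  by_cases hxy : x = y
  · rw [hxy]
    have h1 := mul_nonneg (F0 y) (m0 (y - y))
    have h2 := mul_nonneg (ψ0 y) (Tt0 y)
    simp only [sub_self, zero_mul]
    rw [sub_self] at h1
    linarith
  obtain ⟨κ0, κ1⟩ := hκ x y hxy
  -- one-sided case
  have key : ∀ (x y : E N) (c : ℝ), 0 ≤ c → c ≤ Λ * ‖x - y‖ ^ (-d) → x ∈ ball x0 R → y ∉ ball x0 R → (U x - U y) * ψ x * c ≤ F x * m (x - y) + ψ x * Tt y := by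
    intro x y c κ0 κ1 hx hy
    by_cases hxr : x ∈ closedBall x0 r
    swap
    · rw [hψ1 x hxr]; have := mul_nonneg (F0 x) (m0 (x - y)); simpa using this
    rw [mem_closedBall, dist_eq_norm] at hxr
    rw [mem_ball, dist_eq_norm, not_lt] at hy
    have n1 : ‖y - x0‖ ≤ ‖x - y‖ + ‖x - x0‖ := by
      calc ‖y - x0‖ = ‖(x - x0) - (x - y)‖ := by congr 1; abel
        _ ≤ _ := by rw [add_comm]; exact norm_sub_le _ _
    have n2 : r ≤ ‖x - y‖ := by linarith
    have n3 : ‖y - x0‖ / 2 ≤ ‖x - y‖ := by linarith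
    have hmz : m (x - y) = Λ * ‖x - y‖ ^ (-d) := by
      rw [hm, min_eq_right, one_mul]
      rw [norm_smul, norm_inv, Real.norm_of_nonneg hr.le]
      exact one_le_pow₀ (by rw [inv_mul_eq_div, one_le_div hr]; exact n2)
    have hκ2 : c ≤ Λ * 2 ^ d * ‖y - x0‖ ^ (-d) := by
      refine κ1.trans ?_
      have hy0 : 0 < ‖y - x0‖ := by linarith
      have : ‖x - y‖ ^ (-d) ≤ (‖y - x0‖ / 2) ^ (-d) :=
        Real.rpow_le_rpow_of_nonpos (by positivity) n3 (by linarith)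
      rw [Real.div_rpow hy0.le zero_le_two, Real.rpow_neg zero_le_two, div_inv_eq_mul] at this
      calc _ ≤ Λ * (‖y - x0‖ ^ (-d) * 2 ^ d) := by gcongr
        _ = _ := by ring
    have hTy : Tt y = Λ * 2 ^ d * ‖y - x0‖ ^ (-d) * max (-(U y)) 0 := by
      rw [hTt, indicator_of_mem (by simpa [dist_eq_norm] using hy)]; ring
    have hVx : U x ≤ V x := by rw [hUV x (by simpa [dist_eq_norm] using hxr)]; linarith
    have hFx : V x * ψ x ≤ F x := by
      rw [hψ, hF, ← mul_assoc]
      have e1 : V x * V x ^ (-p) = V x ^ (1 - p) := by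
        rw [sub_eq_add_neg, Real.rpow_add (hVp x), Real.rpow_one]
      rw [e1]
      set e := eta k ρ (r⁻¹ • (x - x0))
      have e0 : 0 ≤ e := eta_nonneg _ _ _
      set z := zeta ρ (r⁻¹ • (x - x0))
      have z0 : 0 ≤ z := zeta_nonneg _ _
      have z1 : z ≤ 1 := zeta_le_one hρ0 hρ1 _
      have ez : e ≤ z := (eta_le hk ρ _).trans (by change z ^ 2 ≤ z; nlinarith)
      have : e ^ 2 ≤ z ^ 2 := pow_le_pow_left₀ e0 ez 2
      have hv := Real.rpow_pos_of_pos (hVp x) (1 - p)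
      have hp' : 0 < 1 / p := by positivity
      have h1 : V x ^ (1 - p) * e ^ 2 ≤ V x ^ (1 - p) * z ^ 2 := by gcongr
      have h2 : 0 ≤ V x ^ (1 - p) * z ^ 2 := by positivity
      have h3 : 1 ≤ 36 * (1 + 1 / p) := by linarith
      exact h1.trans (le_mul_of_one_le_left h2 h3)
    have hUy : -(U y) ≤ max (-(U y)) 0 := le_max_left _ _
    have hM0 : 0 ≤ max (-(U y)) 0 := le_max_right _ _
    calc (U x - U y) * ψ x * c ≤ (V x + max (-(U y)) 0) * ψ x * c := by
          have := ψ0 x; gcongr; linarith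
      _ = (V x * ψ x) * c + ψ x * (c * max (-(U y)) 0) := by ring
      _ ≤ F x * m (x - y) + ψ x * Tt y := by
          rw [hmz, hTy]; have := ψ0 x; have := F0 x; gcongr
  by_cases hx : x ∈ ball x0 R <;> by_cases hy : y ∈ ball x0 R
  · have hxx : ψ x = (U x + A) ^ (-p) * eta k ρ (r⁻¹ • (x - x0)) ^ 2 := by
      rw [hψ]; by_cases h : x ∈ closedBall x0 r
      · rw [hUV x h]
      · rw [he x h]; simp
    have hyy : ψ y = (U y + A) ^ (-p) * eta k ρ (r⁻¹ • (y - x0)) ^ 2 := by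
      rw [hψ]; by_cases h : y ∈ closedBall x0 r
      · rw [hUV y h]
      · rw [he y h]; simp
    have hFx : F x = 36 * (1 + 1 / p) * ((U x + A) ^ (1 - p) * zeta ρ (r⁻¹ • (x - x0)) ^ 2) := by
      rw [hF]; by_cases h : x ∈ closedBall x0 r
      · rw [hUV x h]
      · rw [hz x h]; simp
    have hFy : F y = 36 * (1 + 1 / p) * ((U y + A) ^ (1 - p) * zeta ρ (r⁻¹ • (y - x0)) ^ 2) := by
      rw [hF]; by_cases h : y ∈ closedBall x0 r
      · rw [hUV y h]
      · rw [hz y h]; simp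
    have ax : 0 < U x + A := by linarith [hU x hx]
    have ay : 0 < U y + A := by linarith [hU y hy]
    have h1 := alg_nl hp ax ay (eta_nonneg k ρ (r⁻¹ • (x - x0))) (eta_nonneg k ρ (r⁻¹ • (y - x0)))
    rw [← hxx, ← hyy] at h1
    have nxy : r⁻¹ • (x - x0) - r⁻¹ • (y - x0) = r⁻¹ • (x - y) := by rw [← smul_sub]; congr 1; abel
    have nyx : r⁻¹ • (y - x0) - r⁻¹ • (x - x0) = -(r⁻¹ • (x - y)) := by rw [← smul_sub, ← smul_neg]; congr 1; abel
    have l1 := eta_lip hk hρ0 hρ1 (r⁻¹ • (x - x0)) (r⁻¹ • (y - x0))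
    have l2 := eta_lip hk hρ0 hρ1 (r⁻¹ • (y - x0)) (r⁻¹ • (x - x0))
    rw [nxy] at l1
    rw [nyx, norm_neg] at l2
    have mm : ∀ n : ℝ, 0 ≤ n → (min n 1) ^ 2 = min (n ^ 2) 1 := fun n hn => by
      rcases le_total n 1 with h | h
      · rw [min_eq_left h, min_eq_left (pow_le_one₀ hn h)]
      · rw [min_eq_right h, min_eq_right (one_le_pow₀ h), one_pow]
    have l1' := pow_le_pow_left₀ (le_max_right _ _) l1 2
    have l2' := pow_le_pow_left₀ (le_max_right _ _) l2 2
    rw [mul_pow, mul_pow, mm _ (norm_nonneg _)] at l1' l2'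
    set q := min (‖r⁻¹ • (x - y)‖ ^ 2) 1 with hq
    have q0 : 0 ≤ q := by positivity
    have h2 : (U x - U y) * (ψ x - ψ y) ≤ (F x + F y) * q := by
      have c : 0 < 1 + 1 / p := by positivity
      have : (U x + A - (U y + A)) = U x - U y := by ring
      rw [this] at h1
      refine h1.trans ?_
      rw [hFx, hFy]
      have a1 : (1 + 1 / p) * ((U x + A) ^ (1 - p) * max (eta k ρ (r⁻¹ • (x - x0)) - eta k ρ (r⁻¹ • (y - x0))) 0 ^ 2)
          ≤ (1 + 1 / p) * ((U x + A) ^ (1 - p) * (6 ^ 2 * zeta ρ (r⁻¹ • (x - x0)) ^ 2 * q)) := by gcongr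
      have a2 : (1 + 1 / p) * ((U y + A) ^ (1 - p) * max (eta k ρ (r⁻¹ • (y - x0)) - eta k ρ (r⁻¹ • (x - x0))) 0 ^ 2)
          ≤ (1 + 1 / p) * ((U y + A) ^ (1 - p) * (6 ^ 2 * zeta ρ (r⁻¹ • (y - x0)) ^ 2 * q)) := by gcongr
      refine (add_le_add a1 a2).trans (le_of_eq ?_)
      ring
    have hmz : m (x - y) = q * (Λ * ‖x - y‖ ^ (-d)) := by rw [hm]; ring
    have := mul_nonneg (ψ0 x) (Tt0 y)
    have := mul_nonneg (ψ0 y) (Tt0 x)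
    have h3 : (U x - U y) * (ψ x - ψ y) * κ x y ≤ (F x + F y) * q * (Λ * ‖x - y‖ ^ (-d)) := by
      have := F0 x; have := F0 y
      calc _ ≤ (F x + F y) * q * κ x y := mul_le_mul_of_nonneg_right h2 κ0
        _ ≤ _ := by gcongr
    have h4 : (F x + F y) * q * (Λ * ‖x - y‖ ^ (-d)) = F x * m (x - y) + F y * m (x - y) := by rw [hmz]; ring
    linarith
  · have h1 := key x y _ κ0 κ1 hx hy
    rw [hψ1 y (fun h => hy (hsub h)), sub_zero]
    have := mul_nonneg (F0 y) (m0 (x - y))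
    linarith
  · have h1 := key y x _ κ0 (by rw [norm_sub_rev]; exact κ1) hy hx
    rw [hψ1 x (fun h => hx (hsub h)), zero_sub]
    have := mul_nonneg (F0 x) (m0 (x - y))
    have hmm : m (y - x) = m (x - y) := by
      rw [hm, hm, ← neg_sub, smul_neg, norm_neg, norm_neg]
    rw [hmm] at h1
    linarith
  · rw [hψ1 x (fun h => hx (hsub h)), hψ1 y (fun h => hy (hsub h))]
    have h1 := mul_nonneg (F0 y) (m0 (x - y))
    have h2 := mul_nonneg (F0 x) (m0 (x - y))
    simp only [sub_self, mul_zero, zero_mul, add_zero]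
    linarith

lemma m_scale {N : ℕ} {s r : ℝ} (hr : 0 < r) (z : E N) :
    min (‖r⁻¹ • z‖ ^ 2) 1 * ‖z‖ ^ (-((N : ℝ) + 2 * s)) =
      r ^ (-((N : ℝ) + 2 * s)) * (min (‖r⁻¹ • z‖ ^ 2) 1 * ‖r⁻¹ • z‖ ^ (-((N : ℝ) + 2 * s))) := by
  have : ‖z‖ = r * ‖r⁻¹ • z‖ := by
    rw [norm_smul, norm_inv, Real.norm_of_nonneg hr.le]; field_simp
  rw [show ‖z‖ ^ (-((N : ℝ) + 2 * s)) = (r * ‖r⁻¹ • z‖) ^ (-((N : ℝ) + 2 * s)) by rw [← this],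
    Real.mul_rpow hr.le (norm_nonneg _)]; ring

lemma nl_bound {N : ℕ} (hN : 2 ≤ N) {s Λ : ℝ} (hs : s ∈ Ioo (0:ℝ) 1) (hΛ : 1 ≤ Λ) : ∃ C : ℝ, 0 ≤ C ∧
    ∀ {κ : E N → E N → ℝ}
    (_ : ∀ x y : E N, x ≠ y → 0 ≤ κ x y ∧ κ x y ≤ Λ * ‖x - y‖ ^ (-((N : ℝ) + 2 * s)))
    {U V : E N → ℝ} {x0 : E N} {r R A p ρ k : ℝ} (_ : 0 < r) (_ : r ≤ 1) (_ : r < R / 2) (_ : 0 < p) (_ : 0 < ρ)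
    (_ : ρ ≤ 1) (_ : 0 < k) (_ : 0 < A) (_ : Measurable U) (M : ℝ) (_ : ∀ x, |U x| ≤ M) (_ : Continuous V) (_ : ∀ x, 0 < V x) (_ : ∀ x ∈ ball x0 R, 0 ≤ U x)
    (_ : ∀ x ∈ closedBall x0 r, V x = U x + A)
    (_ : ∫ y in (ball x0 R)ᶜ, max (-(U y)) 0 * ‖y - x0‖ ^ (-((N : ℝ) + 2 * s)) ≤ A * r⁻¹ ^ 2),
    ∫ x, ∫ y, (U x - U y) * (V x ^ (-p) * eta k ρ (r⁻¹ • (x - x0)) ^ 2 - V y ^ (-p) * eta k ρ (r⁻¹ • (y - x0)) ^ 2) * κ x y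
      ≤ C * (1 + 1 / p) * r⁻¹ ^ 2 * ∫ x, V x ^ (1 - p) * zeta ρ (r⁻¹ • (x - x0)) ^ 2 := by
  set d := (N : ℝ) + 2 * s with hd
  set m₁ : ℝ := ∫ z : E N, min (‖z‖ ^ 2) 1 * ‖z‖ ^ (-d) with hm₁
  have hm₁0 : 0 ≤ m₁ := integral_nonneg fun z => by positivity
  have hΛ0 : 0 < Λ := by linarith
  refine ⟨2 * (36 * (Λ * m₁) + Λ * 2 ^ d), by positivity, ?_⟩
  intro κ hκ U V x0 r R A p ρ k hr hr1 hR hp hρ0 hρ1 hk hA hUm M hM hV hVp hU hUV htail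
  have hR0 : 0 < R := by linarith
  have hd0 : 0 ≤ d := by have := hs.1; positivity
  set ψ : E N → ℝ := fun x => V x ^ (-p) * eta k ρ (r⁻¹ • (x - x0)) ^ 2 with hψ
  set F₁ : E N → ℝ := fun x => V x ^ (1 - p) * zeta ρ (r⁻¹ • (x - x0)) ^ 2 with hF₁
  set F : E N → ℝ := fun x => 36 * (1 + 1 / p) * F₁ x with hF
  set m : E N → ℝ := fun z => Λ * (min (‖r⁻¹ • z‖ ^ 2) 1 * ‖z‖ ^ (-d)) with hm
  set Tt : E N → ℝ := (ball x0 R)ᶜ.indicator (fun y => Λ * 2 ^ d * (max (-(U y)) 0 * ‖y - x0‖ ^ (-d))) with hTt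
  have cz : Continuous fun x : E N => r⁻¹ • (x - x0) := by fun_prop
  have hz : ∀ x, x ∉ closedBall x0 r → zeta ρ (r⁻¹ • (x - x0)) = 0 := fun x hx => by
    apply zeta_zero hρ0
    rw [mem_closedBall, dist_eq_norm, not_le] at hx
    rw [norm_smul, norm_inv, Real.norm_of_nonneg hr.le]
    have : 1 ≤ r⁻¹ * ‖x - x0‖ := by rw [inv_mul_eq_div, one_le_div hr]; exact hx.le
    linarith
  have iF₁ : Integrable F₁ := by
    apply cs_int
    · exact (hV.rpow_const fun x => Or.inl (hVp x).ne').mul (((zeta_cont ρ).comp cz).pow 2)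
    · refine HasCompactSupport.intro (isCompact_closedBall x0 r) fun x hx => ?_
      simp [hF₁, hz x hx]
  have iψ : Integrable ψ := by
    apply cs_int
    · exact (hV.rpow_const fun x => Or.inl (hVp x).ne').mul (((eta_smooth k ρ).continuous.comp cz).pow 2)
    · refine HasCompactSupport.intro (isCompact_closedBall x0 r) fun x hx => ?_
      simp [hψ, eta_eq hk, hz x hx]
  have im1 : Integrable fun z : E N => min (‖z‖ ^ 2) 1 * ‖z‖ ^ (-d) := m1_int hN hs
  have em : m = fun z => Λ * r ^ (-d) * (min (‖r⁻¹ • z‖ ^ 2) 1 * ‖r⁻¹ • z‖ ^ (-d)) := by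
    ext z; simp only [hm]; rw [m_scale hr]; ring
  have im : Integrable m := by
    rw [em]
    exact (im1.comp_smul (inv_ne_zero hr.ne')).const_mul _
  have vm : ∫ z, m z ≤ Λ * m₁ * r⁻¹ ^ 2 := by
    rw [em, integral_const_mul, Measure.integral_comp_smul volume (fun z : E N => min (‖z‖ ^ 2) 1 * ‖z‖ ^ (-d)) r⁻¹]
    rw [finrank_euclideanSpace_fin, ← hm₁, smul_eq_mul]
    have e1 : |((r⁻¹) ^ N)⁻¹| = r ^ (N:ℝ) := by
      rw [inv_pow, inv_inv, abs_of_pos (by positivity), Real.rpow_natCast]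
    have e2 : r ^ (-d) * r ^ (N:ℝ) = r ^ (-(2 * s)) := by
      rw [← Real.rpow_add hr]; congr 1; rw [hd]; ring
    have e3 : r ^ (-(2 * s)) ≤ r⁻¹ ^ 2 := by
      have : r⁻¹ ^ 2 = r ^ (-2 : ℝ) := by rw [Real.rpow_neg hr.le, inv_pow]; norm_cast
      rw [this]
      exact Real.rpow_le_rpow_of_exponent_ge hr hr1 (by linarith [hs.2])
    rw [e1]
    calc Λ * r ^ (-d) * (r ^ (N:ℝ) * m₁) = Λ * m₁ * (r ^ (-d) * r ^ (N:ℝ)) := by ring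
      _ ≤ _ := by rw [e2]; gcongr
  have iT0 : IntegrableOn (fun y => max (-(U y)) 0 * ‖y - x0‖ ^ (-d)) (ball x0 R)ᶜ := by
    have i1 : Integrable fun y : E N => M * max 1 (R⁻¹ ^ 2) * (min (‖y - x0‖ ^ 2) 1 * ‖y - x0‖ ^ (-d)) :=
      (im1.comp_sub_right x0).const_mul _
    refine i1.integrableOn.mono' ?_ ?_
    · exact Measurable.aestronglyMeasurable (by fun_prop)
    · rw [ae_restrict_iff' measurableSet_ball.compl]
      refine Filter.Eventually.of_forall fun y hy => ?_
      have hy' : R ≤ ‖y - x0‖ := by simpa [dist_eq_norm] using hy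
      have hM0 : 0 ≤ M := (abs_nonneg _).trans (hM y)
      have h1 : max (-(U y)) 0 ≤ M := max_le ((neg_le_abs _).trans (hM y)) hM0
      rw [Real.norm_of_nonneg (by positivity)]
      have h2 : 1 ≤ max 1 (R⁻¹ ^ 2) * min (‖y - x0‖ ^ 2) 1 := by
        rcases le_total (‖y - x0‖ ^ 2) 1 with h | h
        · rw [min_eq_left h]
          calc (1:ℝ) = R⁻¹ ^ 2 * R ^ 2 := by field_simp
            _ ≤ _ := by gcongr; exact le_max_right _ _
        · rw [min_eq_right h, mul_one]; exact le_max_left _ _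
      calc max (-(U y)) 0 * ‖y - x0‖ ^ (-d) ≤ M * ‖y - x0‖ ^ (-d) := by gcongr
        _ = M * 1 * ‖y - x0‖ ^ (-d) := by ring
        _ ≤ M * (max 1 (R⁻¹ ^ 2) * min (‖y - x0‖ ^ 2) 1) * ‖y - x0‖ ^ (-d) := by gcongr
        _ = _ := by ring
  have iT : Integrable Tt := by
    rw [hTt, integrable_indicator_iff measurableSet_ball.compl]
    exact iT0.const_mul _
  have vT : ∫ y, Tt y ≤ Λ * 2 ^ d * (A * r⁻¹ ^ 2) := by
    rw [hTt, integral_indicator measurableSet_ball.compl, integral_const_mul]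
    gcongr
  have Tt0 : ∀ y, 0 ≤ Tt y := fun y => indicator_nonneg (fun y _ => by positivity) y
  have ψ0 : ∀ x, 0 ≤ ψ x := fun x => by have := hVp x; positivity
  have F₁0 : ∀ x, 0 ≤ F₁ x := fun x => by have := hVp x; positivity
  have F0 : ∀ x, 0 ≤ F x := fun x => by have := F₁0 x; simp only [hF]; positivity
  have m0 : ∀ x, 0 ≤ m x := fun x => by simp only [hm]; positivity
  have hAψ : A * ∫ x, ψ x ≤ ∫ x, F₁ x := by
    rw [← integral_const_mul]
    refine integral_mono (iψ.const_mul A) iF₁ fun x => ?_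
    by_cases h : x ∈ closedBall x0 r
    · have hAV : A ≤ V x := by rw [hUV x h]; linarith [hU x (closedBall_subset_ball (by linarith) h)]
      have e1 : V x * V x ^ (-p) = V x ^ (1 - p) := by
        rw [sub_eq_add_neg, Real.rpow_add (hVp x), Real.rpow_one]
      simp only [hψ, hF₁]
      have hv := Real.rpow_pos_of_pos (hVp x) (-p)
      have z0 : 0 ≤ zeta ρ (r⁻¹ • (x - x0)) := zeta_nonneg _ _
      have z1 : zeta ρ (r⁻¹ • (x - x0)) ≤ 1 := zeta_le_one hρ0 hρ1 _
      have ez : eta k ρ (r⁻¹ • (x - x0)) ≤ zeta ρ (r⁻¹ • (x - x0)) := (eta_le hk ρ _).trans (by nlinarith)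
      have e0 : 0 ≤ eta k ρ (r⁻¹ • (x - x0)) := eta_nonneg _ _ _
      rw [← e1, ← mul_assoc]
      have := hVp x
      gcongr
    · simp [hψ, hF₁, eta_eq hk, hz x h]
  have main := double_dom (f := fun x y => (U x - U y) * (ψ x - ψ y) * κ x y) (F1 := F) (F2 := ψ) (m1 := m) (m2 := Tt)
    (iF₁.const_mul _) iψ im iT F0 ψ0 m0 Tt0 (fun z => by simp only [hm, smul_neg, norm_neg])
    (nl_ptwise hs hΛ hκ hr hR hp hρ0 hρ1 hk hA hVp hU hUV (fun x => rfl) (fun x => rfl) (fun x => rfl))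
  refine main.trans ?_
  have eF : ∫ x, F x = 36 * (1 + 1 / p) * ∫ x, F₁ x := integral_const_mul _ _
  rw [eF]
  have I0 : 0 ≤ ∫ x, F₁ x := integral_nonneg F₁0
  have J0 : 0 ≤ ∫ x, ψ x := integral_nonneg ψ0
  have hp' : 0 < 1 / p := by positivity
  have a1 : 36 * (1 + 1 / p) * (∫ x, F₁ x) * ∫ x, m x ≤ 36 * (1 + 1 / p) * (∫ x, F₁ x) * (Λ * m₁ * r⁻¹ ^ 2) := by gcongr
  have a2 : (∫ x, ψ x) * ∫ x, Tt x ≤ (1 + 1 / p) * (Λ * 2 ^ d * r⁻¹ ^ 2 * ∫ x, F₁ x) := by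
    calc (∫ x, ψ x) * ∫ x, Tt x ≤ (∫ x, ψ x) * (Λ * 2 ^ d * (A * r⁻¹ ^ 2)) := by gcongr
      _ = Λ * 2 ^ d * r⁻¹ ^ 2 * (A * ∫ x, ψ x) := by ring
      _ ≤ Λ * 2 ^ d * r⁻¹ ^ 2 * ∫ x, F₁ x := by gcongr
      _ ≤ _ := le_mul_of_one_le_left (by positivity) (by linarith)
  refine (mul_le_mul_of_nonneg_left (add_le_add a1 a2) zero_le_two).trans (le_of_eq ?_)
  ring

lemma cov_x {N : ℕ} {r : ℝ} (hr : 0 < r) (x0 : E N) (f : E N → ℝ) :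
    ∫ X, f (r⁻¹ • (X - x0)) = r ^ N * ∫ x, f x := by
  rw [integral_sub_right_eq_self (fun X => f (r⁻¹ • X)) x0, Measure.integral_comp_smul, finrank_euclideanSpace_fin,
    smul_eq_mul, inv_pow, inv_inv, abs_of_pos (by positivity)]

lemma cov_t {r : ℝ} (hr : 0 < r) (t0 : ℝ) (f : ℝ → ℝ) :
    ∫ t, f ((t - t0) / r ^ 2) = r ^ 2 * ∫ t, f t := by
  rw [integral_sub_right_eq_self (fun t => f (t / r ^ 2)) t0, Measure.integral_comp_div, smul_eq_mul, abs_of_pos (by positivity)]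

lemma grad_scale {N : ℕ} {r : ℝ} (x0 : E N) {f : E N → ℝ} (hf : Differentiable ℝ f) (X : E N) :
    gradient (fun Y => f (r⁻¹ • (Y - x0))) X = r⁻¹ • gradient f (r⁻¹ • (X - x0)) := by
  have h1 : HasFDerivAt (fun Y : E N => r⁻¹ • (Y - x0)) (r⁻¹ • ContinuousLinearMap.id ℝ (E N)) X :=
    ((hasFDerivAt_id X).sub_const x0).const_smul r⁻¹
  have h2 : HasFDerivAt (fun Y => f (r⁻¹ • (Y - x0))) ((fderiv ℝ f (r⁻¹ • (X - x0))).comp (r⁻¹ • ContinuousLinearMap.id ℝ (E N))) X :=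
    (hf (r⁻¹ • (X - x0))).hasFDerivAt.comp X h1
  unfold gradient
  rw [h2.fderiv, ContinuousLinearMap.comp_smul, ContinuousLinearMap.comp_id, map_smulₛₗ]
  simp

lemma norm_gradient {N : ℕ} (f : E N → ℝ) (x : E N) : ‖gradient f x‖ = ‖fderiv ℝ f x‖ := by
  unfold gradient; exact LinearIsometryEquiv.norm_map _ _

lemma inner_gradient {N : ℕ} (f g : E N → ℝ) (x : E N) : ⟪gradient f x, gradient g x⟫ = fderiv ℝ g x (gradient f x) := by
  rw [real_inner_comm]; unfold gradient
  exact InnerProductSpace.toDual_symm_apply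

lemma grad_ptwise {N : ℕ} {k ρ p : ℝ} (hk : 0 < k) (h0 : 0 < ρ) (h1 : ρ ≤ 1) (hp : 0 < p) {v : E N → ℝ} (hv : Differentiable ℝ v)
    (hvp : ∀ x, 0 < v x) (x : E N) :
    ⟪gradient v x, gradient (fun y => v y ^ (-p) * eta k ρ y ^ 2) x⟫ ≤
      -(p / 2) * (‖fderiv ℝ v x‖ ^ 2 * v x ^ (-p - 1) * eta k ρ x ^ 2) + 72 * (1 + 1 / p) * (v x ^ (1 - p) * zeta ρ x ^ 2) := by
  have hd1 : HasFDerivAt (fun y => v y ^ (-p)) ((-p * v x ^ (-p - 1)) • fderiv ℝ v x) x :=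
    (hv x).hasFDerivAt.rpow_const (Or.inl (hvp x).ne')
  have hd2 : HasFDerivAt (fun y => eta k ρ y ^ 2) ((2 * eta k ρ x) • fderiv ℝ (eta k ρ) x) x := by
    have := (((eta_smooth (N := N) k ρ).differentiable (by simp)) x).hasFDerivAt.pow 2
    simpa using this
  have hd : HasFDerivAt (fun y => v y ^ (-p) * eta k ρ y ^ 2) _ x := hd1.mul hd2
  rw [inner_gradient, hd.fderiv]
  simp only [add_apply, smul_apply, smul_eq_mul]
  have e1 : fderiv ℝ v x (gradient v x) = ‖fderiv ℝ v x‖ ^ 2 := by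
    rw [← inner_gradient, real_inner_self_eq_norm_sq, norm_gradient]
  rw [e1]
  set g := ‖fderiv ℝ v x‖ with hg
  have b1 : fderiv ℝ (eta k ρ) x (gradient v x) ≤ 6 * zeta ρ x * g := by
    refine (le_abs_self _).trans ?_
    rw [← Real.norm_eq_abs]
    refine (ContinuousLinearMap.le_opNorm _ _).trans ?_
    rw [norm_gradient]
    exact mul_le_mul_of_nonneg_right (eta_grad hk h0 h1 x) (norm_nonneg _)
  have hvx := hvp x
  set e := eta k ρ x
  set z := zeta ρ x
  have he : 0 ≤ e := eta_nonneg _ _ _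
  have hz : 0 ≤ z := zeta_nonneg _ _
  have hq : 0 < v x ^ (-p - 1) := by positivity
  have e2 : v x ^ (-p) = v x ^ (-p - 1) * v x := by rw [← Real.rpow_add_one hvx.ne']; congr 1; ring
  have e3 : v x ^ (1 - p) = v x ^ (-p - 1) * v x ^ 2 := by
    rw [← Real.rpow_natCast (v x) 2, ← Real.rpow_add hvx]; congr 1; push_cast; ring
  rw [e2, e3]
  set Q := v x ^ (-p - 1)
  have b2 : Q * v x * (2 * e * (fderiv ℝ (eta k ρ) x) (gradient v x)) ≤ Q * (2 * (e * g) * (6 * z * v x)) := by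
    have : 0 ≤ Q * v x * (2 * e) := by positivity
    have := mul_le_mul_of_nonneg_left b1 this
    linarith
  have b3 : 2 * (e * g) * (6 * z * v x) ≤ p / 2 * (e * g) ^ 2 + 72 * (1 / p) * (z * v x) ^ 2 := by
    have : 0 ≤ (p / 2 * (e * g) - (6 * z * v x)) ^ 2 / (p / 2) := by positivity
    have e4 : (p / 2 * (e * g) - (6 * z * v x)) ^ 2 / (p / 2) = p / 2 * (e * g) ^ 2 + 72 * (1 / p) * (z * v x) ^ 2 - 2 * (e * g) * (6 * z * v x) := by
      field_simp; ring
    linarith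
  have b4 := mul_le_mul_of_nonneg_left b3 hq.le
  have b5 : 0 ≤ Q * (72 * (z * v x) ^ 2) := by positivity
  linarith

/-- glue factor -/
lemma eta_sq {N : ℕ} {k : ℝ} (hk : 0 < k) (ρ : ℝ) (x : E N) :
    eta k ρ x ^ 2 = expNegInvGlue (k * zeta ρ x) ^ 2 * zeta ρ x ^ 4 := by rw [eta_eq hk]; ring

lemma glue_cont {N : ℕ} (k ρ : ℝ) : Continuous fun x : E N => expNegInvGlue (k * zeta ρ x) ^ 2 := by
  have := zeta_cont (N := N) ρ
  exact ((expNegInvGlue.contDiff (n := 0)).continuous.comp (continuous_const.mul this)).pow 2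

lemma epar_cont {N : ℕ} {F : E N → ℝ → ℝ} (hF : Continuous fun p : E N × ℝ => F p.1 p.2) {k ρ : ℝ} (hk : 0 < k) (h0 : 0 < ρ) :
    Continuous fun t => ∫ x, F x t * eta k ρ x ^ 2 := by
  have h := par_cont (F := fun x t => F x t * expNegInvGlue (k * zeta ρ x) ^ 2) (hF.mul ((glue_cont k ρ).comp continuous_fst)) h0 (k := 4) (by norm_num)
  refine h.congr fun t => ?_
  congr 1; ext x; rw [eta_sq hk]; ring

lemma epar_deriv {N : ℕ} {F F' : E N → ℝ → ℝ} (hF : Continuous fun p : E N × ℝ => F p.1 p.2)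
    (hF' : Continuous fun p : E N × ℝ => F' p.1 p.2) (hd : ∀ x t, HasDerivAt (F x) (F' x t) t)
    {k ρ : ℝ} (hk : 0 < k) (h0 : 0 < ρ) (t : ℝ) :
    HasDerivAt (fun t => ∫ x, F x t * eta k ρ x ^ 2) (∫ x, F' x t * eta k ρ x ^ 2) t := by
  have h := par_deriv (F := fun x t => F x t * expNegInvGlue (k * zeta ρ x) ^ 2) (F' := fun x t => F' x t * expNegInvGlue (k * zeta ρ x) ^ 2)
    (hF.mul ((glue_cont k ρ).comp continuous_fst)) (hF'.mul ((glue_cont k ρ).comp continuous_fst)) (fun x t => (hd x t).mul_const _) h0 (k := 4) (by norm_num) t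
  simp_rw [eta_sq hk]
  convert h using 1 <;> simp only [mul_assoc]

lemma eint {N : ℕ} {k ρ : ℝ} (hk : 0 < k) (h0 : 0 < ρ) {f : E N → ℝ} (hf : Continuous f) : Integrable fun x => f x * eta k ρ x ^ 2 := by
  have := zetapow_int h0 (k := 4) (by norm_num) (f := fun x => f x * expNegInvGlue (k * zeta ρ x) ^ 2) (hf.mul (glue_cont k ρ))
  refine this.congr (Filter.Eventually.of_forall fun x => ?_)
  simp only [eta_sq hk]; ring

lemma deriv_t_cont {N : ℕ} {G : E N → ℝ → ℝ} (hG : ContDiff ℝ 1 fun p : E N × ℝ => G p.1 p.2) :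
    (∀ x t, HasDerivAt (G x) (deriv (G x) t) t) ∧ Continuous fun p : E N × ℝ => deriv (G p.1) p.2 := by
  have hd : ∀ x t, HasDerivAt (G x) (fderiv ℝ (fun p : E N × ℝ => G p.1 p.2) (x, t) (0, 1)) t := fun x t => by
    have h1 := (hG.differentiable (by norm_num) (x, t)).hasFDerivAt
    have h2 : HasDerivAt (fun t : ℝ => (x, t)) ((0 : E N), (1:ℝ)) t := (hasDerivAt_const t x).prodMk (hasDerivAt_id t)
    exact h1.comp_hasDerivAt t h2
  refine ⟨fun x t => (hd x t).differentiableAt.hasDerivAt, ?_⟩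
  have : (fun p : E N × ℝ => deriv (G p.1) p.2) = fun p => fderiv ℝ (fun p : E N × ℝ => G p.1 p.2) p (0, 1) := by
    ext p; exact (hd p.1 p.2).deriv
  rw [this]
  exact (hG.continuous_fderiv (by norm_num)).clm_apply continuous_const

lemma c_time {N : ℕ} {k ρ p A : ℝ} (hk : 0 < k) (h0 : 0 < ρ) {w : E N → ℝ → ℝ} (hw : ContDiff ℝ 1 fun p : E N × ℝ => w p.1 p.2)
    (hwp : ∀ x t, 0 < w x t) {l : ℝ → ℝ} (hl : ContDiff ℝ 1 l) (hlc : HasCompactSupport l) :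
    ∫ t, ∫ x, (w x t - A) * deriv (fun t => l t * (w x t ^ (-p) * eta k ρ x ^ 2)) t =
      - ∫ t, l t * ∫ x, deriv (w x) t * w x t ^ (-p) * eta k ρ x ^ 2 := by
  have hwr : ContDiff ℝ 1 fun z : E N × ℝ => w z.1 z.2 ^ (-p) := hw.rpow_const_of_ne fun z => (hwp _ _).ne'
  have hls : ContDiff ℝ 1 fun z : E N × ℝ => l z.2 := hl.comp contDiff_snd
  have hG : ContDiff ℝ 1 fun z : E N × ℝ => l z.2 * w z.1 z.2 ^ (-p) := hls.mul hwr
  obtain ⟨d1, c1⟩ := deriv_t_cont hw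
  obtain ⟨d2, c2⟩ := deriv_t_cont (G := fun x t => l t * w x t ^ (-p)) hG
  have dF : ∀ x t, HasDerivAt (fun t => (w x t - A) * (l t * w x t ^ (-p)))
      (deriv (w x) t * (l t * w x t ^ (-p)) + (w x t - A) * deriv (fun t => l t * w x t ^ (-p)) t) t :=
    fun x t => ((d1 x t).sub_const A).mul (d2 x t)
  have cw := hw.continuous
  have cG := hG.continuous
  have cF : Continuous fun z : E N × ℝ => (w z.1 z.2 - A) * (l z.2 * w z.1 z.2 ^ (-p)) := (cw.sub continuous_const).mul cG
  have ca : Continuous fun z : E N × ℝ => deriv (w z.1) z.2 * (l z.2 * w z.1 z.2 ^ (-p)) := c1.mul cG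
  have cb : Continuous fun z : E N × ℝ => (w z.1 z.2 - A) * deriv (fun t => l t * w z.1 t ^ (-p)) z.2 := (cw.sub continuous_const).mul c2
  have hD := fun t => epar_deriv (F := fun x t => (w x t - A) * (l t * w x t ^ (-p)))
    (F' := fun x t => deriv (w x) t * (l t * w x t ^ (-p)) + (w x t - A) * deriv (fun t => l t * w x t ^ (-p)) t) cF (ca.add cb) dF hk h0 t
  have cA := epar_cont (F := fun x t => deriv (w x) t * (l t * w x t ^ (-p))) ca hk h0
  have cB := epar_cont (F := fun x t => (w x t - A) * deriv (fun t => l t * w x t ^ (-p)) t) cb hk h0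
  have l0 : ∀ t, t ∉ tsupport l → l t = 0 := fun t ht => image_eq_zero_of_notMem_tsupport ht
  have l0' : ∀ t, t ∉ tsupport l → ∀ x, deriv (fun t => l t * w x t ^ (-p)) t = 0 := fun t ht x => by
    have : (fun t => l t * w x t ^ (-p)) =ᶠ[nhds t] fun _ => 0 := by
      filter_upwards [(isClosed_tsupport l).isOpen_compl.mem_nhds ht] with s hs
      rw [l0 s hs, zero_mul]
    rw [this.deriv_eq]; simp
  have sA : HasCompactSupport fun t => ∫ x, deriv (w x) t * (l t * w x t ^ (-p)) * eta k ρ x ^ 2 :=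
    HasCompactSupport.intro hlc.isCompact fun t ht => by simp [l0 t ht]
  have sB : HasCompactSupport fun t => ∫ x, (w x t - A) * deriv (fun t => l t * w x t ^ (-p)) t * eta k ρ x ^ 2 :=
    HasCompactSupport.intro hlc.isCompact fun t ht => by simp [l0' t ht]
  have sF : HasCompactSupport fun t => ∫ x, (w x t - A) * (l t * w x t ^ (-p)) * eta k ρ x ^ 2 :=
    HasCompactSupport.intro hlc.isCompact fun t ht => by simp [l0 t ht]
  have iA := cA.integrable_of_hasCompactSupport sA (μ := volume)
  have iB := cB.integrable_of_hasCompactSupport sB (μ := volume)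
  have iF := (epar_cont cF hk h0).integrable_of_hasCompactSupport sF (μ := volume)
  have split : ∀ t, ∫ x, (deriv (w x) t * (l t * w x t ^ (-p)) + (w x t - A) * deriv (fun t => l t * w x t ^ (-p)) t) * eta k ρ x ^ 2
      = (∫ x, deriv (w x) t * (l t * w x t ^ (-p)) * eta k ρ x ^ 2) + ∫ x, (w x t - A) * deriv (fun t => l t * w x t ^ (-p)) t * eta k ρ x ^ 2 := by
    intro t
    have sl : Continuous fun x : E N => (x, t) := by fun_prop
    rw [← integral_add (eint hk h0 (f := fun x => deriv (w x) t * (l t * w x t ^ (-p))) (ca.comp sl)) (eint hk h0 (f := fun x => (w x t - A) * deriv (fun t => l t * w x t ^ (-p)) t) (cb.comp sl))]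
    congr 1; ext x; ring
  simp_rw [split] at hD
  have h := integral_eq_zero_of_hasDerivAt_of_integrable hD (iA.add iB) iF
  rw [integral_add iA iB] at h
  have e1 : ∫ t, ∫ x, (w x t - A) * deriv (fun t => l t * (w x t ^ (-p) * eta k ρ x ^ 2)) t =
      ∫ t, ∫ x, (w x t - A) * deriv (fun t => l t * w x t ^ (-p)) t * eta k ρ x ^ 2 := by
    congr 1; ext t; congr 1; ext x
    have : (fun t => l t * (w x t ^ (-p) * eta k ρ x ^ 2)) = fun t => l t * w x t ^ (-p) * eta k ρ x ^ 2 := by ext t; ring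
    rw [this, ((d2 x t).mul_const (eta k ρ x ^ 2)).deriv]; ring
  have e2 : ∫ t, ∫ x, deriv (w x) t * (l t * w x t ^ (-p)) * eta k ρ x ^ 2 = ∫ t, l t * ∫ x, deriv (w x) t * w x t ^ (-p) * eta k ρ x ^ 2 := by
    congr 1; ext t; rw [← integral_const_mul]; congr 1; ext x; ring
  rw [e1, ← e2]; linarith

lemma slice_diff {N : ℕ} {G : E N → ℝ → ℝ} (hG : ContDiff ℝ 1 fun p : E N × ℝ => G p.1 p.2) (t : ℝ) : ContDiff ℝ 1 fun x => G x t :=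
  hG.comp (by fun_prop : ContDiff ℝ 1 fun x : E N => (x, t))

lemma slice_grad_cont {N : ℕ} {G : E N → ℝ → ℝ} (hG : ContDiff ℝ 1 fun p : E N × ℝ => G p.1 p.2) :
    Continuous fun p : E N × ℝ => gradient (fun y => G y p.2) p.1 := by
  have hd : ∀ p : E N × ℝ, fderiv ℝ (fun y => G y p.2) p.1 =
      (fderiv ℝ (fun p : E N × ℝ => G p.1 p.2) p).comp (ContinuousLinearMap.inl ℝ (E N) ℝ) := fun p => by
    have h1 := (hG.differentiable (by norm_num) p).hasFDerivAt
    have h2 : HasFDerivAt (fun y : E N => (y, p.2)) (ContinuousLinearMap.inl ℝ (E N) ℝ) p.1 := hasFDerivAt_prodMk_left p.1 p.2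
    have h3 : HasFDerivAt (fun y => G y p.2) _ p.1 := HasFDerivAt.comp (g := fun p : E N × ℝ => G p.1 p.2) p.1 h1 h2
    exact h3.fderiv
  unfold gradient
  simp_rw [hd]
  exact (LinearIsometryEquiv.continuous _).comp ((hG.continuous_fderiv (by norm_num)).clm_comp continuous_const)

/-- the right-hand side quantity at time `t` -/
def Gt {N : ℕ} (C k p ρ : ℝ) (w : E N → ℝ → ℝ) (t : ℝ) : ℝ :=
  (∫ x, deriv (w x) t * w x t ^ (-p) * eta k ρ x ^ 2) +
  (-(p / 2) * (∫ x, ‖fderiv ℝ (fun y => w y t) x‖ ^ 2 * w x t ^ (-p - 1) * eta k ρ x ^ 2) +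
    72 * (1 + 1 / p) * ∫ x, w x t ^ (1 - p) * zeta ρ x ^ 2) +
  C * (1 + 1 / p) * ∫ x, w x t ^ (1 - p) * zeta ρ x ^ 2

lemma rpw {N : ℕ} {w : E N → ℝ → ℝ} (hw : ContDiff ℝ 1 fun p : E N × ℝ => w p.1 p.2)
    (hwp : ∀ x t, 0 < w x t) (m : ℝ) : ContDiff ℝ 1 fun z : E N × ℝ => w z.1 z.2 ^ m := hw.rpow_const_of_ne fun _ => (hwp _ _).ne'

lemma Gt_parts {N : ℕ} {k p ρ : ℝ} (hk : 0 < k) (h0 : 0 < ρ) {w : E N → ℝ → ℝ} (hw : ContDiff ℝ 1 fun p : E N × ℝ => w p.1 p.2)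
    (hwp : ∀ x t, 0 < w x t) : (Continuous fun t => ∫ x, deriv (w x) t * w x t ^ (-p) * eta k ρ x ^ 2) ∧
    (Continuous fun t => ∫ x, ‖fderiv ℝ (fun y => w y t) x‖ ^ 2 * w x t ^ (-p - 1) * eta k ρ x ^ 2) ∧
    (Continuous fun t => ∫ x, w x t ^ (1 - p) * zeta ρ x ^ 2) := by
  refine ⟨epar_cont (F := fun x t => deriv (w x) t * w x t ^ (-p)) ((deriv_t_cont hw).2.mul (rpw hw hwp _).continuous) hk h0,
    epar_cont (F := fun x t => ‖fderiv ℝ (fun y => w y t) x‖ ^ 2 * w x t ^ (-p - 1)) ?_ hk h0,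
    par_cont (F := fun x t => w x t ^ (1 - p)) (rpw hw hwp _).continuous h0 (by norm_num)⟩
  have := (slice_grad_cont hw).norm
  simp_rw [norm_gradient] at this
  exact (this.pow 2).mul (rpw hw hwp _).continuous

lemma Gt_cont {N : ℕ} {C k p ρ : ℝ} (hk : 0 < k) (h0 : 0 < ρ) {w : E N → ℝ → ℝ} (hw : ContDiff ℝ 1 fun p : E N × ℝ => w p.1 p.2)
    (hwp : ∀ x t, 0 < w x t) : Continuous (Gt C k p ρ w) := by
  obtain ⟨h1, h2, h3⟩ := Gt_parts (p := p) hk h0 hw hwp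
  unfold Gt
  exact (h1.add ((h2.const_mul _).add (h3.const_mul _))).add (h3.const_mul _)

lemma cpar {N : ℕ} {F : E N → ℝ → ℝ} (hF : Continuous fun z : E N × ℝ => F z.1 z.2) {ρ : ℝ}
    (hz : ∀ t (x : E N), x ∉ closedBall (0 : E N) ρ → F x t = 0) :
    (Continuous fun t => ∫ x, F x t) ∧ ∀ t, Integrable fun x => F x t := by
  constructor
  · have h := continuous_parametric_integral_of_continuous (μ := (volume : Measure (E N)))
      (f := fun t x => F x t) (s := closedBall (0 : E N) ρ)
      (hF.comp (by fun_prop : Continuous fun p : ℝ × E N => (p.2, p.1))) (isCompact_closedBall _ _)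
    refine h.congr fun t => ?_
    exact setIntegral_eq_integral_of_forall_compl_eq_zero fun x hx => hz t x hx
  · exact fun t => cs_int (hF.comp (by fun_prop : Continuous fun x : E N => (x, t)))
      (HasCompactSupport.intro (isCompact_closedBall (0 : E N) ρ) fun x hx => hz t x hx)

lemma inner_c {N : ℕ} {f g : E N × ℝ → E N} (hf : Continuous f) (hg : Continuous g) : Continuous fun z => ⟪f z, g z⟫ :=
  hf.inner hg

lemma cpar2 {N : ℕ} {f g : E N → ℝ → E N} (hF : Continuous fun z : E N × ℝ => ⟪f z.1 z.2, g z.1 z.2⟫) {ρ : ℝ}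
    (hz : ∀ t (x : E N), x ∉ closedBall (0 : E N) ρ → g x t = 0) :
    (Continuous fun t => ∫ x, ⟪f x t, g x t⟫) ∧ ∀ t, Integrable fun x => ⟪f x t, g x t⟫ :=
  cpar (F := fun x t => ⟪f x t, g x t⟫) hF (fun t x hx => by rw [hz t x hx, inner_zero_right])

lemma c_grad {N : ℕ} {k ρ p : ℝ} (hk : 0 < k) (h0 : 0 < ρ) (h1 : ρ ≤ 1) (hp : 0 < p) {w : E N → ℝ → ℝ} (hw : ContDiff ℝ 1 fun p : E N × ℝ => w p.1 p.2)
    (hwp : ∀ x t, 0 < w x t) :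
    (Continuous fun t => ∫ x, ⟪gradient (fun y => w y t) x, gradient (fun y => w y t ^ (-p) * eta k ρ y ^ 2) x⟫) ∧
    ∀ t, ∫ x, ⟪gradient (fun y => w y t) x, gradient (fun y => w y t ^ (-p) * eta k ρ y ^ 2) x⟫ ≤
     -(p / 2) * (∫ x, ‖fderiv ℝ (fun y => w y t) x‖ ^ 2 * w x t ^ (-p - 1) * eta k ρ x ^ 2) +
    72 * (1 + 1 / p) * ∫ x, w x t ^ (1 - p) * zeta ρ x ^ 2 := by
  have he : ContDiff ℝ 1 fun z : E N × ℝ => eta k ρ z.1 ^ 2 := (((eta_smooth k ρ).of_le (by simp)).comp contDiff_fst).pow 2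
  have hΨ : ContDiff ℝ 1 fun z : E N × ℝ => w z.1 z.2 ^ (-p) * eta k ρ z.1 ^ 2 := (rpw hw hwp _).mul he
  have hc : Continuous fun z : E N × ℝ => ⟪gradient (fun y => w y z.2) z.1, gradient (fun y => w y z.2 ^ (-p) * eta k ρ y ^ 2) z.1⟫ :=
    inner_c (slice_grad_cont hw) (slice_grad_cont (G := fun x t => w x t ^ (-p) * eta k ρ x ^ 2) hΨ)
  have hz : ∀ t (x : E N), x ∉ closedBall (0 : E N) ρ → gradient (fun y => w y t ^ (-p) * eta k ρ y ^ 2) x = 0 := fun t x hx => by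
    have : (fun y => w y t ^ (-p) * eta k ρ y ^ 2) =ᶠ[nhds x] fun _ => 0 := by
      filter_upwards [isClosed_closedBall.isOpen_compl.mem_nhds hx] with y hy
      rw [eta_eq hk, zeta_zero' h0 hy]; simp
    rw [this.gradient_eq]; simp [gradient]
  obtain ⟨P1, P2⟩ := cpar2 (f := fun x t => gradient (fun y => w y t) x) (g := fun x t => gradient (fun y => w y t ^ (-p) * eta k ρ y ^ 2) x) hc hz
  constructor
  · exact P1
  · intro t
    have sl : Continuous fun x : E N => (x, t) := by fun_prop
    have c1 : Continuous fun x => ‖fderiv ℝ (fun y => w y t) x‖ ^ 2 * w x t ^ (-p - 1) := by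
      have w1 := slice_diff hw t
      exact ((w1.continuous_fderiv (by norm_num)).norm.pow 2).mul (w1.continuous.rpow_const fun x => Or.inl (hwp x t).ne')
    have c2 : Continuous fun x => w x t ^ (1 - p) := (rpw hw hwp (1 - p)).continuous.comp sl
    have i1 := (eint hk h0 c1).const_mul (-(p / 2))
    have i2 := (zetapow_int h0 (k := 2) (by norm_num) c2).const_mul (72 * (1 + 1 / p))
    rw [← integral_const_mul, ← integral_const_mul, ← integral_add' i1 i2]
    refine integral_mono (P2 t) (i1.add i2) fun x => ?_
    exact grad_ptwise hk h0 h1 hp ((slice_diff hw t).differentiable (by norm_num)) (fun x => hwp x t) x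

lemma grad_cmul {N : ℕ} {f : E N → ℝ} {X : E N} (h : DifferentiableAt ℝ f X) (c : ℝ) :
    gradient (fun y => c * f y) X = c • gradient f X := by
  unfold gradient; rw [fderiv_const_mul h]; simp

lemma weak_scaled {N : ℕ} (hN : 2 ≤ N) {s Λ : ℝ} (hs : s ∈ Ioo (0:ℝ) 1) (hΛ : 1 ≤ Λ) : ∃ C : ℝ, 0 ≤ C ∧
    ∀ {T : ℝ} {Ω : Set (E N)} {K : E N → E N → ℝ → ℝ} {u : E N → ℝ → ℝ}
        {x0 : E N} {R r t0 A a : ℝ} (_ : KernelOK N s Λ T K) (_ : IsWeakSupersolution N T K Ω u)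
        (_ : ball x0 R ⊆ Ω) (_ : Ioo (t0 - r ^ 2) (t0 + r ^ 2) ⊆ Ioo 0 T)
        (_ : ∀ x ∈ ball x0 R, ∀ t ∈ Ioo (t0 - r ^ 2) (t0 + r ^ 2), 0 ≤ u x t)
        (_ : 0 < r) (_ : r ≤ 1) (_ : r < R / 2) (_ : 0 < A) (_ : a ≤ 1)
        (_ : ∀ᵐ t, t ∈ Ioo (t0 - r ^ 2) (t0 + r ^ 2) →
          ∫ y in (ball x0 R)ᶜ, max (-(u y t)) 0 * ‖y - x0‖ ^ (-((N : ℝ) + 2 * s)) ≤ A * r⁻¹ ^ 2)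
        {w : E N → ℝ → ℝ} (_ : ContDiff ℝ (⊤ : ℕ∞) fun p : E N × ℝ => w p.1 p.2) (_ : ∀ x t, 0 < w x t)
        (_ : ∀ X ∈ ball x0 (3 / 2 * r), ∀ t, (t - t0) / r ^ 2 ∈ Ioo (-a) a → u X t = w (r⁻¹ • (X - x0)) ((t - t0) / r ^ 2) - A)
        {l : ℝ → ℝ} (_ : ContDiff ℝ (⊤ : ℕ∞) l) (_ : HasCompactSupport l) (_ : tsupport l ⊆ Ioo (-a) a) (_ : ∀ t, 0 ≤ l t)
        {p k ρ : ℝ} (_ : 0 < p) (_ : 0 < k) (_ : 0 < ρ) (_ : ρ ≤ 1),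
        0 ≤ ∫ t, l t * Gt C k p ρ w t := by
  obtain ⟨C, hC0, hC⟩ := nl_bound hN hs hΛ
  refine ⟨C, hC0, ?_⟩
  intro T Ω K u x0 R r t0 A a hK hu hBΩ hI hupos hr hr1 hrR hA ha htail w hw hwp hwu l hl hlc hls hl0 p k ρ hp hk h0 h1
  have hw1 : ContDiff ℝ 1 fun p : E N × ℝ => w p.1 p.2 := hw.of_le (by simp)
  have hl1 : ContDiff ℝ 1 l := hl.of_le (by simp)
  have r2 : 0 < r ^ 2 := by positivity
  set σ : ℝ → ℝ := fun t => (t - t0) / r ^ 2 with hσ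
  set ξ : E N → E N := fun X => r⁻¹ • (X - x0) with hξ
  set φ : E N → ℝ → ℝ := fun X t => l (σ t) * (w (ξ X) (σ t) ^ (-p) * eta k ρ (ξ X) ^ 2) with hφ
  have σI : ∀ t, σ t ∈ Ioo (-a) a → t ∈ Ioo (t0 - r ^ 2) (t0 + r ^ 2) := fun t ht => by
    simp only [hσ, mem_Ioo] at ht
    rw [lt_div_iff₀ r2, div_lt_iff₀ r2] at ht
    constructor <;> nlinarith
  have l0 : ∀ t, σ t ∉ Ioo (-a) a → l (σ t) = 0 := fun t ht => image_eq_zero_of_notMem_tsupport fun h => ht (hls h)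
  have he0 : ∀ X, X ∉ closedBall x0 r → eta k ρ (ξ X) = 0 := fun x hx => by
    rw [eta_eq hk, zeta_zero h0]; · simp
    rw [mem_closedBall, dist_eq_norm, not_le] at hx
    rw [hξ, norm_smul, norm_inv, Real.norm_of_nonneg hr.le]
    have : 1 ≤ r⁻¹ * ‖x - x0‖ := by rw [inv_mul_eq_div, one_le_div hr]; exact hx.le
    linarith
  have sξ : ContDiff ℝ (⊤ : ℕ∞) ξ := (contDiff_id.sub contDiff_const).const_smul _
  have sσ : ContDiff ℝ (⊤ : ℕ∞) σ := (contDiff_id.sub contDiff_const).div_const _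
  have sφ : ContDiff ℝ (⊤ : ℕ∞) fun z : E N × ℝ => φ z.1 z.2 := by
    have s1 : ContDiff ℝ (⊤ : ℕ∞) fun z : E N × ℝ => (ξ z.1, σ z.2) := (sξ.comp contDiff_fst).prodMk (sσ.comp contDiff_snd)
    have s2 : ContDiff ℝ (⊤ : ℕ∞) fun z : E N × ℝ => w (ξ z.1) (σ z.2) := hw.comp s1
    have s3 : ContDiff ℝ (⊤ : ℕ∞) fun z : E N × ℝ => w (ξ z.1) (σ z.2) ^ (-p) := s2.rpow_const_of_ne fun z => (hwp _ _).ne'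
    have s4 : ContDiff ℝ (⊤ : ℕ∞) fun z : E N × ℝ => eta k ρ (ξ z.1) := (eta_smooth k ρ).comp (sξ.comp contDiff_fst)
    have s5 : ContDiff ℝ (⊤ : ℕ∞) fun z : E N × ℝ => l (σ z.2) := hl.comp (sσ.comp contDiff_snd)
    exact s5.mul (s3.mul (s4.pow 2))
  have hts : tsupport (fun z : E N × ℝ => φ z.1 z.2) ⊆ closedBall x0 r ×ˢ (σ ⁻¹' tsupport l) := by
    refine closure_minimal (fun z hz => ?_) (isClosed_closedBall.prod ((isClosed_tsupport l).preimage sσ.continuous))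
    by_contra hc
    apply hz
    rw [mem_prod, not_and_or] at hc
    rcases hc with h | h
    · simp [hφ, he0 _ h]
    · have : l (σ z.2) = 0 := image_eq_zero_of_notMem_tsupport h
      simp [hφ, this]
  have hBR : closedBall x0 r ⊆ ball x0 R := closedBall_subset_ball (by linarith)
  have hpre : IsCompact (σ ⁻¹' tsupport l) := by
    have e : σ ⁻¹' tsupport l ⊆ (fun τ => t0 + r ^ 2 * τ) '' tsupport l := fun t ht => ⟨σ t, ht, by simp only [hσ]; field_simp; ring⟩
    exact (hlc.isCompact.image (by fun_prop)).of_isClosed_subset ((isClosed_tsupport l).preimage sσ.continuous) e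
  have hcs : HasCompactSupport fun z : E N × ℝ => φ z.1 z.2 :=
    ((isCompact_closedBall x0 r).prod hpre).of_isClosed_subset (isClosed_tsupport _) hts
  have hweak := hu.2.2.2 φ sφ hcs (hts.trans fun z hz => ⟨hBΩ (hBR hz.1), hI (σI _ (hls hz.2))⟩)
    (fun x t => mul_nonneg (hl0 _) (by have := hwp (ξ x) (σ t); positivity))
  -- the three terms
  set c : ℝ := r ^ N * r⁻¹ ^ 2 with hc
  have c0 : 0 < c := by positivity
  have full : ∀ (f : ℝ → ℝ), (∀ t, σ t ∉ Ioo (-a) a → f (σ t) = 0) → ∫ t in Ioo 0 T, c * f (σ t) = r ^ N * ∫ t, f t := by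
    intro f hf
    rw [setIntegral_eq_integral_of_forall_compl_eq_zero, integral_const_mul, cov_t hr, hc]
    · field_simp
    · intro t ht
      rw [hf t fun h => ht (hI (σI t h)), mul_zero]
  obtain ⟨p1, p2, p3⟩ := Gt_parts (p := p) hk h0 hw1 hwp
  have lI : ∀ {f : ℝ → ℝ}, Continuous f → Integrable fun t => l t * f t := fun {f} hf =>
    (hl.continuous.mul hf).integrable_of_hasCompactSupport hlc.mul_right
  have T1 : ∫ t in Ioo 0 T, ∫ x in Ω, u x t * deriv (fun τ => φ x τ) t =
      - (r ^ N * ∫ t, l t * ∫ x, deriv (w x) t * w x t ^ (-p) * eta k ρ x ^ 2) := by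
    have hΦ : ContDiff ℝ 1 fun z : E N × ℝ => l z.2 * (w z.1 z.2 ^ (-p) * eta k ρ z.1 ^ 2) :=
      (hl1.comp contDiff_snd).mul ((rpw hw1 hwp _).mul ((((eta_smooth k ρ).of_le (by simp)).comp contDiff_fst).pow 2))
    have dΦ := (deriv_t_cont (G := fun x t => l t * (w x t ^ (-p) * eta k ρ x ^ 2)) hΦ).1
    have dφ : ∀ X t, deriv (fun τ => φ X τ) t = r⁻¹ ^ 2 * deriv (fun t => l t * (w (ξ X) t ^ (-p) * eta k ρ (ξ X) ^ 2)) (σ t) := fun X t => by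
      have hσd : HasDerivAt σ (1 / r ^ 2) t := ((hasDerivAt_id t).sub_const t0).div_const _
      have h : HasDerivAt (fun τ => φ X τ) _ t := HasDerivAt.comp (h₂ := fun t => l t * (w (ξ X) t ^ (-p) * eta k ρ (ξ X) ^ 2)) t (dΦ (ξ X) (σ t)) hσd
      rw [h.deriv, inv_pow]; ring
    have z1 : ∀ t, σ t ∉ Ioo (-a) a → ∀ x, deriv (fun t => l t * (w x t ^ (-p) * eta k ρ x ^ 2)) (σ t) = 0 := fun t ht x => by
      have : (fun t => l t * (w x t ^ (-p) * eta k ρ x ^ 2)) =ᶠ[nhds (σ t)] fun _ => 0 := by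
        filter_upwards [(isClosed_tsupport l).isOpen_compl.mem_nhds (fun h => ht (hls h))] with y hy
        rw [image_eq_zero_of_notMem_tsupport hy, zero_mul]
      rw [this.deriv_eq]; simp
    have z2 : ∀ X, X ∉ closedBall x0 r → ∀ t, deriv (fun t => l t * (w (ξ X) t ^ (-p) * eta k ρ (ξ X) ^ 2)) t = 0 := fun X hX t => by
      rw [he0 X hX]; simp
    have inn : ∀ t, ∫ x in Ω, u x t * deriv (fun τ => φ x τ) t =
        c * ∫ x, (w x (σ t) - A) * deriv (fun t => l t * (w x t ^ (-p) * eta k ρ x ^ 2)) (σ t) := fun t => by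
      rw [setIntegral_eq_integral_of_forall_compl_eq_zero (fun x hx => by
        rw [dφ, z2 x (fun h => hx (hBΩ (hBR h)))]; simp)]
      have e1 : ∀ X, u X t * deriv (fun τ => φ X τ) t = r⁻¹ ^ 2 * ((w (ξ X) (σ t) - A) * deriv (fun t => l t * (w (ξ X) t ^ (-p) * eta k ρ (ξ X) ^ 2)) (σ t)) := fun X => by
        rw [dφ]
        by_cases hX : X ∈ closedBall x0 r
        · by_cases ht : σ t ∈ Ioo (-a) a
          · rw [hwu X (closedBall_subset_ball (by linarith) hX) t ht]; ring
          · rw [z1 t ht]; simp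
        · rw [z2 X hX]; simp
      simp_rw [e1]
      rw [integral_const_mul, cov_x hr x0 (fun x => (w x (σ t) - A) * deriv (fun t => l t * (w x t ^ (-p) * eta k ρ x ^ 2)) (σ t)), hc]; ring
    simp_rw [inn]
    rw [full (fun τ => ∫ x, (w x τ - A) * deriv (fun t => l t * (w x t ^ (-p) * eta k ρ x ^ 2)) τ) (fun t ht => by simp [z1 t ht]),
      c_time hk h0 hw1 hwp hl1 hlc, mul_neg]
  have T2 : ∫ t in Ioo 0 T, ∫ x in Ω, ⟪gradient (fun y => u y t) x, gradient (fun y => φ y t) x⟫ ≤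
      r ^ N * ∫ t, l t * (-(p / 2) * (∫ x, ‖fderiv ℝ (fun y => w y t) x‖ ^ 2 * w x t ^ (-p - 1) * eta k ρ x ^ 2) +
    72 * (1 + 1 / p) * ∫ x, w x t ^ (1 - p) * zeta ρ x ^ 2) := by
    obtain ⟨g1, g2⟩ := c_grad hk h0 h1 hp hw1 hwp
    have dw : ∀ t, Differentiable ℝ fun x => w x t := fun t => (slice_diff hw1 t).differentiable (by norm_num)
    have dψ : ∀ t, Differentiable ℝ fun x => w x t ^ (-p) * eta k ρ x ^ 2 := fun t =>
      (((slice_diff (G := fun x t => w x t ^ (-p)) (rpw hw1 hwp _) t)).mul (((eta_smooth k ρ).of_le (by simp)).pow 2)).differentiable (by norm_num)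
    have gφ : ∀ X t, gradient (fun y => φ y t) X = l (σ t) • (r⁻¹ • gradient (fun x => w x (σ t) ^ (-p) * eta k ρ x ^ 2) (ξ X)) := fun X t => by
      rw [← grad_scale x0 (dψ (σ t)) X]
      have h1 := ((dψ (σ t)).comp (sξ.differentiable (by simp))) X
      exact grad_cmul h1 _
    have gψ0 : ∀ X, X ∉ closedBall x0 r → ∀ t, gradient (fun x => w x (σ t) ^ (-p) * eta k ρ x ^ 2) (ξ X) = 0 := fun X hX t => by
      have h2 := grad_scale (r := r) x0 (dψ (σ t)) X
      have : (fun Y => w (r⁻¹ • (Y - x0)) (σ t) ^ (-p) * eta k ρ (r⁻¹ • (Y - x0)) ^ 2) =ᶠ[nhds X] fun _ => 0 := by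
        filter_upwards [isClosed_closedBall.isOpen_compl.mem_nhds hX] with y hy
        have := he0 y hy
        simp only [hξ] at this
        rw [this]; simp
      rw [this.gradient_eq] at h2
      have h3 : (0 : E N) = r⁻¹ • gradient (fun x => w x (σ t) ^ (-p) * eta k ρ x ^ 2) (ξ X) := by
        rw [← h2]; simp [gradient]
      exact (smul_eq_zero.1 h3.symm).resolve_left (inv_ne_zero hr.ne')
    have inn : ∀ t, ∫ x in Ω, ⟪gradient (fun y => u y t) x, gradient (fun y => φ y t) x⟫ =
        c * (l (σ t) * ∫ x, ⟪gradient (fun y => w y (σ t)) x, gradient (fun y => w y (σ t) ^ (-p) * eta k ρ y ^ 2) x⟫) := fun t => by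
      rw [setIntegral_eq_integral_of_forall_compl_eq_zero (fun x hx => by
        rw [gφ, gψ0 x (fun h => hx (hBΩ (hBR h)))]; simp)]
      have e1 : ∀ X, ⟪gradient (fun y => u y t) X, gradient (fun y => φ y t) X⟫ =
          r⁻¹ ^ 2 * l (σ t) * ⟪gradient (fun y => w y (σ t)) (ξ X), gradient (fun y => w y (σ t) ^ (-p) * eta k ρ y ^ 2) (ξ X)⟫ := fun X => by
        rw [gφ]
        by_cases hX : X ∈ closedBall x0 r
        · by_cases ht : σ t ∈ Ioo (-a) a
          · have : (fun y => u y t) =ᶠ[nhds X] fun Y => w (r⁻¹ • (Y - x0)) (σ t) - A := by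
              filter_upwards [isOpen_ball.mem_nhds (closedBall_subset_ball (by linarith : r < 3 / 2 * r) hX)] with Y hY
              exact hwu Y hY t ht
            have h3 : gradient (fun Y => w (r⁻¹ • (Y - x0)) (σ t) - A) X = gradient (fun Y => w (r⁻¹ • (Y - x0)) (σ t)) X := by
              unfold gradient; rw [fderiv_sub_const]
            rw [this.gradient_eq, h3, grad_scale x0 (dw (σ t)) X, inner_smul_left, inner_smul_right, inner_smul_right]
            simp only [hξ, conj_trivial]; ring
          · rw [l0 t ht]; simp
        · rw [gψ0 X hX]; simp
      simp_rw [e1]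
      rw [integral_const_mul, cov_x hr x0 (fun x => ⟪gradient (fun y => w y (σ t)) x, gradient (fun y => w y (σ t) ^ (-p) * eta k ρ y ^ 2) x⟫), hc]; ring
    simp_rw [inn]
    rw [full (fun τ => l τ * ∫ x, ⟪gradient (fun y => w y τ) x, gradient (fun y => w y τ ^ (-p) * eta k ρ y ^ 2) x⟫) (fun t ht => by simp [l0 t ht])]
    refine mul_le_mul_of_nonneg_left (integral_mono (lI g1) (lI ((p2.const_mul _).add (p3.const_mul _))) fun t => ?_) (by positivity)
    exact mul_le_mul_of_nonneg_left (g2 t) (hl0 t)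
  have T3 : ∫ t in Ioo 0 T, ∫ x, ∫ y, (u x t - u y t) * (φ x t - φ y t) * K x y t ≤
      r ^ N * ∫ t, l t * (C * (1 + 1 / p) * ∫ x, w x t ^ (1 - p) * zeta ρ x ^ 2) := by
    have q3 : Continuous fun t => C * (1 + 1 / p) * ∫ x, w x t ^ (1 - p) * zeta ρ x ^ 2 := p3.const_mul _
    have z3 : ∀ t, σ t ∉ Ioo (-a) a → (fun t => l t * (C * (1 + 1 / p) * ∫ x, w x t ^ (1 - p) * zeta ρ x ^ 2)) (σ t) = 0 := fun t ht => by simp [l0 t ht]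
    have nn : ∀ t, 0 ≤ l t * (C * (1 + 1 / p) * ∫ x, w x t ^ (1 - p) * zeta ρ x ^ 2) := fun t => by
      have := hl0 t
      have : 0 ≤ ∫ x, w x t ^ (1 - p) * zeta ρ x ^ 2 := integral_nonneg fun x => by have := hwp x t; positivity
      positivity
    rw [← full _ z3]
    refine int_le_dom ?_ (Filter.Eventually.of_forall fun t => mul_nonneg c0.le (nn _)) ?_
    · have : Integrable fun t => c * (l (σ t) * (C * (1 + 1 / p) * ∫ x, w x (σ t) ^ (1 - p) * zeta ρ x ^ 2)) := by
        have i1 := ((lI q3).comp_div (R := r ^ 2) r2.ne').comp_sub_right t0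
        exact i1.const_mul c
      exact this.integrableOn
    · filter_upwards [ae_restrict_of_ae htail, ae_restrict_mem measurableSet_Ioo] with t ht htT
      by_cases hσt : σ t ∈ Ioo (-a) a
      swap
      · have : ∀ X, φ X t = 0 := fun X => by simp [hφ, l0 t hσt]
        simp only [this, sub_self, mul_zero, zero_mul, integral_zero]
        exact mul_nonneg c0.le (nn _)
      obtain ⟨M, hM⟩ := hu.2.1
      have htI := σI t hσt
      have hκ : ∀ x y : E N, x ≠ y → 0 ≤ K x y t ∧ K x y t ≤ Λ * ‖x - y‖ ^ (-((N : ℝ) + 2 * s)) := fun x y hxy => by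
        obtain ⟨h1, h2⟩ := hK.2.2 x y hxy t htT
        exact ⟨le_trans (by positivity) h1, h2⟩
      have hVc : Continuous fun X => w (ξ X) (σ t) :=
        (slice_diff hw1 (σ t)).continuous.comp sξ.continuous
      have hUm : Measurable fun x => u x t := hu.1.comp (by fun_prop : Measurable fun x : E N => (x, t))
      have main := hC hκ (U := fun x => u x t) (V := fun X => w (ξ X) (σ t)) (x0 := x0) (A := A) hr hr1 hrR hp h0 h1 hk hA hUm M
        (fun x => hM x t htT) hVc (fun X => hwp _ _) (fun x hx => hupos x hx t htI)
        (fun x hx => by rw [hwu x (closedBall_subset_ball (by linarith) hx) t hσt]; ring) (ht htI)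
      have e1 : ∫ x, w (ξ x) (σ t) ^ (1 - p) * zeta ρ (r⁻¹ • (x - x0)) ^ 2 = r ^ N * ∫ x, w x (σ t) ^ (1 - p) * zeta ρ x ^ 2 :=
        cov_x hr x0 (fun x => w x (σ t) ^ (1 - p) * zeta ρ x ^ 2)
      rw [e1] at main
      have e2 : ∫ x, ∫ y, (u x t - u y t) * (φ x t - φ y t) * K x y t = l (σ t) * ∫ x, ∫ y, (u x t - u y t) *
          (w (ξ x) (σ t) ^ (-p) * eta k ρ (r⁻¹ • (x - x0)) ^ 2 - w (ξ y) (σ t) ^ (-p) * eta k ρ (r⁻¹ • (y - x0)) ^ 2) * K x y t := by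
        rw [← integral_const_mul]; congr 1; ext x
        rw [← integral_const_mul]; congr 1; ext y
        simp only [hφ, hξ]; ring
      rw [e2]
      refine (mul_le_mul_of_nonneg_left main (hl0 _)).trans (le_of_eq ?_)
      simp only [hc]; ring
  have q2 : Continuous fun t => (-(p / 2) * (∫ x, ‖fderiv ℝ (fun y => w y t) x‖ ^ 2 * w x t ^ (-p - 1) * eta k ρ x ^ 2) +
    72 * (1 + 1 / p) * ∫ x, w x t ^ (1 - p) * zeta ρ x ^ 2) := (p2.const_mul _).add (p3.const_mul _)
  have e : ∫ t, l t * Gt C k p ρ w t = (∫ t, l t * ∫ x, deriv (w x) t * w x t ^ (-p) * eta k ρ x ^ 2) +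
      (∫ t, l t * (-(p / 2) * (∫ x, ‖fderiv ℝ (fun y => w y t) x‖ ^ 2 * w x t ^ (-p - 1) * eta k ρ x ^ 2) +
    72 * (1 + 1 / p) * ∫ x, w x t ^ (1 - p) * zeta ρ x ^ 2)) + ∫ t, l t * (C * (1 + 1 / p) * ∫ x, w x t ^ (1 - p) * zeta ρ x ^ 2) := by
    have q3 : Continuous fun t => C * (1 + 1 / p) * ∫ x, w x t ^ (1 - p) * zeta ρ x ^ 2 := p3.const_mul _
    have i1 := lI p1
    have i2 := lI q2
    have i3 := lI q3
    rw [← integral_add' i1 i2]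
    have i12 := i1.add i2
    rw [← integral_add' i12 i3]
    congr 1; ext t; simp only [Gt, Pi.add_apply]; ring
  rw [e]
  rw [T1] at hweak
  have rN : 0 < r ^ N := by positivity
  refine nonneg_of_mul_nonneg_right ?_ rN
  linarith

lemma bump_nonneg {f : ℝ → ℝ} (hf : Continuous f) {a : ℝ} (h : ∀ l : ℝ → ℝ, ContDiff ℝ (⊤ : ℕ∞) l → HasCompactSupport l →
    tsupport l ⊆ Ioo (-a) a → (∀ t, 0 ≤ l t) → 0 ≤ ∫ t, l t * f t) {t : ℝ} (ht : t ∈ Ioo (-a) a) : 0 ≤ f t := by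
  by_contra hn
  push Not at hn
  obtain ⟨δ, hδ, hB⟩ := Metric.isOpen_iff.1 ((isOpen_Iio.preimage hf).inter isOpen_Ioo) t ⟨hn, ht⟩
  let b : ContDiffBump t := ⟨δ / 3, δ / 2, by positivity, by linarith⟩
  have hs : tsupport b ⊆ ball t δ := by
    rw [b.tsupport_eq]; exact closedBall_subset_ball (by change δ / 2 < δ; linarith)
  have h1 := h b b.contDiff b.hasCompactSupport (fun x hx => (hB (hs hx)).2) (fun x => b.nonneg)
  have h2 : 0 < ∫ x, -(b x * f x) := by
    have hc : Continuous fun x => -(b x * f x) := (b.continuous.mul hf).neg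
    refine hc.integral_pos_of_hasCompactSupport_nonneg_nonzero (x := t) ?_ (fun x => ?_) ?_
    · exact (b.hasCompactSupport.mul_right (f' := f)).neg
    · by_cases hx : x ∈ tsupport b
      · have := (hB (hs hx)).1
        have h4 : f x < 0 := this
        have := b.nonneg (x := x)
        simp only [Pi.zero_apply]; nlinarith
      · simp [image_eq_zero_of_notMem_tsupport hx]
    · have : b t = 1 := b.one_of_mem_closedBall (by simp [b.rIn_pos.le])
      rw [this]; simp; linarith
  rw [integral_neg] at h2
  linarith

lemma elim {N : ℕ} {ρ : ℝ} (h0 : 0 < ρ) {F : E N → ℝ} (hF : Continuous F) :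
    Filter.Tendsto (fun n : ℕ => ∫ x, F x * eta ((n : ℝ) + 1) ρ x ^ 2) Filter.atTop (nhds (∫ x, F x * zeta ρ x ^ 4)) := by
  have hi := (zetapow_int h0 (k := 4) (by norm_num) hF).norm
  refine tendsto_integral_of_dominated_convergence _ (fun n => ?_) hi (fun n => ?_) ?_
  · exact (hF.mul ((eta_smooth _ _).continuous.pow 2)).aestronglyMeasurable
  · refine Filter.Eventually.of_forall fun x => ?_
    have h1 := eta_le (k := (n : ℝ) + 1) (by positivity) ρ x
    have h2 := eta_nonneg ((n : ℝ) + 1) ρ x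
    rw [norm_mul, norm_mul]
    refine mul_le_mul_of_nonneg_left ?_ (norm_nonneg _)
    rw [Real.norm_of_nonneg (by positivity), Real.norm_of_nonneg (by positivity)]
    calc eta ((n : ℝ) + 1) ρ x ^ 2 ≤ (zeta ρ x ^ 2) ^ 2 := pow_le_pow_left₀ h2 h1 2
      _ = _ := by ring
  · refine Filter.Eventually.of_forall fun x => ?_
    have := ((eta_lim ρ x).pow 2).const_mul (F x)
    convert this using 2; ring

lemma ss_of_gt {N : ℕ} {C a : ℝ} {w : E N → ℝ → ℝ} (hw : ContDiff ℝ (⊤ : ℕ∞) fun p : E N × ℝ => w p.1 p.2)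
    (hwp : ∀ x t, 0 < w x t) (h : ∀ l : ℝ → ℝ, ContDiff ℝ (⊤ : ℕ∞) l → HasCompactSupport l →
    tsupport l ⊆ Ioo (-a) a → (∀ t, 0 ≤ l t) → ∀ p k ρ, 0 < p → 0 < k → 0 < ρ → ρ ≤ 1 → 0 ≤ ∫ t, l t * Gt C k p ρ w t) :
    SS N (C + 72) a w := by
  refine ⟨hw.of_le (WithTop.coe_le_coe.2 le_top : (((2 : ℕ∞) : WithTop ℕ∞)) ≤ _), hwp, ?_⟩
  intro t ht p hp ρ hρ
  have hw1 : ContDiff ℝ 1 fun p : E N × ℝ => w p.1 p.2 := hw.of_le (by simp)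
  have key : ∀ n : ℕ, 0 ≤ Gt C ((n : ℝ) + 1) p ρ w t := fun n =>
    bump_nonneg (Gt_cont (by positivity) hρ.1 hw1 hwp) (fun l h1 h2 h3 h4 => h l h1 h2 h3 h4 p _ ρ hp (by positivity) hρ.1 hρ.2) ht
  have sl : Continuous fun x : E N => (x, t) := by fun_prop
  have w1 := slice_diff hw1 t
  have c0 : ∀ m : ℝ, Continuous fun x => w x t ^ m := fun m => w1.continuous.rpow_const fun x => Or.inl (hwp x t).ne'
  have c1 : Continuous fun x => ‖fderiv ℝ (fun y => w y t) x‖ ^ 2 * w x t ^ (-p - 1) :=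
    ((w1.continuous_fderiv (by norm_num)).norm.pow 2).mul (c0 _)
  have c2 : Continuous fun x => deriv (w x) t * w x t ^ (-p) := ((deriv_t_cont hw1).2.comp sl).mul (c0 _)
  have L := ((elim hρ.1 c2).add (((elim hρ.1 c1).const_mul (-(p / 2))).add_const (72 * (1 + 1 / p) * ∫ x, w x t ^ (1 - p) * zeta ρ x ^ 2))).add_const
    (C * (1 + 1 / p) * ∫ x, w x t ^ (1 - p) * zeta ρ x ^ 2)
  have := ge_of_tendsto' L key
  linarith

lemma wk {N : ℕ} (hN : 2 ≤ N) {s Λ : ℝ} (hs : s ∈ Ioo (0:ℝ) 1) (hΛ : 1 ≤ Λ) : ∃ C : ℝ, 0 ≤ C ∧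
    ∀ {T : ℝ} {Ω : Set (E N)} {K : E N → E N → ℝ → ℝ} {u : E N → ℝ → ℝ}
        {x0 : E N} {R r t0 A a : ℝ} (_ : KernelOK N s Λ T K) (_ : IsWeakSupersolution N T K Ω u)
        (_ : ball x0 R ⊆ Ω) (_ : Ioo (t0 - r ^ 2) (t0 + r ^ 2) ⊆ Ioo 0 T)
        (_ : ∀ x ∈ ball x0 R, ∀ t ∈ Ioo (t0 - r ^ 2) (t0 + r ^ 2), 0 ≤ u x t)
        (_ : 0 < r) (_ : r ≤ 1) (_ : r < R / 2) (_ : 0 < A) (_ : a ≤ 1)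
        (_ : ∀ᵐ t, t ∈ Ioo (t0 - r ^ 2) (t0 + r ^ 2) →
          ∫ y in (ball x0 R)ᶜ, max (-(u y t)) 0 * ‖y - x0‖ ^ (-((N : ℝ) + 2 * s)) ≤ A * r⁻¹ ^ 2)
        {w : E N → ℝ → ℝ} (_ : ContDiff ℝ (⊤ : ℕ∞) fun p : E N × ℝ => w p.1 p.2) (_ : ∀ x t, 0 < w x t)
        (_ : ∀ X ∈ ball x0 (3 / 2 * r), ∀ t, (t - t0) / r ^ 2 ∈ Ioo (-a) a → u X t = w (r⁻¹ • (X - x0)) ((t - t0) / r ^ 2) - A),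
        SS N C a w := by
  obtain ⟨C, hC0, hC⟩ := weak_scaled hN hs hΛ
  refine ⟨C + 72, by positivity, ?_⟩
  intro T Ω K u x0 R r t0 A a hK hu hBΩ hI hupos hr hr1 hrR hA ha htail w hw hwp hwu
  exact ss_of_gt hw hwp fun l h1 h2 h3 h4 p k ρ hp hk h0 h1' =>
    hC hK hu hBΩ hI hupos hr hr1 hrR hA ha htail hw hwp hwu h1 h2 h3 h4 hp hk h0 h1'

lemma tail_ae {N : ℕ} (hN : 2 ≤ N) {s T : ℝ} (hs : s ∈ Ioo (0:ℝ) 1) {u : E N → ℝ → ℝ} {x0 : E N} {R r t0 𝒯 A M : ℝ}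
    (hM : ∀ x t, t ∈ Ioo 0 T → |u x t| ≤ M) (hI : Ioo (t0 - r ^ 2) (t0 + r ^ 2) ⊆ Ioo 0 T) (hr : 0 < r) (hR : 0 < R)
    (h𝒯 : 𝒯 = (r / R) ^ 2 * tailInfty N s (uminus N u) x0 R (t0 - r ^ 2) (t0 + r ^ 2)) (hA : 𝒯 ≤ A) :
    (∀ᵐ t, t ∈ Ioo (t0 - r ^ 2) (t0 + r ^ 2) →
          ∫ y in (ball x0 R)ᶜ, max (-(u y t)) 0 * ‖y - x0‖ ^ (-((N : ℝ) + 2 * s)) ≤ A * r⁻¹ ^ 2) ∧ 0 ≤ 𝒯 := by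
  set F : ℝ → ℝ := fun t => ∫ y in (ball x0 R)ᶜ, |uminus N u y t| * ‖y - x0‖ ^ (-((N : ℝ) + 2 * s)) with hF
  set μ := volume.restrict (Ioo (t0 - r ^ 2) (t0 + r ^ 2)) with hμ
  have i1 : Integrable fun y : E N => M * max 1 (R⁻¹ ^ 2) * (min (‖y - x0‖ ^ 2) 1 * ‖y - x0‖ ^ (-((N : ℝ) + 2 * s))) :=
    ((m1_int hN hs).comp_sub_right x0).const_mul _
  have hb : ∀ t ∈ Ioo (t0 - r ^ 2) (t0 + r ^ 2), F t ≤ ∫ y in (ball x0 R)ᶜ, M * max 1 (R⁻¹ ^ 2) * (min (‖y - x0‖ ^ 2) 1 * ‖y - x0‖ ^ (-((N : ℝ) + 2 * s))) := by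
    intro t ht
    have hM0 : 0 ≤ M := (abs_nonneg _).trans (hM x0 t (hI ht))
    refine int_le_dom i1.integrableOn (Filter.Eventually.of_forall fun y => by positivity) ?_
    filter_upwards [ae_restrict_mem measurableSet_ball.compl] with y hy
    have hy' : R ≤ ‖y - x0‖ := by simpa [dist_eq_norm] using hy
    have h1 : |uminus N u y t| ≤ M := by
      unfold uminus
      rw [abs_of_nonneg (le_max_right _ _)]
      exact max_le ((neg_le_abs _).trans (hM y t (hI ht))) hM0
    have h2 : 1 ≤ max 1 (R⁻¹ ^ 2) * min (‖y - x0‖ ^ 2) 1 := by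
      rcases le_total (‖y - x0‖ ^ 2) 1 with h | h
      · rw [min_eq_left h]
        calc 1 = R⁻¹ ^ 2 * R ^ 2 := by field_simp
          _ ≤ _ := by gcongr; exact le_max_right _ _
      · rw [min_eq_right h, mul_one]; exact le_max_left _ _
    have h3 : 0 ≤ ‖y - x0‖ ^ (-((N : ℝ) + 2 * s)) := by positivity
    calc _ ≤ M * ‖y - x0‖ ^ (-((N : ℝ) + 2 * s)) := mul_le_mul_of_nonneg_right h1 h3
      _ = M * (1 * ‖y - x0‖ ^ (-((N : ℝ) + 2 * s))) := by ring
      _ ≤ M * ((max 1 (R⁻¹ ^ 2) * min (‖y - x0‖ ^ 2) 1) * ‖y - x0‖ ^ (-((N : ℝ) + 2 * s))) := by gcongr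
      _ = _ := by ring
  have h1 : ∀ᵐ t ∂μ, F t ≤ essSup F μ := by
    refine ae_le_essSup (Filter.isBoundedUnder_of_eventually_le (a := ∫ y in (ball x0 R)ᶜ, M * max 1 (R⁻¹ ^ 2) * (min (‖y - x0‖ ^ 2) 1 * ‖y - x0‖ ^ (-((N : ℝ) + 2 * s)))) ?_)
    filter_upwards [ae_restrict_mem measurableSet_Ioo] with t ht using hb t ht
  have h2 : 𝒯 = r ^ 2 * essSup F μ := by rw [h𝒯, tailInfty, ← mul_assoc, ← mul_pow, div_mul_cancel₀ _ hR.ne']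
  have hF0 : ∀ t, 0 ≤ F t := fun t => integral_nonneg fun y => by positivity
  have r2 : 0 < r ^ 2 := by positivity
  constructor
  · rw [ae_restrict_iff' measurableSet_Ioo] at h1
    filter_upwards [h1] with t ht htI
    have e : F t = ∫ y in (ball x0 R)ᶜ, max (-(u y t)) 0 * ‖y - x0‖ ^ (-((N : ℝ) + 2 * s)) := by
      simp only [hF, uminus]; congr 1; ext y; rw [abs_of_nonneg (le_max_right _ _)]
    rw [← e]
    refine (ht htI).trans ?_
    have : essSup F μ = 𝒯 * r⁻¹ ^ 2 := by rw [h2]; field_simp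
    rw [this]; gcongr
  · rw [h2]
    refine mul_nonneg r2.le ?_
    have : (ae μ).NeBot := by
      rw [ae_neBot, hμ]; intro h
      rw [Measure.restrict_eq_zero, Real.volume_Ioo, ENNReal.ofReal_eq_zero] at h; linarith
    obtain ⟨t, ht⟩ := h1.exists
    exact (hF0 t).trans ht

lemma mk_w {N : ℕ} {T : ℝ} {Ω : Set (E N)} {u : E N → ℝ → ℝ} {x0 : E N} {R r t0 A a : ℝ}
    (hu : ContDiffOn ℝ (⊤ : ℕ∞) (fun p : E N × ℝ => u p.1 p.2) (Ω ×ˢ Set.Ioo 0 T))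
    (hBΩ : ball x0 R ⊆ Ω) (hI : Ioo (t0 - r ^ 2) (t0 + r ^ 2) ⊆ Ioo 0 T)
    (hup : ∀ x ∈ ball x0 R, ∀ t ∈ Ioo (t0 - r ^ 2) (t0 + r ^ 2), 0 ≤ u x t)
    (hr : 0 < r) (hrR : r < R / 2) (hA : 0 < A) (ha0 : 0 < a) (ha1 : a < 1) :
    ∃ w : E N → ℝ → ℝ, (ContDiff ℝ (⊤ : ℕ∞) fun p : E N × ℝ => w p.1 p.2) ∧ (∀ x t, 0 < w x t) ∧
      ∀ x ∈ ball (0 : E N) (3 / 2), ∀ t ∈ Ioo (-a) a, w x t = u (x0 + r • x) (t0 + r ^ 2 * t) + A := by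
  let θ : ContDiffBump (0 : E N) := ⟨3 / 2, 2, by norm_num, by norm_num⟩
  let η : ContDiffBump (0 : ℝ) := ⟨a, (a + 1) / 2, ha0, by linarith⟩
  have r2 : 0 < r ^ 2 := by positivity
  have hx : ∀ x ∈ closedBall (0 : E N) 2, x0 + r • x ∈ ball x0 R := fun x hx => by
    rw [mem_closedBall_zero_iff] at hx
    rw [mem_ball, dist_eq_norm, add_sub_cancel_left, norm_smul, Real.norm_of_nonneg hr.le]
    nlinarith
  have htt : ∀ t ∈ closedBall (0 : ℝ) ((a + 1) / 2), t0 + r ^ 2 * t ∈ Ioo (t0 - r ^ 2) (t0 + r ^ 2) := fun t ht => by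
    rw [mem_closedBall_zero_iff, Real.norm_eq_abs, abs_le] at ht
    constructor <;> nlinarith
  let F : E N × ℝ → ℝ := fun p => u (x0 + r • p.1) (t0 + r ^ 2 * p.2) + A - 1
  refine ⟨fun x t => 1 + θ x * η t * F (x, t), ?_, ?_, ?_⟩
  · refine contDiff_const.add ?_
    refine contDiff_iff_contDiffAt.2 fun p => ?_
    by_cases hp' : p ∈ closedBall (0 : E N) 2 ×ˢ closedBall (0 : ℝ) ((a + 1) / 2)
    swap
    · refine (contDiffAt_const (c := (0 : ℝ))).congr_of_eventuallyEq ?_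
      filter_upwards [(isClosed_closedBall.prod isClosed_closedBall).isOpen_compl.mem_nhds hp'] with z hc
      rw [mem_compl_iff, mem_prod, not_and_or] at hc
      rcases hc with h | h
      · have : θ z.1 = 0 := image_eq_zero_of_notMem_tsupport (by rw [θ.tsupport_eq]; exact h)
        simp [this]
      · have : η z.2 = 0 := image_eq_zero_of_notMem_tsupport (by rw [η.tsupport_eq]; exact h)
        simp [this]
    have h1 : ContDiffAt ℝ (⊤ : ℕ∞) (fun p : E N × ℝ => u p.1 p.2) (x0 + r • p.1, t0 + r ^ 2 * p.2) := by
      refine hu.contDiffAt ?_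
      refine Filter.mem_of_superset ((isOpen_ball.prod isOpen_Ioo).mem_nhds ⟨hx _ hp'.1, htt _ hp'.2⟩) ?_
      exact prod_mono hBΩ hI
    have h2 : ContDiff ℝ (⊤ : ℕ∞) fun p : E N × ℝ => (x0 + r • p.1, t0 + r ^ 2 * p.2) := by fun_prop
    have h3 : ContDiffAt ℝ (⊤ : ℕ∞) F p := ((h1.comp p h2.contDiffAt).add contDiffAt_const).sub contDiffAt_const
    exact (((θ.contDiff.comp contDiff_fst).mul (η.contDiff.comp contDiff_snd)).contDiffAt).mul h3
  · intro x t
    have a1 := θ.nonneg (x := x)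
    have a2 := θ.le_one (x := x)
    have b1 := η.nonneg (x := t)
    have b2 := η.le_one (x := t)
    have c1 : 0 ≤ θ x * η t := mul_nonneg a1 b1
    have c2 : θ x * η t ≤ 1 := mul_le_one₀ a2 b1 b2
    by_cases h : x ∈ closedBall (0 : E N) 2 ∧ t ∈ closedBall (0 : ℝ) ((a + 1) / 2)
    · have := hup _ (hx x h.1) _ (htt t h.2)
      simp only [F]
      rcases c1.eq_or_lt with h0 | h0
      · rw [← h0]; simp
      · nlinarith
    · have : θ x * η t = 0 := by
        rw [not_and_or] at h
        rcases h with h | h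
        · rw [image_eq_zero_of_notMem_tsupport (f := θ) (by rw [θ.tsupport_eq]; exact h), zero_mul]
        · rw [image_eq_zero_of_notMem_tsupport (f := η) (by rw [η.tsupport_eq]; exact h), mul_zero]
      simp only [this]; norm_num
  · intro x hx t ht
    have e1 : θ x = 1 := θ.one_of_mem_closedBall (ball_subset_closedBall hx)
    have e2 : η t = 1 := η.one_of_mem_closedBall (by
      rw [mem_closedBall_zero_iff, Real.norm_eq_abs, abs_le]; exact ⟨ht.1.le, ht.2.le⟩)
    simp only [e1, e2, F]; ring

lemma toSS {N : ℕ} (hN : 2 ≤ N) {s Λ : ℝ} (hs : s ∈ Ioo (0:ℝ) 1) (hΛ : 1 ≤ Λ) : ∃ C : ℝ, 0 ≤ C ∧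
    ∀ {T : ℝ} {Ω : Set (E N)} {K : E N → E N → ℝ → ℝ} {u : E N → ℝ → ℝ}
        {x0 : E N} {R r t0 𝒯 : ℝ} (_ : KernelOK N s Λ T K) (_ : IsWeakSupersolution N T K Ω u)
        (_ : ball x0 R ⊆ Ω) (_ : Ioo (t0 - r ^ 2) (t0 + r ^ 2) ⊆ Ioo 0 T)
        (_ : ∀ x ∈ ball x0 R, ∀ t ∈ Ioo (t0 - r ^ 2) (t0 + r ^ 2), 0 ≤ u x t)
        (_ : 0 < r) (_ : r ≤ 1) (_ : r < R / 2)
        (_ : 𝒯 = (r / R) ^ 2 * tailInfty N s (uminus N u) x0 R (t0 - r ^ 2) (t0 + r ^ 2)),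
        0 ≤ 𝒯 ∧ ∀ ε > 0, ∀ a ∈ Ioo (0 : ℝ) 1, ∃ w : E N → ℝ → ℝ, SS N C a w ∧
      ∀ x ∈ ball (0 : E N) (3 / 2), ∀ t ∈ Ioo (-a) a, w x t = u (x0 + r • x) (t0 + r ^ 2 * t) + (𝒯 + ε) := by
  obtain ⟨C, hC0, hC⟩ := wk hN hs hΛ
  refine ⟨C, hC0, ?_⟩
  intro T Ω K u x0 R r t0 𝒯 hK hu hBΩ hI hupos hr hr1 hrR h𝒯
  obtain ⟨M, hM⟩ := hu.2.1
  have tl := fun A (hA : 𝒯 ≤ A) => tail_ae hN hs hM hI hr (by linarith) h𝒯 hA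
  have h0 := (tl 𝒯 le_rfl).2
  refine ⟨h0, fun ε hε a ha => ?_⟩
  have hA : 0 < 𝒯 + ε := by positivity
  obtain ⟨w, hw, hwp, hwu⟩ := mk_w hu.2.2.1 hBΩ hI hupos hr hrR hA ha.1 ha.2
  refine ⟨w, hC hK hu hBΩ hI hupos hr hr1 hrR hA ha.2.le (tl _ (by linarith)).1 hw hwp ?_, hwu⟩
  intro X hX t ht
  have hX' : r⁻¹ • (X - x0) ∈ ball (0 : E N) (3 / 2) := by
    rw [mem_ball, dist_eq_norm] at hX
    rw [mem_ball_zero_iff, norm_smul, norm_inv, Real.norm_of_nonneg hr.le, inv_mul_lt_iff₀ hr]; linarith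
  rw [hwu _ hX' _ ht, smul_inv_smul₀ hr.ne', mul_div_cancel₀ _ (by positivity)]
  simp

lemma cov_S {N : ℕ} {r : ℝ} (hr : 0 < r) (x0 : E N) (t0 b c : ℝ) (f : E N × ℝ → ℝ)
    (hf : IntegrableOn f (ball x0 (r / 2) ×ˢ Ioo (t0 + r ^ 2 * b) (t0 + r ^ 2 * c))) :
    ∫ p in ball x0 (r / 2) ×ˢ Ioo (t0 + r ^ 2 * b) (t0 + r ^ 2 * c), f p =
      r ^ N * r ^ 2 * ∫ t in Ioo b c, ∫ x in ball (0 : E N) (1 / 2), f (x0 + r • x, t0 + r ^ 2 * t) := by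
  have r2 : 0 < r ^ 2 := by positivity
  have hx : ∀ g : E N → ℝ, ∫ x in ball x0 (r / 2), g x = r ^ N * ∫ x in ball (0 : E N) (1 / 2), g (x0 + r • x) := fun g => by
    rw [← integral_indicator measurableSet_ball, ← integral_indicator measurableSet_ball, ← cov_x hr x0]
    congr 1; ext X
    have e : x0 + r • r⁻¹ • (X - x0) = X := by rw [smul_inv_smul₀ hr.ne']; simp
    have e2 : r⁻¹ • (X - x0) ∈ ball (0 : E N) (1 / 2) ↔ X ∈ ball x0 (r / 2) := by
      rw [mem_ball_zero_iff, norm_smul, norm_inv, Real.norm_of_nonneg hr.le, inv_mul_lt_iff₀ hr, mem_ball, dist_eq_norm]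
      ring_nf
    by_cases h : X ∈ ball x0 (r / 2)
    · rw [indicator_of_mem h, indicator_of_mem (e2.2 h), e]
    · rw [indicator_of_notMem h, indicator_of_notMem (fun h' => h (e2.1 h'))]
  have ht : ∀ g : ℝ → ℝ, ∫ t in Ioo (t0 + r ^ 2 * b) (t0 + r ^ 2 * c), g t = r ^ 2 * ∫ t in Ioo b c, g (t0 + r ^ 2 * t) := fun g => by
    rw [← integral_indicator measurableSet_Ioo, ← integral_indicator measurableSet_Ioo, ← cov_t hr t0]
    congr 1; ext t
    have e : t0 + r ^ 2 * ((t - t0) / r ^ 2) = t := by rw [mul_div_cancel₀ _ r2.ne']; ring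
    have e2 : (t - t0) / r ^ 2 ∈ Ioo b c ↔ t ∈ Ioo (t0 + r ^ 2 * b) (t0 + r ^ 2 * c) := by
      rw [mem_Ioo, mem_Ioo, lt_div_iff₀ r2, div_lt_iff₀ r2]
      constructor <;> rintro ⟨h1, h2⟩ <;> constructor <;> linarith
    by_cases h : t ∈ Ioo (t0 + r ^ 2 * b) (t0 + r ^ 2 * c)
    · rw [indicator_of_mem h, indicator_of_mem (e2.2 h), e]
    · rw [indicator_of_notMem h, indicator_of_notMem (fun h' => h (e2.1 h'))]
  rw [IntegrableOn, Measure.volume_eq_prod, ← Measure.prod_restrict] at hf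
  rw [Measure.volume_eq_prod, ← Measure.prod_restrict, integral_prod_symm _ hf, ht]
  simp_rw [hx]
  rw [integral_const_mul]; ring

lemma kappa_le {N : ℕ} (hN : 2 ≤ N) : 2 - 2 / kappa N ≤ chi N := by
  unfold kappa chi
  split_ifs with h
  · have h1 : (2 : ℝ) < N := by exact_mod_cast h
    have h2 : (N : ℝ) - 2 ≠ 0 := by linarith
    have h3 : (N : ℝ) ≠ 0 := by linarith
    apply le_of_eq; field_simp; ring
  · have : N = 2 := by omega
    subst this; norm_num

lemma core {N : ℕ} (hN : 2 ≤ N) {s Λ : ℝ} (hs : s ∈ Ioo (0:ℝ) 1) (hΛ : 1 ≤ Λ) {q : ℝ} (hq0 : 0 < q) (hq1 : q < 2 - 2 / kappa N) :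
    ∃ C : ℝ, 0 < C ∧
    ∀ {T : ℝ} {Ω : Set (E N)} {K : E N → E N → ℝ → ℝ} {u : E N → ℝ → ℝ}
        {x0 : E N} {R r t0 𝒯 : ℝ} (_ : KernelOK N s Λ T K) (_ : IsWeakSupersolution N T K Ω u)
        (_ : ball x0 R ⊆ Ω) (_ : Ioo (t0 - r ^ 2) (t0 + r ^ 2) ⊆ Ioo 0 T)
        (_ : ∀ x ∈ ball x0 R, ∀ t ∈ Ioo (t0 - r ^ 2) (t0 + r ^ 2), 0 ≤ u x t)
        (_ : 0 < r) (_ : r ≤ 1) (_ : r < R / 2)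
        (_ : 𝒯 = (r / R) ^ 2 * tailInfty N s (uminus N u) x0 R (t0 - r ^ 2) (t0 + r ^ 2)),
        0 ≤ 𝒯 ∧ ∀ y ∈ ball x0 (r / 2), ∀ t ∈ Ioo (t0 + 3 * r ^ 2 / 4) (t0 + r ^ 2),
        ∫ p in ball x0 (r / 2) ×ˢ Ioo (t0 - r ^ 2) (t0 - 3 * r ^ 2 / 4), (u p.1 p.2 + 𝒯) ^ q ≤ r ^ N * r ^ 2 * (C * (u y t + 𝒯) ^ q) := by
  obtain ⟨C0, hC0, hS⟩ := toSS hN hs hΛ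
  obtain ⟨C, hC, hP⟩ := phaseE hN hC0 hq0 (hq1.trans_le (kappa_le hN)) (1 / 2) ⟨le_rfl, by norm_num⟩ (3 / 4) ⟨by norm_num, le_rfl⟩
  refine ⟨C, hC, ?_⟩
  intro T Ω K u x0 R r t0 𝒯 hK hu hBΩ hI hup hr hr1 hrR h𝒯
  obtain ⟨h𝒯0, hw⟩ := hS hK hu hBΩ hI hup hr hr1 hrR h𝒯
  refine ⟨h𝒯0, fun y hy t ht => ?_⟩
  obtain ⟨M, hM⟩ := hu.2.1
  have r2 : 0 < r ^ 2 := by positivity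
  have hBB : ball x0 (r / 2) ⊆ ball x0 R := ball_subset_ball (by linarith)
  have eI : Ioo (t0 - r ^ 2) (t0 - 3 * r ^ 2 / 4) = Ioo (t0 + r ^ 2 * (-1)) (t0 + r ^ 2 * (-(3 / 4))) := by
    congr 1 <;> ring
  set S := ball x0 (r / 2) ×ˢ Ioo (t0 - r ^ 2) (t0 - 3 * r ^ 2 / 4) with hSd
  have hSI : ∀ p ∈ S, p.1 ∈ ball x0 R ∧ p.2 ∈ Ioo (t0 - r ^ 2) (t0 + r ^ 2) := fun p hp => ⟨hBB hp.1, hp.2.1, by linarith [hp.2.2]⟩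
  have int : ∀ ε, 0 ≤ ε → IntegrableOn (fun p : E N × ℝ => (u p.1 p.2 + (𝒯 + ε)) ^ q) S := fun ε hε => by
    refine Measure.integrableOn_of_bounded (M := (M + (𝒯 + ε)) ^ q) ?_ ?_ ?_
    · refine (Bornology.IsBounded.measure_lt_top (isBounded_ball.prod (isBounded_Ioo _ _))).ne
    · exact ((hu.1.add_const _).pow_const q).aestronglyMeasurable
    · filter_upwards [ae_restrict_mem (measurableSet_ball.prod measurableSet_Ioo)] with p hp
      obtain ⟨h1, h2⟩ := hSI p hp
      have h3 := hup _ h1 _ h2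
      have h4 := hM p.1 p.2 (hI h2)
      rw [Real.norm_of_nonneg (by positivity)]
      exact Real.rpow_le_rpow (by positivity) (by linarith [le_abs_self (u p.1 p.2)]) hq0.le
  have huyt : 0 ≤ u y t := hup y (hBB hy) t ⟨by linarith [ht.1], ht.2⟩
  -- fixed sub-cylinder and `ε`
  have step : ∀ T1 ∈ Ioo (3 / 4 : ℝ) 1, ∀ ε > 0,
      ∫ p in ball x0 (r / 2) ×ˢ Ioo (t0 + r ^ 2 * (-T1)) (t0 + r ^ 2 * (-(3 / 4))), (u p.1 p.2 + 𝒯) ^ q ≤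
        r ^ N * r ^ 2 * (C * (u y t + (𝒯 + ε)) ^ q) := by
    intro T1 hT1 ε hε
    set S1 := ball x0 (r / 2) ×ˢ Ioo (t0 + r ^ 2 * (-T1)) (t0 + r ^ 2 * (-(3 / 4))) with hS1
    have hsub : S1 ⊆ S := by
      rw [hS1, hSd, eI]
      refine prod_mono le_rfl (Ioo_subset_Ioo_left ?_)
      nlinarith [hT1.2]
    have i0 := int 0 le_rfl
    simp only [add_zero] at i0
    have i1 := (int ε hε.le).mono_set hsub
    have m1 : ∫ p in S1, (u p.1 p.2 + 𝒯) ^ q ≤ ∫ p in S1, (u p.1 p.2 + (𝒯 + ε)) ^ q := by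
      refine setIntegral_mono_on (i0.mono_set hsub) i1 (measurableSet_ball.prod measurableSet_Ioo) fun p hp => ?_
      obtain ⟨h1, h2⟩ := hSI p (hsub hp)
      have h3 := hup _ h1 _ h2
      exact Real.rpow_le_rpow (by positivity) (by linarith) hq0.le
    refine m1.trans ?_
    rw [cov_S hr x0 t0 _ _ _ i1]
    refine mul_le_mul_of_nonneg_left ?_ (by positivity)
    set τ := (t - t0) / r ^ 2 with hτ
    have hτ1 : 3 / 4 < τ ∧ τ < 1 := by
      rw [hτ, lt_div_iff₀ r2, div_lt_iff₀ r2]; constructor <;> linarith [ht.1, ht.2]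
    obtain ⟨a, ha1, ha2⟩ := exists_between (max_lt hT1.2 hτ1.2)
    have haT := (le_max_left _ _).trans_lt ha1
    have haτ := (le_max_right _ _).trans_lt ha1
    have ha0 : 3 / 4 < a := hT1.1.trans haT
    obtain ⟨w, hSS, hwu⟩ := hw ε hε a ⟨by linarith, ha2⟩
    have hys : r⁻¹ • (y - x0) ∈ ball (0 : E N) (1 / 2) := by
      rw [mem_ball, dist_eq_norm] at hy
      rw [mem_ball_zero_iff, norm_smul, norm_inv, Real.norm_of_nonneg hr.le, inv_mul_lt_iff₀ hr]; linarith
    have fin := hP a w hSS ha2.le T1 ⟨hT1.1, haT⟩ _ hys τ ⟨hτ1.1, haτ⟩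
    have hb : ball (0 : E N) (1 / 2) ⊆ ball 0 (3 / 2) := ball_subset_ball (by norm_num)
    rw [hwu _ (hb hys) τ ⟨by linarith, haτ⟩, smul_inv_smul₀ hr.ne', hτ, mul_div_cancel₀ _ r2.ne', add_sub_cancel, add_sub_cancel] at fin
    refine le_trans (le_of_eq ?_) fin
    rw [sint, intervalIntegral.integral_of_le (by linarith [hT1.1]), integral_Ioc_eq_integral_Ioo]
    refine setIntegral_congr_fun measurableSet_Ioo fun t' ht' => ?_
    have : Nontrivial (E N) := by
      have : Nonempty (Fin N) := ⟨⟨0, by omega⟩⟩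
      infer_instance
    have hae : (closedBall (0 : E N) (1 / 2) : Set (E N)) =ᵐ[volume] ball (0 : E N) (1 / 2) := by
      rw [← ball_union_sphere]
      exact union_ae_eq_left_of_ae_eq_empty (ae_eq_empty.2 (Measure.addHaar_sphere _ _ _))
    simp only
    rw [setIntegral_congr_set hae]
    refine setIntegral_congr_fun measurableSet_ball fun x hx => ?_
    rw [hwu x (hb hx) t' ⟨by linarith [ht'.1], by linarith [ht'.2]⟩]
  -- let `ε → 0`
  have step2 : ∀ T1 ∈ Ioo (3 / 4 : ℝ) 1,
      ∫ p in ball x0 (r / 2) ×ˢ Ioo (t0 + r ^ 2 * (-T1)) (t0 + r ^ 2 * (-(3 / 4))), (u p.1 p.2 + 𝒯) ^ q ≤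
        r ^ N * r ^ 2 * (C * (u y t + 𝒯) ^ q) := by
    intro T1 hT1
    have hc : Continuous fun ε : ℝ => r ^ N * r ^ 2 * (C * (u y t + (𝒯 + ε)) ^ q) := by
      have : Continuous fun ε : ℝ => (u y t + (𝒯 + ε)) ^ q := (by fun_prop : Continuous fun ε : ℝ => u y t + (𝒯 + ε)).rpow_const fun _ => Or.inr hq0.le
      fun_prop
    have := (hc.tendsto 0).mono_left (nhdsWithin_le_nhds (s := Ioi 0))
    simp only [add_zero] at this
    refine ge_of_tendsto this ?_
    filter_upwards [self_mem_nhdsWithin] with ε hε using step T1 hT1 ε hε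
  have hU : ⋃ n : ℕ, ball x0 (r / 2) ×ˢ Ioo (t0 + r ^ 2 * (-(1 - 1 / ((n : ℝ) + 5)))) (t0 + r ^ 2 * (-(3 / 4))) = S := by
    rw [hSd, eI, ← prod_iUnion]
    congr 1
    ext t'
    simp only [mem_iUnion, mem_Ioo]
    constructor
    · rintro ⟨n, h1, h2⟩
      refine ⟨lt_of_le_of_lt ?_ h1, h2⟩
      have : (0 : ℝ) < 1 / ((n : ℝ) + 5) := by positivity
      nlinarith
    · rintro ⟨h1, h2⟩
      obtain ⟨n, hn⟩ := exists_nat_one_div_lt (K := ℝ) (ε := (t' - t0 + r ^ 2) / r ^ 2) (div_pos (by linarith) r2)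
      refine ⟨n, ?_, h2⟩
      have h3 : 1 / ((n : ℝ) + 5) ≤ 1 / ((n : ℝ) + 1) := by gcongr; norm_num
      have h4 := h3.trans_lt hn
      rw [lt_div_iff₀ r2] at h4
      linarith
  have i0 := int 0 le_rfl
  simp only [add_zero] at i0
  have lim := tendsto_setIntegral_of_monotone (μ := volume) (f := fun p : E N × ℝ => (u p.1 p.2 + 𝒯) ^ q)
    (s := fun n : ℕ => ball x0 (r / 2) ×ˢ Ioo (t0 + r ^ 2 * (-(1 - 1 / ((n : ℝ) + 5)))) (t0 + r ^ 2 * (-(3 / 4))))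
    (fun n => measurableSet_ball.prod measurableSet_Ioo) (fun n m hnm => by
      refine prod_mono le_rfl (Ioo_subset_Ioo_left ?_)
      have : 1 / ((m : ℝ) + 5) ≤ 1 / ((n : ℝ) + 5) := by gcongr
      nlinarith) (by rw [hU]; exact i0)
  rw [hU] at lim
  refine le_of_tendsto' lim fun n => step2 _ ⟨?_, ?_⟩
  · have : 1 / ((n : ℝ) + 5) ≤ 1 / 5 := by gcongr; linarith [n.cast_nonneg (α := ℝ)]
    linarith
  · have : (0 : ℝ) < 1 / ((n : ℝ) + 5) := by positivity
    linarith

theorem stmt_16 (N : ℕ) (hN : 2 ≤ N) (s Λ : ℝ) (hs : s ∈ Set.Ioo (0 : ℝ) 1)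
    (hΛ : 1 ≤ Λ) (q : ℝ) (hq0 : 0 < q) (hq1 : q < 2 - 2 / kappa N) :
    ∃ C : ℝ, 0 < C ∧
      ∀ (T : ℝ) (Ω : Set (E N)) (K : E N → E N → ℝ → ℝ) (u : E N → ℝ → ℝ)
        (x₀ : E N) (R r t₀ 𝒯 : ℝ),
        0 < T → IsOpen Ω → Bornology.IsBounded Ω →
        KernelOK N s Λ T K → IsWeakSupersolution N T K Ω u →
        Metric.ball x₀ R ⊆ Ω → Set.Ioo (t₀ - r ^ 2) (t₀ + r ^ 2) ⊆ Set.Ioo 0 T →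
        (∀ x ∈ Metric.ball x₀ R, ∀ t ∈ Set.Ioo (t₀ - r ^ 2) (t₀ + r ^ 2), 0 ≤ u x t) →
        0 < r → r ≤ 1 → r < R / 2 →
        𝒯 = (r / R) ^ 2 * tailInfty N s (uminus N u) x₀ R (t₀ - r ^ 2) (t₀ + r ^ 2) →
        (⨍ p in (Metric.ball x₀ (r / 2)) ×ˢ Set.Ioo (t₀ - r ^ 2) (t₀ - 3 * r ^ 2 / 4),
            (u p.1 p.2 + 𝒯) ^ q) ^ (1 / q) ≤
          C * (essInf (fun p : E N × ℝ => u p.1 p.2)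
                (volume.restrict
                  ((Metric.ball x₀ (r / 2)) ×ˢ Set.Ioo (t₀ + 3 * r ^ 2 / 4) (t₀ + r ^ 2)))
              + 𝒯) := by
  obtain ⟨C, hC, hcore⟩ := core hN hs hΛ hq0 hq1
  set m := volume.real (ball (0 : E N) (1 / 2)) with hm
  have m0 : 0 < m := ENNReal.toReal_pos (measure_ball_pos _ _ (by norm_num)).ne' measure_ball_lt_top.ne
  set D := (4 * C / m) ^ (1 / q) with hD
  have D0 : 0 < D := by positivity
  refine ⟨D, D0, ?_⟩
  intro T Ω K u x0 R r t0 𝒯 _ _ _ hK hu hBΩ hI hup hr hr1 hrR h𝒯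
  obtain ⟨h𝒯0, hc⟩ := hcore hK hu hBΩ hI hup hr hr1 hrR h𝒯
  have r2 : 0 < r ^ 2 := by positivity
  set S := ball x0 (r / 2) ×ˢ Ioo (t0 - r ^ 2) (t0 - 3 * r ^ 2 / 4) with hSd
  have hBB : ball x0 (r / 2) ⊆ ball x0 R := ball_subset_ball (by linarith)
  have vol : volume.real S = r ^ N * r ^ 2 * (m / 4) := by
    have hf : volume S ≠ ⊤ := (Bornology.IsBounded.measure_lt_top (isBounded_ball.prod (isBounded_Ioo _ _))).ne
    have e : volume.real S = ∫ p in S, (1 : ℝ) := by simp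
    have eI : Ioo (t0 - r ^ 2) (t0 - 3 * r ^ 2 / 4) = Ioo (t0 + r ^ 2 * (-1)) (t0 + r ^ 2 * (-(3 / 4))) := by
      congr 1 <;> ring
    have hi : IntegrableOn (fun _ : E N × ℝ => (1 : ℝ)) S := integrableOn_const hf
    rw [hSd, eI] at hi
    rw [e, hSd, eI, cov_S hr x0 t0 _ _ _ hi]
    simp only [integral_const, smul_eq_mul, mul_one, measureReal_restrict_apply_univ, Real.volume_real_Ioo, ← hm]
    rw [show max (-(3 / 4 : ℝ) - -1) 0 = 1 / 4 by norm_num]; ring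
  obtain ⟨M, hM⟩ := hu.2.1
  set μ := volume.restrict (ball x0 (r / 2) ×ˢ Ioo (t0 + 3 * r ^ 2 / 4) (t0 + r ^ 2)) with hμ
  set L := (⨍ p in S, (u p.1 p.2 + 𝒯) ^ q) ^ (1 / q) with hL
  have mem : ∀ᵐ p ∂μ, p ∈ ball x0 (r / 2) ×ˢ Ioo (t0 + 3 * r ^ 2 / 4) (t0 + r ^ 2) :=
    ae_restrict_mem (measurableSet_ball.prod measurableSet_Ioo)
  have hle : ∀ᵐ p ∂μ, L / D - 𝒯 ≤ u p.1 p.2 := by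
    filter_upwards [mem] with p hp
    have h1 := hc p.1 hp.1 p.2 hp.2
    have hu0 : 0 ≤ u p.1 p.2 := hup _ (hBB hp.1) _ ⟨by linarith [hp.2.1], hp.2.2⟩
    have avg : ⨍ p in S, (u p.1 p.2 + 𝒯) ^ q ≤ 4 * C / m * (u p.1 p.2 + 𝒯) ^ q := by
      rw [setAverage_eq, vol, smul_eq_mul, inv_mul_le_iff₀ (by positivity)]
      refine h1.trans (le_of_eq ?_)
      field_simp
    have nn : 0 ≤ ⨍ p in S, (u p.1 p.2 + 𝒯) ^ q := by
      rw [setAverage_eq, smul_eq_mul]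
      refine mul_nonneg (by positivity) (setIntegral_nonneg (measurableSet_ball.prod measurableSet_Ioo) fun p' hp' => ?_)
      have : 0 ≤ u p'.1 p'.2 := hup _ (hBB hp'.1) _ ⟨hp'.2.1, by linarith [hp'.2.2]⟩
      positivity
    have h2 : L ≤ D * (u p.1 p.2 + 𝒯) := by
      refine (Real.rpow_le_rpow nn avg (by positivity)).trans (le_of_eq ?_)
      rw [Real.mul_rpow (by positivity) (by positivity), ← Real.rpow_mul (by positivity), mul_one_div_cancel hq0.ne', Real.rpow_one]
    have h3 : L / D ≤ u p.1 p.2 + 𝒯 := by rw [div_le_iff₀' D0]; exact h2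
    linarith
  have : (ae μ).NeBot := by
    rw [ae_neBot, hμ]; intro h
    rw [Measure.restrict_eq_zero] at h
    refine ((isOpen_ball.prod isOpen_Ioo).measure_pos volume ?_).ne' h
    exact (nonempty_ball.2 (by positivity)).prod (nonempty_Ioo.2 (by linarith))
  have hbd : Filter.IsBoundedUnder (· ≤ ·) (ae μ) (fun p : E N × ℝ => u p.1 p.2) := by
    refine Filter.isBoundedUnder_of_eventually_le (a := M) ?_
    filter_upwards [mem] with p hp
    exact (le_abs_self _).trans (hM _ _ (hI ⟨by linarith [hp.2.1], hp.2.2⟩))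
  have fin := le_essInf_of_ae_le (L / D - 𝒯) hle hbd.isCoboundedUnder_ge
  have : L / D ≤ essInf (fun p : E N × ℝ => u p.1 p.2) μ + 𝒯 := by linarith
  rwa [div_le_iff₀' D0] at this
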